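/- arXiv:1103.5809 — 4 statements merged into one kernel-verified Lean document; each statement's English description precedes it below -/
import Mathlib

section
/- Let p_1,...,p_n ∈ P^2 be distinct K-points and let I = ∩_i I(p_i) ⊆ K[x_0,x_1,x_2]. Set α_m = α(I^(m)) and β_m = β(I^(m)). Then α_m · β_m ≥ m^2 · n for every m ≥ 1. -/
open MvPolynomial
open scoped LinearAlgebra.Projectivization

noncomputable section

/-- The homogeneous vanishing ideal of a point of projective `N`-space:
the ideal generated by all forms vanishing at the point. -/
def pointIdeal {K : Type*} [Field K] {N : ℕ} (q : ℙ K (Fin (N + 1) → K)) :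
    Ideal (MvPolynomial (Fin (N + 1)) K) :=
  Ideal.span {f | (∃ d : ℕ, f.IsHomogeneous d) ∧ MvPolynomial.eval q.rep f = 0}

/-- `α(J)`: the least degree of a nonzero form in `J`. -/
def alphaDeg {σ K : Type*} [CommSemiring K] (J : Ideal (MvPolynomial σ K)) : ℕ :=
  sInf {d : ℕ | ∃ f ∈ J, f ≠ 0 ∧ MvPolynomial.IsHomogeneous f d}

/-- `β(J)`: the least degree `d` such that the degree-`d` graded piece of `J`
contains a regular sequence of length two. -/
def betaDeg {σ K : Type*} [CommRing K] (J : Ideal (MvPolynomial σ K)) : ℕ :=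
  sInf {d : ℕ | ∃ f g : MvPolynomial σ K, f ∈ J ∧ g ∈ J ∧
    f.IsHomogeneous d ∧ g.IsHomogeneous d ∧
    RingTheory.Sequence.IsRegular (MvPolynomial σ K) [f, g]}

theorem exists_mem_pow_isRelPrime {σ K : Type*} [Field K] {J : Ideal (MvPolynomial σ K)} {d : ℕ}
    {f g h : MvPolynomial σ K} (hf : f ∈ J) (hg : g ∈ J) (hfd : f.IsHomogeneous d)
    (hgd : g.IsHomogeneous d) (hfg : IsRelPrime f g) (hh : h ≠ 0) :
    ∃ N, 1 ≤ N ∧ ∃ F ∈ J ^ N, F.IsHomogeneous (d * N) ∧ IsRelPrime h F := by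
  classical
  let P (X : MvPolynomial σ K) := (UniqueFactorizationMonoid.factors h).toFinset.filter (¬ · ∣ X)
  suffices H : ∀ k M X, X ∈ J ^ M → X.IsHomogeneous (d * M) → IsRelPrime X g → (P X).card = k →
      ∃ N, 1 ≤ N ∧ ∃ F ∈ J ^ N, F.IsHomogeneous (d * N) ∧ IsRelPrime h F from
    H _ 0 1 (by simp) (by simpa using isHomogeneous_one σ K) isRelPrime_one_left rfl
  intro k
  induction k using Nat.strong_induction_on with
  | _ k ih =>
    intro M X hX hXd hXg hk
    have hF : X * f + g ^ (M + 1) ∈ J ^ (M + 1) := by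
      refine add_mem ?_ (Ideal.pow_mem_pow hg _)
      rw [pow_succ]
      exact Ideal.mul_mem_mul hX hf
    have hFd : (X * f + g ^ (M + 1)).IsHomogeneous (d * (M + 1)) := by
      refine IsHomogeneous.add ?_ (hgd.pow _)
      rw [mul_add, mul_one]
      exact hXd.mul hfd
    by_cases hrel : IsRelPrime h (X * f + g ^ (M + 1))
    · exact ⟨M + 1, by lia, _, hF, hFd, hrel⟩
    obtain ⟨q, hqh, hqF, hq⟩ : ∃ q, q ∣ h ∧ q ∣ X * f + g ^ (M + 1) ∧ Irreducible q := by
      by_contra! hcon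
      exact hrel (WfDvdMonoid.isRelPrime_of_no_irreducible_factors (by simp [hh])
        fun z hz hzh hzF => hcon z hzh hzF hz)
    obtain ⟨π, hπ, hqπ⟩ := UniqueFactorizationMonoid.exists_mem_factors_of_dvd hh hq hqh
    have hπ' := UniqueFactorizationMonoid.prime_of_factor π hπ
    have hπF := hqπ.symm.dvd.trans hqF
    have hπX : ¬ π ∣ X := fun hd => hπ'.not_isUnit <| hXg hd <|
      hπ'.dvd_of_dvd_pow ((dvd_add_right (hd.mul_right f)).1 hπF)
    refine ih _ ?_ (M + (M + 1)) (X * (X * f + g ^ (M + 1))) ?_ ?_ ?_ rfl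
    · rw [← hk]
      refine Finset.card_lt_card (Finset.ssubset_iff_of_subset ?_ |>.2 ⟨π, ?_, ?_⟩)
      · intro r hr
        simp only [P, Finset.mem_filter] at hr ⊢
        exact ⟨hr.1, fun h => hr.2 (h.mul_right _)⟩
      · simp [P, hπ, hπX]
      · simp [P, hπF.mul_left]
    · rw [pow_add]; exact Ideal.mul_mem_mul hX hF
    · rw [mul_add d]; exact hXd.mul hFd
    · refine IsRelPrime.mul_left hXg fun r hrF hrg => ?_
      have hr : r ∣ X * f :=
        (dvd_add_left (dvd_pow hrg (Nat.succ_ne_zero M))).1 hrF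
      exact hfg (IsRelPrime.dvd_of_dvd_mul_left (hXg.symm.of_dvd_left hrg) hr) hrg

open scoped Pointwise in
theorem isRelPrime_of_isRegular_pair {R : Type*} [CommRing R] [IsDomain R]
    {f g : R} (h : RingTheory.Sequence.IsRegular R [f, g]) : IsRelPrime f g := by
  rw [RingTheory.Sequence.isRegular_cons_iff] at h
  obtain ⟨hf, h⟩ := h
  have hg := ((RingTheory.Sequence.isRegular_cons_iff _ _ _).1 h).1
  have hf0 : f ≠ 0 := by rintro rfl; simpa using hf (a₁ := 0) (a₂ := 1)
  rintro r ⟨a, rfl⟩ ⟨b, rfl⟩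
  have : a ∈ (r * a) • (⊤ : Submodule R R) := by
    have := @hg (Submodule.Quotient.mk a) 0 (by
      dsimp only
      rw [← Submodule.Quotient.mk_smul, smul_zero, Submodule.Quotient.mk_eq_zero]
      exact (Submodule.mem_smul_pointwise_iff_exists _ _ _).2 ⟨b, trivial, by simp; ring⟩)
    exact (Submodule.Quotient.mk_eq_zero _).1 this
  obtain ⟨c, -, hc⟩ := (Submodule.mem_smul_pointwise_iff_exists _ _ _).1 this
  have ha : a ≠ 0 := right_ne_zero_of_mul hf0
  exact IsUnit.of_mul_eq_one c (mul_right_cancel₀ ha (by simpa [mul_right_comm] using hc))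

open scoped Pointwise in
theorem isRegular_pair_of_isRelPrime {R : Type*} [CommRing R] [IsDomain R] [DecompositionMonoid R]
    {f g : R} (hf : f ≠ 0) (hfg : IsRelPrime f g) {J : Ideal R} (hJ : J ≠ ⊤) (hfJ : f ∈ J)
    (hgJ : g ∈ J) : RingTheory.Sequence.IsRegular R [f, g] where
  toIsWeaklyRegular := by
    rw [RingTheory.Sequence.isWeaklyRegular_cons_iff,
      RingTheory.Sequence.isWeaklyRegular_singleton_iff]
    refine ⟨IsSMulRegular.of_ne_zero hf, isSMulRegular_iff_right_eq_zero_of_smul.2 fun x hx => ?_⟩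
    obtain ⟨x, rfl⟩ := Submodule.Quotient.mk_surjective _ x
    rw [← Submodule.Quotient.mk_smul, Submodule.Quotient.mk_eq_zero] at hx
    obtain ⟨c, -, hc⟩ := (Submodule.mem_smul_pointwise_iff_exists _ _ _).1 hx
    rw [Submodule.Quotient.mk_eq_zero]
    obtain ⟨e, rfl⟩ := hfg.dvd_of_dvd_mul_left ⟨c, hc.symm⟩
    exact (Submodule.mem_smul_pointwise_iff_exists _ _ _).2 ⟨e, trivial, rfl⟩
  top_ne_smul := by
    intro h
    apply hJ
    rw [smul_eq_mul, Ideal.mul_top] at h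
    rw [eq_top_iff, h, Ideal.ofList, Ideal.span_le]
    rintro x hx
    simp at hx
    rcases hx with rfl | rfl <;> assumption

attribute [local instance] MvPolynomial.gradedAlgebra in
theorem IsHomogeneous.exists_eq_mul {σ K : Type*} [Field K] {F u : MvPolynomial σ K} {b c : ℕ}
    (hF : F.IsHomogeneous b) (hu : u.IsHomogeneous (b + c)) (h : F ∣ u) :
    ∃ w : MvPolynomial σ K, w.IsHomogeneous c ∧ u = F * w := by
  obtain ⟨w, rfl⟩ := h
  refine ⟨DirectSum.decompose (homogeneousSubmodule σ K) w c,
    SetLike.coe_mem (DirectSum.decompose (homogeneousSubmodule σ K) w c), ?_⟩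
  rw [← DirectSum.coe_decompose_mul_add_of_left_mem (homogeneousSubmodule σ K) hF,
    DirectSum.decompose_of_mem_same _ hu]

theorem finrank_homogeneousSubmodule_fin_three (K : Type*) [Field K] (t : ℕ) :
    Module.finrank K (homogeneousSubmodule (Fin 3) K t) = (t + 2).choose 2 := by
  classical
  rw [homogeneousSubmodule_eq_finsupp_supported,
    ← restrictSupport, Module.finrank_eq_nat_card_basis (basisRestrictSupport K _)]
  have : {d : Fin 3 →₀ ℕ | d.degree = t} =
      ((Finset.univ : Finset (Fin 3)).finsuppAntidiag t : Set (Fin 3 →₀ ℕ)) := by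
    ext; simp [Finsupp.degree_eq_sum]
  rw [this]
  rw [Nat.card_eq_card_toFinset, Finset.toFinset_coe, Finset.card_finsuppAntidiag_nat_eq_choose,
    Finset.card_univ, Fintype.card_fin, Nat.choose_symm_of_eq_add (b := 2)]
  · congr 1; lia
  · lia

/-- The exponents of bivariate monomials of degree less than `s`. -/
def jetExponents (s : ℕ) : Finset (Fin 2 →₀ ℕ) :=
  (Finset.range s).biUnion fun r => Finset.univ.finsuppAntidiag r

theorem mem_jetExponents {s : ℕ} {d : Fin 2 →₀ ℕ} : d ∈ jetExponents s ↔ d.degree < s := by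
  simp [jetExponents, Finsupp.degree_eq_sum]

theorem card_jetExponents (s : ℕ) : (jetExponents s).card = (s + 1).choose 2 := by
  rw [jetExponents, Finset.card_biUnion]
  · simp only [Finset.card_finsuppAntidiag_nat_eq_choose]
    induction s with
    | zero => rfl
    | succ s ih =>
      rw [Finset.sum_range_succ, ih, Nat.choose_succ_succ' (s + 1) 1, add_comm]
      simp
      rw [add_comm]
      exact Nat.choose_succ_self_right s
  · intro i _ j _ hij
    rw [Function.onFun, Finset.disjoint_left]
    simp only [Finset.mem_finsuppAntidiag]
    rintro a ⟨h1, -⟩ ⟨h2, -⟩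
    exact hij (h1.symm.trans h2)

theorem finrank_map_add_le {K V W : Type*} [Field K] [AddCommGroup V] [Module K V]
    [AddCommGroup W] [Module K W] (E : V →ₗ[K] W) {U S : Submodule K V} [Module.Finite K S]
    (h : U ≤ S) :
    Module.finrank K (S.map E) + Module.finrank K U ≤
      Module.finrank K S + Module.finrank K (U.map E) := by
  have : Module.Finite K U := Submodule.finiteDimensional_of_le h
  have h1 := (E.domRestrict S).finrank_range_add_finrank_ker
  have h2 := (E.domRestrict U).finrank_range_add_finrank_ker
  rw [LinearMap.range_domRestrict] at h1 h2
  have h3 := (LinearMap.finrank_le_finrank_of_injective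
    (f := (Submodule.inclusion h).restrict (p := LinearMap.ker (E.domRestrict U))
      (q := LinearMap.ker (E.domRestrict S)) fun x hx => by simpa using hx) (by
      intro x y hxy
      apply Subtype.ext; apply Subtype.ext
      exact congrArg (fun z : LinearMap.ker (E.domRestrict S) => ((z : S) : V)) hxy))
  lia

theorem finrank_map_le_of_ker_le {K V W W' : Type*} [Field K] [AddCommGroup V] [Module K V]
    [AddCommGroup W] [Module K W] [AddCommGroup W'] [Module K W'] [Module.Finite K W']
    (E : V →ₗ[K] W) (E' : V →ₗ[K] W')  (h : LinearMap.ker E' ≤ LinearMap.ker E) :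
    Module.finrank K (LinearMap.range E) ≤ Module.finrank K W' := by
  rw [← Submodule.range_liftQ _ E h]
  have := Module.Finite.equiv E'.quotKerEquivRange.symm
  calc _ ≤ Module.finrank K (V ⧸ LinearMap.ker E') := LinearMap.finrank_range_le _
    _ = Module.finrank K (LinearMap.range E') := E'.quotKerEquivRange.finrank_eq
    _ ≤ _ := Submodule.finrank_le _

section Dehomogenization

variable {K : Type*} [Field K]

theorem mem_idealOfVars_of_constantCoeff {σ : Type*} {f : MvPolynomial σ K}
    (hf : constantCoeff f = 0) : f ∈ idealOfVars σ K := by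
  rw [← pow_one (idealOfVars _ _), mem_pow_idealOfVars_iff']
  intro x hx
  rwa [(Finsupp.degree_eq_zero_iff x).1 (Nat.lt_one_iff.1 hx)]

/-- Restriction of a ternary polynomial to the affine plane through `v` on which the `j`-th
coordinate is constant, in coordinates centred at `v`. -/
def dehomogenize (v : Fin 3 → K) (j : Fin 3) :
    MvPolynomial (Fin 3) K →ₐ[K] MvPolynomial (Fin 2) K :=
  aeval (j.insertNth (α := fun _ => MvPolynomial (Fin 2) K) (C (v j))
    fun k => C (v (j.succAbove k)) + X k)

@[simp]
theorem dehomogenize_X_self (v : Fin 3 → K) (j : Fin 3) :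
    dehomogenize v j (X j) = C (v j) := by
  simp [dehomogenize]

@[simp]
theorem dehomogenize_X_succAbove (v : Fin 3 → K) (j : Fin 3) (k : Fin 2) :
    dehomogenize v j (X (j.succAbove k)) = C (v (j.succAbove k)) + X k := by
  simp [dehomogenize]

theorem constantCoeff_dehomogenize (v : Fin 3 → K) (j : Fin 3) (f : MvPolynomial (Fin 3) K) :
    constantCoeff (dehomogenize v j f) = eval v f := by
  induction f using MvPolynomial.induction_on with
  | C a => simp [dehomogenize]
  | add p q hp hq => simp [hp, hq]
  | mul_X p i hp =>
    rw [map_mul, map_mul, hp, map_mul, eval_X]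
    congr 1
    rcases Fin.eq_self_or_eq_succAbove j i with rfl | ⟨k, rfl⟩ <;> simp

/-- A linear form vanishing at `v`, whose dehomogenization at `v` is the `k`-th coordinate. -/
def linForm (v : Fin 3 → K) (j : Fin 3) (k : Fin 2) : MvPolynomial (Fin 3) K :=
  X (j.succAbove k) - C (v (j.succAbove k) / v j) * X j

theorem isHomogeneous_linForm (v : Fin 3 → K) (j : Fin 3) (k : Fin 2) :
    (linForm v j k).IsHomogeneous 1 :=
  (isHomogeneous_X _ _).sub (isHomogeneous_C_mul_X _ _)

theorem dehomogenize_linForm {v : Fin 3 → K} {j : Fin 3} (hj : v j ≠ 0) (k : Fin 2) :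
    dehomogenize v j (linForm v j k) = X k := by
  have : dehomogenize v j (C (v (j.succAbove k) / v j)) = C (v (j.succAbove k) / v j) :=
    (dehomogenize v j).commutes _
  rw [linForm, map_sub, map_mul, this, dehomogenize_X_self, dehomogenize_X_succAbove, ← C_mul,
    div_mul_cancel₀ _ hj, add_sub_cancel_left]

theorem linForm_ne_zero {v : Fin 3 → K} {j : Fin 3} (hj : v j ≠ 0) (k : Fin 2) :
    linForm v j k ≠ 0 := fun h => by
  have := dehomogenize_linForm hj k
  rw [h, map_zero] at this
  exact X_ne_zero k this.symm

theorem linForm_mem_pointIdeal {q : ℙ K (Fin (2 + 1) → K)} {j : Fin 3} (hj : q.rep j ≠ 0)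
    (k : Fin 2) : linForm q.rep j k ∈ pointIdeal q := by
  refine Ideal.subset_span ⟨⟨1, isHomogeneous_linForm _ _ _⟩, ?_⟩
  simp [linForm, hj]

theorem isRelPrime_linForm (v : Fin 3 → K) (j : Fin 3) :
    IsRelPrime (linForm v j 0) (linForm v j 1) := by
  have hval (k l : Fin 2) : eval (Pi.single (j.succAbove k) 1) (linForm v j l) =
      if l = k then 1 else 0 := by
    simp [linForm, Pi.single_apply, (Fin.succAbove_ne j k).symm]
  have hne (k : Fin 2) : linForm v j k ≠ 0 := fun h => by simpa [h] using hval k k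
  rintro r ⟨a, ha⟩ hr
  have hra : r ≠ 0 ∧ a ≠ 0 := by rw [← mul_ne_zero_iff, ← ha]; exact hne 0
  have hdeg : r.totalDegree + a.totalDegree = 1 := by
    rw [← totalDegree_mul_of_isDomain hra.1 hra.2, ← ha,
      (isHomogeneous_linForm v j 0).totalDegree (hne 0)]
  have hunit {x : MvPolynomial (Fin 3) K} (hx : x ≠ 0) (hx' : x.totalDegree = 0) : IsUnit x := by
    rw [totalDegree_eq_zero_iff_eq_C] at hx'
    rw [hx'] at hx ⊢
    exact (IsUnit.mk0 _ (by simpa using hx)).map C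
  rcases Nat.eq_zero_or_pos r.totalDegree with h0 | h0
  · exact hunit hra.1 h0
  · obtain ⟨a', ha'⟩ := hunit hra.2 (by lia)
    obtain ⟨b, hb⟩ : linForm v j 0 ∣ linForm v j 1 := by
      rw [ha, ← ha']
      exact (Units.mul_right_dvd).2 hr
    have := congrArg (eval (Pi.single (j.succAbove 1) 1)) hb
    rw [map_mul, hval, hval] at this
    simp at this

theorem dehomogenize_mem_pow {q : ℙ K (Fin (2 + 1) → K)} (j : Fin 3) {s : ℕ}
    {f : MvPolynomial (Fin 3) K} (hf : f ∈ pointIdeal q ^ s) :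
    dehomogenize q.rep j f ∈ idealOfVars (Fin 2) K ^ s := by
  have h : pointIdeal q ≤ (idealOfVars (Fin 2) K).comap (dehomogenize q.rep j) := by
    refine Ideal.span_le.2 fun g hg => ?_
    exact mem_idealOfVars_of_constantCoeff ((constantCoeff_dehomogenize _ _ _).trans hg.2)
  exact Ideal.le_comap_pow _ _ (Ideal.pow_right_mono h s hf)

theorem exists_dehomogenize_eq {v : Fin 3 → K} {j : Fin 3} (hj : v j ≠ 0)
    (r : MvPolynomial (Fin 2) K) {t : ℕ} (ht : r.totalDegree ≤ t) :
    ∃ u : MvPolynomial (Fin 3) K, u.IsHomogeneous t ∧ dehomogenize v j u = r := by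
  suffices r ∈ (homogeneousSubmodule (Fin 3) K t).map (dehomogenize v j).toLinearMap from this
  rw [r.as_sum]
  refine Submodule.sum_mem _ fun d hd => ?_
  have hdt : d 0 + d 1 ≤ t := by
    refine le_trans (le_of_eq ?_) ((le_totalDegree hd).trans ht)
    rw [Finsupp.sum_fintype _ _ (by simp), Fin.sum_univ_two]
  refine ⟨C (coeff d r) * (linForm v j 0 ^ d 0 * linForm v j 1 ^ d 1 *
    (C (v j)⁻¹ * X j) ^ (t - d 0 - d 1)), ?_, ?_⟩
  · have := ((((isHomogeneous_linForm v j 0).pow (d 0)).mul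
      ((isHomogeneous_linForm v j 1).pow (d 1))).mul
      ((isHomogeneous_C_mul_X (v j)⁻¹ j).pow (t - d 0 - d 1))).C_mul (coeff d r)
    rwa [show 1 * d 0 + 1 * d 1 + 1 * (t - d 0 - d 1) = t by lia] at this
  · have hC (c : K) : dehomogenize v j (C c) = C c := (dehomogenize v j).commutes _
    simp only [AlgHom.toLinearMap_apply, map_mul, map_pow, dehomogenize_linForm hj, hC,
      dehomogenize_X_self]
    rw [← C_mul, inv_mul_cancel₀ hj, C_1, one_pow, mul_one, monomial_eq,
      Finsupp.prod_fintype _ _ (by simp), Fin.prod_univ_two]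

theorem exists_mul_sub_mem_pow {σ : Type*} {p : MvPolynomial σ K} (hp : constantCoeff p ≠ 0)
    (r : MvPolynomial σ K) (s : ℕ) : ∃ u, p * u - r ∈ idealOfVars σ K ^ s := by
  have hx : C (constantCoeff p) - p ∈ idealOfVars σ K :=
    mem_idealOfVars_of_constantCoeff (by simp)
  have hu : IsUnit (Ideal.Quotient.mk (idealOfVars σ K ^ s) p) := by
    have h1 : IsUnit (Ideal.Quotient.mk (idealOfVars σ K ^ s) (C (constantCoeff p))) :=
      ((IsUnit.mk0 _ hp).map C).map _
    have h2 : IsNilpotent (Ideal.Quotient.mk (idealOfVars σ K ^ s) (C (constantCoeff p) - p)) :=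
      ⟨s, by rw [← map_pow, Ideal.Quotient.eq_zero_iff_mem]; exact Ideal.pow_mem_pow hx s⟩
    have := h2.neg.isUnit_add_left_of_commute h1 (Commute.all _ _)
    rwa [← map_neg, ← map_add, neg_sub, add_sub_cancel] at this
  obtain ⟨w, hw⟩ := hu
  obtain ⟨u, hu⟩ := Ideal.Quotient.mk_surjective
    (((w⁻¹ : (MvPolynomial σ K ⧸ idealOfVars σ K ^ s)ˣ) : MvPolynomial σ K ⧸ idealOfVars σ K ^ s) *
      Ideal.Quotient.mk (idealOfVars σ K ^ s) r)
  refine ⟨u, ?_⟩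
  rw [← Ideal.Quotient.eq_zero_iff_mem, map_sub, map_mul, hu, ← hw, Units.mul_inv_cancel_left,
    sub_self]

theorem exists_rep_ne_zero (q : ℙ K (Fin (2 + 1) → K)) : ∃ j : Fin 3, q.rep j ≠ 0 :=
  Function.ne_iff.1 q.rep_nonzero

theorem exists_linear_form_separating {q q' : ℙ K (Fin (2 + 1) → K)} (h : q ≠ q') :
    ∃ l : MvPolynomial (Fin 3) K, l.IsHomogeneous 1 ∧ l ∈ pointIdeal q ∧ eval q'.rep l ≠ 0 := by
  obtain ⟨j, hj⟩ := exists_rep_ne_zero q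
  by_contra! hcon
  have hk (k : Fin 2) := hcon _ (isHomogeneous_linForm q.rep j k) (linForm_mem_pointIdeal hj k)
  simp only [linForm, map_sub, map_mul, eval_X, eval_C, sub_eq_zero] at hk
  apply h
  rw [← q.mk_rep, ← q'.mk_rep, eq_comm, Projectivization.mk_eq_mk_iff']
  refine ⟨q'.rep j / q.rep j, funext fun i => ?_⟩
  rcases Fin.eq_self_or_eq_succAbove j i with rfl | ⟨k, rfl⟩
  · simp [hj]
  · simp only [Pi.smul_apply, smul_eq_mul, hk]
    ring

theorem exists_form_separating {n : ℕ} {p : Fin n → ℙ K (Fin (2 + 1) → K)}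
    (hp : Function.Injective p) (i : Fin n) (s : ℕ) :
    ∃ (e : ℕ) (G : MvPolynomial (Fin 3) K), G.IsHomogeneous e ∧ eval (p i).rep G ≠ 0 ∧
      ∀ i', i' ≠ i → G ∈ pointIdeal (p i') ^ s := by
  classical
  have (i' : Fin n) : ∃ l : MvPolynomial (Fin 3) K, i' ≠ i → l.IsHomogeneous 1 ∧
      l ∈ pointIdeal (p i') ∧ eval (p i).rep l ≠ 0 := by
    by_cases h : i' = i
    · exact ⟨0, fun h' => absurd h h'⟩
    · obtain ⟨l, hl⟩ := exists_linear_form_separating (hp.ne h)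
      exact ⟨l, fun _ => hl⟩
  choose l hl using this
  refine ⟨_, ∏ i' ∈ Finset.univ.erase i, l i' ^ s, IsHomogeneous.prod _ _ (fun _ => 1 * s)
    fun i' hi' => (hl i' (by simpa using hi')).1.pow s, ?_, fun i' hi' => ?_⟩
  · rw [map_prod, Finset.prod_ne_zero_iff]
    intro i' hi'
    rw [map_pow]
    exact pow_ne_zero _ (hl i' (by simpa using hi')).2.2
  · exact Ideal.mem_of_dvd _ (Finset.dvd_prod_of_mem _ (by simpa using hi'))
      (Ideal.pow_mem_pow (hl i' hi').2.1 s)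

end Dehomogenization

section Jets

variable {K : Type*} [Field K] {n : ℕ}

/-- The coefficients of degree less than `s` of the dehomogenizations at finitely many points. -/
def jets (p : Fin n → ℙ K (Fin (2 + 1) → K)) (j : Fin n → Fin 3) (s : ℕ) :
    MvPolynomial (Fin 3) K →ₗ[K] Fin n → jetExponents s → K :=
  LinearMap.pi fun i => LinearMap.pi fun d =>
    lcoeff K (d : Fin 2 →₀ ℕ) ∘ₗ (dehomogenize (p i).rep (j i)).toLinearMap

theorem jets_apply (p : Fin n → ℙ K (Fin (2 + 1) → K)) (j : Fin n → Fin 3) (s : ℕ)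
    (f : MvPolynomial (Fin 3) K) (i : Fin n) (d : jetExponents s) :
    jets p j s f i d = coeff (d : Fin 2 →₀ ℕ) (dehomogenize (p i).rep (j i) f) := rfl

theorem jets_eq_zero_iff {p : Fin n → ℙ K (Fin (2 + 1) → K)} {j : Fin n → Fin 3} {s : ℕ}
    {f : MvPolynomial (Fin 3) K} :
    jets p j s f = 0 ↔ ∀ i, dehomogenize (p i).rep (j i) f ∈ idealOfVars (Fin 2) K ^ s := by
  simp only [funext_iff, jets_apply, mem_pow_idealOfVars_iff', Subtype.forall, mem_jetExponents,
    Pi.zero_apply]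

theorem exists_jets_eq_single {p : Fin n → ℙ K (Fin (2 + 1) → K)} (hp : Function.Injective p)
    {j : Fin n → Fin 3} (hj : ∀ i, (p i).rep (j i) ≠ 0) (s : ℕ) (i : Fin n)
    (d : jetExponents s) :
    ∃ t₀, ∀ t, t₀ ≤ t → Pi.single i (Pi.single d 1) ∈
      (homogeneousSubmodule (Fin 3) K t).map (jets p j s) := by
  obtain ⟨e, G, hG, hGi, hGs⟩ := exists_form_separating hp i s
  obtain ⟨r, hr⟩ := exists_mul_sub_mem_pow
    (by rwa [constantCoeff_dehomogenize] : constantCoeff (dehomogenize (p i).rep (j i) G) ≠ 0)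
    (monomial (d : Fin 2 →₀ ℕ) 1) s
  refine ⟨e + r.totalDegree, fun t ht => ?_⟩
  obtain ⟨u, hu, hur⟩ := exists_dehomogenize_eq (hj i) r (t := t - e) (by lia)
  refine ⟨G * u, ?_, ?_⟩
  · have := hG.mul hu
    rwa [Nat.add_sub_cancel' (by lia)] at this
  · ext i' d'
    rw [jets_apply, map_mul]
    have hd' := mem_jetExponents.1 d'.2
    by_cases hi : i' = i
    · subst hi
      have := (mem_pow_idealOfVars_iff' _ _).1 hr d' hd'
      rw [coeff_sub, sub_eq_zero, coeff_monomial] at this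
      rw [hur, this, Pi.single_eq_same, Pi.single_apply]
      simp only [Subtype.ext_iff, eq_comm]
    · rw [Pi.single_eq_of_ne hi]
      exact (mem_pow_idealOfVars_iff' _ _).1
        (Ideal.mul_mem_right _ _ (dehomogenize_mem_pow (j i') (hGs i' hi))) d' hd'

theorem exists_map_jets_eq_top {p : Fin n → ℙ K (Fin (2 + 1) → K)} (hp : Function.Injective p)
    {j : Fin n → Fin 3} (hj : ∀ i, (p i).rep (j i) ≠ 0) (s : ℕ) :
    ∃ t₀, ∀ t, t₀ ≤ t → (homogeneousSubmodule (Fin 3) K t).map (jets p j s) = ⊤ := by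
  choose t₀ ht₀ using exists_jets_eq_single hp hj s
  refine ⟨Finset.univ.sup fun i => Finset.univ.sup fun d => t₀ i d, fun t ht => ?_⟩
  rw [Finset.sup_le_iff] at ht
  refine eq_top_iff.2 fun w _ => ?_
  have hw : w = ∑ i, ∑ d, w i d • Pi.single i (Pi.single d (1 : K)) := by
    ext i d
    simp [Finset.sum_apply, Pi.single_apply, Finset.sum_ite_eq, ite_apply]
  rw [hw]
  exact Submodule.sum_mem _ fun i _ => Submodule.sum_mem _ fun d _ =>
    Submodule.smul_mem _ _ (ht₀ i d t (Finset.sup_le_iff.1 (ht i (by simp)) d (by simp)))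

theorem finrank_map_jets_mul_le {p : Fin n → ℙ K (Fin (2 + 1) → K)} (j : Fin n → Fin 3)
    {m k : ℕ} {h : MvPolynomial (Fin 3) K} (hh : ∀ i, h ∈ pointIdeal (p i) ^ m)
    (S : Submodule K (MvPolynomial (Fin 3) K)) :
    Module.finrank K ((S.map (LinearMap.mulLeft K h)).map (jets p j (m + k))) ≤
      n * (k + 1).choose 2 := by
  have hW : Module.finrank K (Fin n → jetExponents k → K) = n * (k + 1).choose 2 := by
    simp [Module.finrank_pi_fintype, card_jetExponents]
  rw [← hW]
  refine le_trans (Submodule.finrank_mono ?_) (finrank_map_le_of_ker_le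
    (jets p j (m + k) ∘ₗ LinearMap.mulLeft K h) (jets p j k) fun u hu => ?_)
  · rw [← Submodule.map_comp]
    exact LinearMap.map_le_range
  · rw [LinearMap.mem_ker, jets_eq_zero_iff] at hu
    rw [LinearMap.mem_ker, LinearMap.comp_apply, LinearMap.mulLeft_apply, jets_eq_zero_iff]
    intro i
    rw [map_mul, pow_add]
    exact Ideal.mul_mem_mul (dehomogenize_mem_pow _ (hh i)) (hu i)

theorem mul_mul_le_mul_of_isRelPrime {p : Fin n → ℙ K (Fin (2 + 1) → K)}
    (hp : Function.Injective p) {h F : MvPolynomial (Fin 3) K} {a b m k : ℕ}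
    (hha : h.IsHomogeneous a) (hFb : F.IsHomogeneous b) (h0 : h ≠ 0) (F0 : F ≠ 0)
    (hrel : IsRelPrime h F) (hhm : ∀ i, h ∈ pointIdeal (p i) ^ m)
    (hFk : ∀ i, F ∈ pointIdeal (p i) ^ k) : n * (m * k) ≤ a * b := by
  choose j hj using fun i => exists_rep_ne_zero (p i)
  obtain ⟨c, hc⟩ := exists_map_jets_eq_top hp hj (m + k)
  let V (t : ℕ) := homogeneousSubmodule (Fin 3) K t
  have hfin (t : ℕ) : Module.Finite K (V t) :=
    Module.Finite.iff_fg.2 (homogeneousSubmodule_fg (Fin 3) K t)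
  have hinj {x : MvPolynomial (Fin 3) K} (hx : x ≠ 0) (t : ℕ) :
      Module.finrank K ((V t).map (LinearMap.mulLeft K x)) = (t + 2).choose 2 := by
    rw [← finrank_homogeneousSubmodule_fin_three K t]
    exact ((V t).equivMapOfInjective _ (mul_right_injective₀ hx)).finrank_eq.symm
  set U₁ := (V (b + c)).map (LinearMap.mulLeft K h) with hU₁
  set U₂ := (V (a + c)).map (LinearMap.mulLeft K F) with hU₂
  have hle : U₁ ⊔ U₂ ≤ V (a + b + c) := by
    refine sup_le ?_ ?_
    · rintro _ ⟨u, hu, rfl⟩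
      rw [add_assoc]
      exact hha.mul hu
    · rintro _ ⟨u, hu, rfl⟩
      rw [add_comm a, add_assoc]
      exact hFb.mul hu
  have hinf : U₁ ⊓ U₂ ≤ (V c).map (LinearMap.mulLeft K (h * F)) := by
    rintro _ ⟨⟨u, hu, rfl⟩, v, hv, huv⟩
    obtain ⟨w, hw, rfl⟩ := IsHomogeneous.exists_eq_mul hFb hu
      (hrel.symm.dvd_of_dvd_mul_left ⟨v, huv.symm⟩)
    exact ⟨w, hw, mul_assoc _ _ _⟩
  have e1 := Submodule.finrank_sup_add_finrank_inf_eq U₁ U₂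
  have e2 := (Submodule.finrank_mono hinf).trans_eq (hinj (mul_ne_zero h0 F0) c)
  have e3 := finrank_map_add_le (jets p j (m + k)) hle
  have e4 : Module.finrank K ((U₁ ⊔ U₂).map (jets p j (m + k))) ≤
      n * (k + 1).choose 2 + n * (m + 1).choose 2 := by
    rw [Submodule.map_sup]
    refine (Submodule.finrank_add_le_finrank_add_finrank _ _).trans (add_le_add ?_ ?_)
    · exact finrank_map_jets_mul_le j hhm _
    · rw [add_comm m k]
      exact finrank_map_jets_mul_le j hFk _
  rw [hc _ (by lia), finrank_top, finrank_homogeneousSubmodule_fin_three] at e3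
  rw [hinj h0, hinj F0] at e1
  have e5 : Module.finrank K (Fin n → jetExponents (m + k) → K) = n * (m + k + 1).choose 2 := by
    simp [Module.finrank_pi_fintype, card_jetExponents]
  rw [e5] at e3
  have key : n * (m + k + 1).choose 2 + (b + c + 2).choose 2 + (a + c + 2).choose 2 ≤
      (a + b + c + 2).choose 2 + (c + 2).choose 2 + n * (k + 1).choose 2 +
        n * (m + 1).choose 2 := by
    lia
  have hch (x : ℕ) : ((x + 1).choose 2 : ℚ) = x * (x + 1) / 2 := by
    rw [Nat.cast_choose_two]; push_cast; ring
  have := (Nat.cast_le (α := ℚ)).2 key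
  push_cast [hch] at this
  have goal : ((n * (m * k) : ℕ) : ℚ) ≤ ((a * b : ℕ) : ℚ) := by
    push_cast
    linarith
  exact_mod_cast goal

end Jets

theorem pointIdeal_ne_top {K : Type*} [Field K] (q : ℙ K (Fin (2 + 1) → K)) :
    pointIdeal q ≠ ⊤ := fun h => by
  have hle : pointIdeal q ≤ RingHom.ker (eval q.rep) := Ideal.span_le.2 fun f hf => hf.2
  exact RingHom.ker_ne_top (eval q.rep) (eq_top_iff.2 (h ▸ hle))

theorem iInf_pointIdeal_pow_ne_top {K : Type*} [Field K] {n : ℕ} (hn : 0 < n)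
    (p : Fin n → ℙ K (Fin (2 + 1) → K)) {m : ℕ} (hm : 1 ≤ m) :
    ⨅ i, pointIdeal (p i) ^ m ≠ ⊤ := by
  intro h
  apply pointIdeal_ne_top (p ⟨0, hn⟩)
  rw [eq_top_iff, ← h]
  exact (iInf_le (fun i => pointIdeal (p i) ^ m) ⟨0, hn⟩).trans
    (Ideal.pow_le_self (Nat.one_le_iff_ne_zero.1 hm))

theorem exists_form_mem_iInf {K : Type*} [Field K] {n : ℕ} (p : Fin n → ℙ K (Fin (2 + 1) → K))
    (m : ℕ) : ∃ f ∈ ⨅ i, pointIdeal (p i) ^ m, f ≠ 0 ∧ f.IsHomogeneous (n * m) := by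
  choose j hj using fun i => exists_rep_ne_zero (p i)
  refine ⟨∏ i, linForm (p i).rep (j i) 0 ^ m, ?_, ?_, ?_⟩
  · rw [Ideal.mem_iInf]
    exact fun i => Ideal.mem_of_dvd _ (Finset.dvd_prod_of_mem _ (Finset.mem_univ i))
      (Ideal.pow_mem_pow (linForm_mem_pointIdeal (hj i) 0) m)
  · exact Finset.prod_ne_zero_iff.2 fun i _ => pow_ne_zero _ (linForm_ne_zero (hj i) 0)
  · have := IsHomogeneous.prod Finset.univ (fun i => linForm (p i).rep (j i) 0 ^ m) (fun _ => m)
      fun i _ => by simpa using (isHomogeneous_linForm (p i).rep (j i) 0).pow m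
    simpa using this

theorem exists_isRegular_mem_iInf {K : Type*} [Field K] {n : ℕ} (hn : 0 < n)
    (p : Fin n → ℙ K (Fin (2 + 1) → K)) {m : ℕ} (hm : 1 ≤ m) :
    ∃ d, ∃ f g : MvPolynomial (Fin (2 + 1)) K, f ∈ ⨅ i, pointIdeal (p i) ^ m ∧
      g ∈ ⨅ i, pointIdeal (p i) ^ m ∧ f.IsHomogeneous d ∧ g.IsHomogeneous d ∧
      RingTheory.Sequence.IsRegular (MvPolynomial (Fin (2 + 1)) K) [f, g] := by
  choose j hj using fun i => exists_rep_ne_zero (p i)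
  obtain ⟨f, hfJ, hf0, hfd⟩ := exists_form_mem_iInf p m
  choose N hN F hFN hFd hfF using fun i => exists_mem_pow_isRelPrime
    (linForm_mem_pointIdeal (hj i) 0) (linForm_mem_pointIdeal (hj i) 1)
    (isHomogeneous_linForm _ _ _) (isHomogeneous_linForm _ _ _)
    (isRelPrime_linForm (p i).rep (j i)) hf0
  have hgJ : ∏ i, F i ^ m ∈ ⨅ i, pointIdeal (p i) ^ m := by
    rw [Ideal.mem_iInf]
    exact fun i => Ideal.mem_of_dvd _ (Finset.dvd_prod_of_mem _ (Finset.mem_univ i))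
      (Ideal.pow_mem_pow (Ideal.pow_le_self (by have := hN i; lia) (hFN i)) m)
  have hgd := IsHomogeneous.prod Finset.univ (fun i => F i ^ m) _ fun i _ => (hFd i).pow m
  set e := ∑ i, 1 * N i * m
  have he : 0 < e := Finset.sum_pos (fun i _ => by have := hN i; positivity)
    ⟨⟨0, hn⟩, Finset.mem_univ _⟩
  clear_value e
  have hfg : IsRelPrime f (∏ i, F i ^ m) :=
    IsRelPrime.prod_right fun i _ => (hfF i).pow_right
  have hfe := Ideal.pow_mem_of_mem _ hfJ e he
  have hge := Ideal.pow_mem_of_mem _ hgJ (n * m) (by positivity)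
  refine ⟨n * m * e, f ^ e, (∏ i, F i ^ m) ^ (n * m), hfe, hge, hfd.pow e, ?_,
    isRegular_pair_of_isRelPrime (pow_ne_zero _ hf0) hfg.pow
      (iInf_pointIdeal_pow_ne_top hn p hm) hfe hge⟩
  rw [mul_comm (n * m) e]
  exact hgd.pow _

/-- for the radical ideal `I` of `n` distinct points of `ℙ²`,
`α(I^(m)) · β(I^(m)) ≥ m² n` for every `m ≥ 1`. -/
theorem stmt6 {K : Type*} [Field K] {n : ℕ} (hn : 0 < n)
    (p : Fin n → ℙ K (Fin (2 + 1) → K)) (hinj : Function.Injective p) :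
    ∀ m : ℕ, 1 ≤ m →
      m ^ 2 * n ≤
        alphaDeg (⨅ i, (pointIdeal (p i)) ^ m) *
          betaDeg (⨅ i, (pointIdeal (p i)) ^ m) := by
  intro m hm
  obtain ⟨h, hhJ, h0, hhd⟩ := Nat.sInf_mem (s := {d : ℕ | ∃ f ∈ ⨅ i, pointIdeal (p i) ^ m,
    f ≠ 0 ∧ MvPolynomial.IsHomogeneous f d})
    (let ⟨f, hf⟩ := exists_form_mem_iInf p m; ⟨_, f, hf⟩)
  obtain ⟨f, g, hfJ, hgJ, hfd, hgd, hfg⟩ := Nat.sInf_mem (exists_isRegular_mem_iInf hn p hm)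
  change h.IsHomogeneous (alphaDeg _) at hhd
  change f.IsHomogeneous (betaDeg _) at hfd
  change g.IsHomogeneous (betaDeg _) at hgd
  set β := betaDeg (⨅ i, pointIdeal (p i) ^ m)
  have hX : (X 0 : MvPolynomial (Fin (2 + 1)) K) ≠ 0 := X_ne_zero 0
  obtain ⟨N, hN, F, hFJ, hFd, hhF⟩ := exists_mem_pow_isRelPrime hfJ hgJ hfd hgd
    (isRelPrime_of_isRegular_pair hfg) (mul_ne_zero h0 hX)
  have hF0 : F ≠ 0 := by
    rintro rfl
    exact (MvPolynomial.X_prime (R := K) (i := (0 : Fin (2 + 1)))).not_isUnit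
      (isUnit_of_mul_isUnit_right (hhF.isUnit_of_dvd (dvd_zero _)))
  have := mul_mul_le_mul_of_isRelPrime hinj hhd hFd h0 hF0 hhF.of_mul_left_left
    (fun i => Ideal.mem_iInf.1 hhJ i) (k := m * N) fun i => by
      rw [pow_mul]
      exact Ideal.pow_right_mono (iInf_le _ i) N hFJ
  refine Nat.le_of_mul_le_mul_right (c := N) ?_ hN
  calc m ^ 2 * n * N = n * (m * (m * N)) := by ring
    _ ≤ _ := this
    _ = _ := by ring

end
end

section
/- Let p_1,...,p_n ∈ P^2 be distinct K-points and let I = ∩_i I(p_i) ⊆ K[x_0,x_1,x_2]. If for some m ≥ 1 one has α(I^(m))·β(I^(m)) = m^2·n, then (I^(m))^k = I^(mk) for all k ≥ 1. -/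
open MvPolynomial
open scoped LinearAlgebra.Projectivization

noncomputable section

section CoordinatePoint

variable {K : Type*} [Field K]

/-- The ideal of the coordinate point `e_c` of `ℙ²`. -/
def coordIdeal (K : Type*) [Field K] (c : Fin 3) : Ideal (MvPolynomial (Fin 3) K) :=
  Ideal.span (X '' {c}ᶜ)

lemma monomial_mem_coordIdeal_pow (c : Fin 3) (t : ℕ) (a : Fin 3 →₀ ℕ) (r : K)
    (h : t + a c ≤ a.degree) : monomial a r ∈ coordIdeal K c ^ t := by
  induction t generalizing a with
  | zero => simp
  | succ t ih =>
    obtain ⟨j, hjc, hj⟩ : ∃ j, j ≠ c ∧ a j ≠ 0 := by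
      by_contra! hcon
      have : a.degree = a c := by
        rw [Finsupp.degree_eq_sum]
        exact Finset.sum_eq_single c (fun j _ hj => hcon j hj) (by simp)
      omega
    obtain ⟨b, rfl⟩ : ∃ b, a = b + Finsupp.single j 1 :=
      ⟨a - Finsupp.single j 1, (tsub_add_cancel_of_le (by simpa using Nat.one_le_iff_ne_zero.2 hj)).symm⟩
    have hb : t + b c ≤ b.degree := by
      simp [hjc, map_add] at h
      omega
    rw [show monomial (b + Finsupp.single j 1) r = monomial b r * X j by
      simp [X, monomial_mul], pow_succ]
    exact Ideal.mul_mem_mul (ih b hb) (Ideal.subset_span ⟨j, hjc, rfl⟩)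

lemma mem_coordIdeal_pow_iff {c : Fin 3} {t : ℕ} {f : MvPolynomial (Fin 3) K} :
    f ∈ coordIdeal K c ^ t ↔ ∀ a ∈ f.support, t + a c ≤ a.degree := by
  constructor
  · have hup : ∀ t, IsUpperSet {a : Fin 3 →₀ ℕ | t + a c ≤ a.degree} := by
      intro t a b hab ha
      obtain ⟨e, rfl⟩ := exists_add_of_le hab
      have : e c ≤ e.degree := Finsupp.le_degree c e
      simp only [Set.mem_ofPred_eq, map_add, Finsupp.add_apply] at ha ⊢
      omega
    have key : ∀ t, coordIdeal K c ^ t ≤ restrictSupportIdeal K _ (hup t) := by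
      intro t
      induction t with
      | zero =>
        intro x _ a _
        simpa using Finsupp.le_degree c a
      | succ t ih =>
        rw [pow_succ, Ideal.mul_le]
        intro x hx y hy a ha
        obtain ⟨b, hb, e, he, rfl⟩ := Finset.mem_add.1 (support_mul x y ha)
        have h1 : t + b c ≤ b.degree := ih hx hb
        obtain ⟨j, hj, hj'⟩ := mem_ideal_span_X_image.1 hy e he
        have h2 : 1 + e c ≤ e.degree := by
          rw [Finsupp.degree_eq_sum, ← Finset.sum_erase_add _ _ (Finset.mem_univ c)]
          have := Finset.single_le_sum (f := fun i => e i) (fun _ _ => Nat.zero_le _)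
            (Finset.mem_erase.2 ⟨hj, Finset.mem_univ j⟩)
          omega
        change t + 1 + (b + e) c ≤ (b + e).degree
        rw [map_add, Finsupp.add_apply]
        omega
    exact fun hf a ha => key t hf ha
  · intro h
    rw [f.as_sum]
    exact Ideal.sum_mem _ fun a ha => monomial_mem_coordIdeal_pow c t a _ (h a ha)

lemma mem_coordIdeal_pow_of_X_pow_mul {c : Fin 3} {t e : ℕ} {f : MvPolynomial (Fin 3) K}
    (h : X c ^ e * f ∈ coordIdeal K c ^ t) : f ∈ coordIdeal K c ^ t := by
  rw [mem_coordIdeal_pow_iff] at h ⊢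
  intro a ha
  have := h (Finsupp.single c e + a) (by
    rw [mem_support_iff] at ha ⊢
    rwa [X_pow_eq_monomial, coeff_monomial_mul, one_mul])
  simp at this
  omega

lemma ncard_degree_eq (c : Fin 3) {t d : ℕ} (h : t ≤ d + 1) :
    2 * {a : Fin 3 →₀ ℕ | a.degree = d ∧ t + a c ≤ d}.ncard + t * (t + 1)
      = (d + 1) * (d + 2) := by
  classical
  let F : Finset (Σ _ : ℕ, ℕ) := (Finset.range (d + 1 - t)).sigma fun e => Finset.range (d - e + 1)
  let g : (Σ _ : ℕ, ℕ) → (Fin 3 →₀ ℕ) := fun x => Finsupp.equivFunOnFinite.symm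
    fun j => if j = c then x.1 else if j = c + 1 then x.2 else d - x.1 - x.2
  have hc1 : c + 1 ≠ c := by fin_cases c <;> decide
  have hg : Set.InjOn g F := by
    rintro ⟨x, y⟩ - ⟨x', y'⟩ - hxy
    have h1 := DFunLike.congr_fun hxy c
    have h2 := DFunLike.congr_fun hxy (c + 1)
    simp [g, hc1] at h1 h2
    simp [h1, h2]
  have hset : {a : Fin 3 →₀ ℕ | a.degree = d ∧ t + a c ≤ d} = ↑(F.image g) := by
    ext a
    simp only [Set.mem_ofPred_eq, Finset.coe_image, Set.mem_image, Finsupp.degree_eq_sum,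
      Fin.sum_univ_three, F, Finset.coe_sigma, Set.mem_sigma_iff, Finset.coe_range, Set.mem_Iio]
    constructor
    · rintro ⟨h1, h2⟩
      refine ⟨⟨a c, a (c + 1)⟩, ⟨by dsimp only; omega, ?_⟩, ?_⟩
      · fin_cases c <;> simp at * <;> omega
      · ext j
        fin_cases c <;> fin_cases j <;> simp [g] at * <;> omega
    · rintro ⟨⟨x, y⟩, ⟨h1, h2⟩, rfl⟩
      fin_cases c <;> simp [g] at * <;> omega
  rw [hset, Set.ncard_coe_finset, Finset.card_image_of_injOn hg, Finset.card_sigma]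
  simp only [Finset.card_range]
  have key : ∀ s ≤ d + 1, 2 * ∑ e ∈ Finset.range s, (d - e + 1) + (d + 1 - s) * (d + 2 - s)
      = (d + 1) * (d + 2) := by
    intro s hs
    induction s with
    | zero => simp
    | succ s ih =>
      have := ih (by omega)
      obtain ⟨r, rfl⟩ := Nat.exists_eq_add_of_le (Nat.le_of_succ_le_succ hs)
      rw [Finset.sum_range_succ, ← this,
        show s + r + 1 - (s + 1) = r by omega, show s + r + 2 - (s + 1) = r + 1 by omega,
        show s + r + 1 - s = r + 1 by omega, show s + r + 2 - s = r + 2 by omega,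
        show s + r - s = r by omega]
      ring
  have := key (d + 1 - t) (by omega)
  rwa [show d + 1 - (d + 1 - t) = t by omega, show d + 2 - (d + 1 - t) = t + 1 by omega] at this

/-- The dimension of the degree-`d` graded piece of an ideal. -/
def gradedDim (J : Ideal (MvPolynomial (Fin 3) K)) (d : ℕ) : ℕ :=
  Module.finrank K ↥(J.restrictScalars K ⊓ homogeneousSubmodule (Fin 3) K d)

lemma gradedDim_coordIdeal_pow (c : Fin 3) {t d : ℕ} (h : t ≤ d + 1) :
    2 * gradedDim (coordIdeal K c ^ t) d + t * (t + 1) = (d + 1) * (d + 2) := by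
  have : (coordIdeal K c ^ t).restrictScalars K ⊓ homogeneousSubmodule (Fin 3) K d
      = restrictSupport K {a : Fin 3 →₀ ℕ | a.degree = d ∧ t + a c ≤ d} := by
    ext f
    rw [Submodule.mem_inf, Submodule.restrictScalars_mem, mem_coordIdeal_pow_iff,
      homogeneousSubmodule_eq_finsupp_supported, mem_restrictSupport_iff]
    change _ ∧ (f.support : Set (Fin 3 →₀ ℕ)) ⊆ _ ↔ _
    constructor
    · rintro ⟨h1, h2⟩ a ha
      have h3 : a.degree = d := h2 ha
      exact ⟨h3, h3 ▸ h1 a ha⟩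
    · intro h
      exact ⟨fun a ha => (h ha).1.symm ▸ (h ha).2, fun a ha => (h ha).1⟩
  rw [gradedDim, this, Module.finrank_eq_nat_card_basis (basisRestrictSupport K _),
    Nat.card_coe_set_eq, ncard_degree_eq c h]

lemma gradedDim_top (d : ℕ) :
    2 * gradedDim (⊤ : Ideal (MvPolynomial (Fin 3) K)) d = (d + 1) * (d + 2) := by
  simpa using gradedDim_coordIdeal_pow (K := K) 0 (t := 0) (d := d) (by omega)

lemma sub_mem_coordIdeal {c : Fin 3} {G : MvPolynomial (Fin 3) K} {e : ℕ}
    (hG : G.IsHomogeneous e) :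
    G - C (eval (Pi.single c 1) G) * X c ^ e ∈ coordIdeal K c := by
  have hev : eval (Pi.single c 1) G = coeff (Finsupp.single c e) G := by
    rw [eval_eq']
    rw [Finset.sum_eq_single (Finsupp.single c e)]
    · rw [Finset.prod_eq_one, mul_one]
      intro i _
      by_cases hi : i = c
      · subst hi; simp
      · simp [Ne.symm hi]
    · intro a ha hne
      obtain ⟨j, hj, hj'⟩ : ∃ j, j ≠ c ∧ a j ≠ 0 := by
        by_contra! hcon
        apply hne
        have hd : a.degree = e := by
          by_contra hne'
          exact (mem_support_iff.1 ha) (hG.coeff_eq_zero hne')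
        have h2 : a.degree = a c := by
          rw [Finsupp.degree_eq_sum]
          exact Finset.sum_eq_single c (fun j _ hj => hcon j hj) (by simp)
        ext j
        by_cases hj : j = c
        · subst hj; simp; omega
        · simp [hcon j hj, Ne.symm hj]
      rw [Finset.prod_eq_zero (Finset.mem_univ j), mul_zero]
      simp [hj, hj']
    · intro h
      simp [notMem_support_iff.1 h]
  rw [coordIdeal, mem_ideal_span_X_image]
  intro a ha
  by_contra! hcon
  have h2 : a = Finsupp.single c (a c) := by
    ext j
    by_cases hj : j = c
    · subst hj; simp
    · simp [hcon j hj, Ne.symm hj]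
  rw [mem_support_iff, coeff_sub, hev, X_pow_eq_monomial, C_mul_monomial, mul_one,
    coeff_monomial] at ha
  by_cases hae : a c = e
  · rw [h2, hae] at ha
    simp at ha
  · have hd : a.degree ≠ e := by
      rw [h2]; simpa using hae
    rw [hG.coeff_eq_zero hd, if_neg] at ha
    · simp at ha
    · intro h
      apply hae
      rw [← h]; simp

end CoordinatePoint

section Points

variable {K : Type*} [Field K]

/-- The ideal of the point of `ℙ²` with coordinates `u`, normalised by `u c = 1`. -/
def normPointIdeal (c : Fin 3) (u : Fin 3 → K) : Ideal (MvPolynomial (Fin 3) K) :=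
  Ideal.span ((fun j => X j - C (u j) * X c) '' {c}ᶜ)

/-- The shear substituting `X_j + w_j X_c` for `X_j` when `j ≠ c`, and fixing `X_c`. -/
def shear (c : Fin 3) (w : Fin 3 → K) : MvPolynomial (Fin 3) K →ₐ[K] MvPolynomial (Fin 3) K :=
  aeval fun j => X j + C (if j = c then 0 else w j) * X c

lemma shear_X_self (c : Fin 3) (w : Fin 3 → K) : shear c w (X c) = X c := by
  simp [shear]

lemma shear_X_of_ne {c j : Fin 3} (w : Fin 3 → K) (hj : j ≠ c) :
    shear c w (X j) = X j + C (w j) * X c := by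
  simp [shear, hj]

lemma shear_C (c : Fin 3) (w : Fin 3 → K) (r : K) : shear c w (C r) = C r :=
  (shear c w).commutes r

lemma shear_neg_shear (c : Fin 3) (w : Fin 3 → K) (f : MvPolynomial (Fin 3) K) :
    shear c (-w) (shear c w f) = f := by
  have : (shear c (-w)).comp (shear c w) = AlgHom.id K _ := by
    ext1 j
    by_cases hj : j = c
    · subst hj; simp [shear_X_self]
    · simp [shear_X_self, shear_X_of_ne _ hj]
  exact DFunLike.congr_fun this f

/-- The shear as an automorphism. -/
def shearEquiv (c : Fin 3) (w : Fin 3 → K) :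
    MvPolynomial (Fin 3) K ≃ₐ[K] MvPolynomial (Fin 3) K :=
  AlgEquiv.ofAlgHom (shear c w) (shear c (-w))
    (AlgHom.ext fun f => by simpa using shear_neg_shear c (-w) f)
    (AlgHom.ext fun f => by simpa using shear_neg_shear c w f)

lemma shearEquiv_apply (c : Fin 3) (w : Fin 3 → K) (f : MvPolynomial (Fin 3) K) :
    shearEquiv c w f = shear c w f := rfl

lemma isHomogeneous_shear (c : Fin 3) (w : Fin 3 → K) {f : MvPolynomial (Fin 3) K} {d : ℕ}
    (hf : f.IsHomogeneous d) : (shear c w f).IsHomogeneous d := by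
  rw [← one_mul d]
  exact hf.aeval _ fun j => (isHomogeneous_X K j).add (isHomogeneous_C_mul_X _ c)

lemma isHomogeneous_shear_iff (c : Fin 3) (w : Fin 3 → K) {f : MvPolynomial (Fin 3) K} {d : ℕ} :
    (shear c w f).IsHomogeneous d ↔ f.IsHomogeneous d :=
  ⟨fun h => by simpa only [shear_neg_shear] using isHomogeneous_shear c (-w) h,
    isHomogeneous_shear c w⟩

lemma eval_shear {c : Fin 3} {u : Fin 3 → K} (hu : u c = 1) (f : MvPolynomial (Fin 3) K) :
    eval (Pi.single c 1) (shear c u f) = eval u f := by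
  have : (aeval (Pi.single c (1 : K))).comp (shear c u) = aeval u := by
    ext1 j
    by_cases hj : j = c
    · subst hj; simp [shear, hu]
    · simp [shear, hj]
  simpa [aeval_eq_eval] using DFunLike.congr_fun this f

lemma map_shearEquiv_normPointIdeal (c : Fin 3) (u : Fin 3 → K) :
    (normPointIdeal c u).map (shearEquiv c u) = coordIdeal K c := by
  rw [normPointIdeal, coordIdeal, Ideal.map_span, ← Set.image_comp]
  congr 1
  refine Set.image_congr fun j hj => ?_
  have hj : j ≠ c := hj
  simp [shearEquiv_apply, shear_X_self, shear_X_of_ne _ hj]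

lemma mem_normPointIdeal_pow_iff {c : Fin 3} {u : Fin 3 → K} {t : ℕ}
    {f : MvPolynomial (Fin 3) K} :
    f ∈ normPointIdeal c u ^ t ↔ shear c u f ∈ coordIdeal K c ^ t := by
  rw [← map_shearEquiv_normPointIdeal c u, ← Ideal.map_pow]
  constructor
  · exact fun h => Ideal.mem_map_of_mem (shearEquiv c u) h
  · intro h
    obtain ⟨g, hg, hgf⟩ := (Ideal.mem_map_of_equiv (shearEquiv c u) _).1 h
    rwa [← (shearEquiv c u).injective hgf]

lemma gradedDim_normPointIdeal_pow (c : Fin 3) (u : Fin 3 → K) {t d : ℕ} (h : t ≤ d + 1) :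
    2 * gradedDim (normPointIdeal c u ^ t) d + t * (t + 1) = (d + 1) * (d + 2) := by
  rw [← gradedDim_coordIdeal_pow (K := K) c h, gradedDim, gradedDim,
    ← LinearEquiv.finrank_map_eq (shearEquiv c u).toLinearEquiv]
  congr 2
  refine congrArg (fun S : Submodule K (MvPolynomial (Fin 3) K) => Module.finrank K S) ?_
  ext f
  simp only [Submodule.mem_map, Submodule.mem_inf, Submodule.restrictScalars_mem,
    mem_homogeneousSubmodule, mem_normPointIdeal_pow_iff]
  constructor
  · rintro ⟨g, ⟨h1, h2⟩, rfl⟩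
    exact ⟨h1, isHomogeneous_shear c u h2⟩
  · rintro ⟨h1, h2⟩
    refine ⟨(shearEquiv c u).symm f, ?_, (shearEquiv c u).apply_symm_apply f⟩
    have : shear c u ((shearEquiv c u).symm f) = f := (shearEquiv c u).apply_symm_apply f
    rw [← isHomogeneous_shear_iff c u, this]
    exact ⟨h1, h2⟩

lemma sub_mem_normPointIdeal {c : Fin 3} {u : Fin 3 → K} (hu : u c = 1)
    {G : MvPolynomial (Fin 3) K} {e : ℕ} (hG : G.IsHomogeneous e) :
    G - C (eval u G) * X c ^ e ∈ normPointIdeal c u := by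
  rw [← pow_one (normPointIdeal c u), mem_normPointIdeal_pow_iff, pow_one]
  have := sub_mem_coordIdeal (c := c) (isHomogeneous_shear c u hG)
  rw [eval_shear hu] at this
  simpa [shear_X_self, shear_C] using this

lemma mem_normPointIdeal_pow_of_mul {c : Fin 3} {u : Fin 3 → K} (hu : u c = 1)
    {G : MvPolynomial (Fin 3) K} {e : ℕ} (hG : G.IsHomogeneous e) (hGu : eval u G ≠ 0) {t : ℕ}
    {f : MvPolynomial (Fin 3) K} (h : G * f ∈ normPointIdeal c u ^ t) :
    f ∈ normPointIdeal c u ^ t := by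
  induction t with
  | zero => simp
  | succ t ih =>
    have hf := ih (Ideal.pow_le_pow_right t.le_succ h)
    have h1 : C (eval u G) * (X c ^ e * f) ∈ normPointIdeal c u ^ (t + 1) := by
      have h2 := Ideal.mul_mem_mul hf (sub_mem_normPointIdeal hu hG)
      rw [← pow_succ] at h2
      convert Ideal.sub_mem _ h h2 using 1
      ring
    have h2 : X c ^ e * f ∈ normPointIdeal c u ^ (t + 1) := by
      convert Ideal.mul_mem_left _ (C (eval u G)⁻¹) h1 using 1
      rw [← mul_assoc, ← C_mul, inv_mul_cancel₀ hGu, C_1, one_mul]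
    rw [mem_normPointIdeal_pow_iff, map_mul, map_pow, shear_X_self] at h2
    exact mem_normPointIdeal_pow_iff.2 (mem_coordIdeal_pow_of_X_pow_mul h2)

lemma eval_smul_of_isHomogeneous {σ : Type*} {f : MvPolynomial σ K} {d : ℕ}
    (hf : f.IsHomogeneous d) (r : K) (v : σ → K) : eval (r • v) f = r ^ d * eval v f := by
  rw [eval_eq, eval_eq, Finset.mul_sum]
  refine Finset.sum_congr rfl fun a ha => ?_
  simp only [Pi.smul_apply, smul_eq_mul, mul_pow, Finset.prod_mul_distrib,
    Finset.prod_pow_eq_pow_sum, hf.degree_eq_sum_deg_support ha]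
  ring

lemma pointIdeal_eq_normPointIdeal (q : ℙ K (Fin (2 + 1) → K)) {c : Fin 3} (hc : q.rep c ≠ 0) :
    pointIdeal q = normPointIdeal c ((q.rep c)⁻¹ • q.rep) := by
  apply le_antisymm
  · rw [pointIdeal, Ideal.span_le]
    rintro f ⟨⟨d, hd⟩, hf⟩
    have h := sub_mem_normPointIdeal (c := c) (u := (q.rep c)⁻¹ • q.rep) (by simp [hc]) hd
    have h0 : eval ((q.rep c)⁻¹ • q.rep) f = 0 := by
      rw [eval_smul_of_isHomogeneous hd, hf, mul_zero]
    simpa [h0] using h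
  · rw [normPointIdeal, Ideal.span_le]
    rintro _ ⟨j, -, rfl⟩
    refine Ideal.subset_span ⟨⟨1, (isHomogeneous_X K j).sub (isHomogeneous_C_mul_X _ c)⟩, ?_⟩
    simp
    field_simp
    simp

attribute [local instance] MvPolynomial.gradedAlgebra in
lemma isHomogeneous_normPointIdeal_pow (c : Fin 3) (u : Fin 3 → K) (t : ℕ) :
    (normPointIdeal c u ^ t).IsHomogeneous (homogeneousSubmodule (Fin 3) K) := by
  induction t with
  | zero => simpa using Ideal.IsHomogeneous.top _
  | succ t ih =>
    rw [pow_succ]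
    refine ih.mul (Ideal.homogeneous_span _ _ ?_)
    rintro _ ⟨j, -, rfl⟩
    exact ⟨1, (isHomogeneous_X K j).sub (isHomogeneous_C_mul_X _ c)⟩

end Points

section HilbertFunction

variable {K : Type*} [Field K]

instance finiteDimensional_inf_homogeneousSubmodule (S : Submodule K (MvPolynomial (Fin 3) K))
    (d : ℕ) : FiniteDimensional K ↥(S ⊓ homogeneousSubmodule (Fin 3) K d) :=
  have : FiniteDimensional K ↥(homogeneousSubmodule (Fin 3) K d) :=
    Module.Finite.iff_fg.2 (homogeneousSubmodule_fg (Fin 3) K d)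
  Submodule.finiteDimensional_of_le inf_le_right

/-- The degree-`d` graded piece of an ideal, multiplied by a polynomial. -/
def mulGraded (A : MvPolynomial (Fin 3) K) (U : Ideal (MvPolynomial (Fin 3) K)) (d : ℕ) :
    Submodule K (MvPolynomial (Fin 3) K) :=
  (U.restrictScalars K ⊓ homogeneousSubmodule (Fin 3) K d).map (LinearMap.mulLeft K A)

instance finiteDimensional_mulGraded (A : MvPolynomial (Fin 3) K)
    (U : Ideal (MvPolynomial (Fin 3) K)) (d : ℕ) : FiniteDimensional K ↥(mulGraded A U d) := by
  unfold mulGraded; infer_instance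

lemma finrank_mulGraded {A : MvPolynomial (Fin 3) K} (hA : A ≠ 0)
    (U : Ideal (MvPolynomial (Fin 3) K)) (d : ℕ) :
    Module.finrank K ↥(mulGraded A U d) = gradedDim U d :=
  (Submodule.equivMapOfInjective _ (mul_right_injective₀ hA) _).finrank_eq.symm

lemma mem_mulGraded {A x : MvPolynomial (Fin 3) K} {U : Ideal (MvPolynomial (Fin 3) K)} {d : ℕ} :
    x ∈ mulGraded A U d ↔ ∃ y, (y ∈ U ∧ y.IsHomogeneous d) ∧ A * y = x := Iff.rfl

lemma isHomogeneous_of_mul_left {σ : Type*} {A f : MvPolynomial σ K} {a d : ℕ} (hA : A ≠ 0)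
    (hAa : A.IsHomogeneous a) (h : (A * f).IsHomogeneous (a + d)) : f.IsHomogeneous d := by
  let := MvPolynomial.gradedAlgebra (σ := σ) (R := K)
  have key := DirectSum.coe_decompose_mul_add_of_left_mem (homogeneousSubmodule σ K) (j := d)
    (b := f) ((mem_homogeneousSubmodule a A).2 hAa)
  rw [DirectSum.decompose_of_mem_same _ ((mem_homogeneousSubmodule _ _).2 h)] at key
  rw [mul_left_cancel₀ hA key]
  exact (DirectSum.decompose (homogeneousSubmodule σ K) f d).2

/-- The graded dimension of `A U + C V`, for coprime forms `A` and `C`. -/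
lemma gradedDim_add_le {A C : MvPolynomial (Fin 3) K} {a c : ℕ} (hA : A ≠ 0) (hC : C ≠ 0)
    (hAa : A.IsHomogeneous a) (hCc : C.IsHomogeneous c) (hAC : IsRelPrime A C)
    (U V : Ideal (MvPolynomial (Fin 3) K)) (e : ℕ) :
    gradedDim U (c + e) + gradedDim V (a + e) ≤
      gradedDim (Ideal.span {A} * U ⊔ Ideal.span {C} * V) (a + c + e) +
        gradedDim (⊤ : Ideal (MvPolynomial (Fin 3) K)) e := by
  rw [← finrank_mulGraded hA U, ← finrank_mulGraded hC V,
    ← Submodule.finrank_sup_add_finrank_inf_eq]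
  refine add_le_add (Submodule.finrank_mono (sup_le ?_ ?_)) ?_
  · rintro _ ⟨y, ⟨hyU, hy⟩, rfl⟩
    refine ⟨Ideal.mem_sup_left (Ideal.mul_mem_mul (Ideal.mem_span_singleton_self A) hyU), ?_⟩
    rw [add_assoc]
    exact hAa.mul hy
  · rintro _ ⟨y, ⟨hyV, hy⟩, rfl⟩
    refine ⟨Ideal.mem_sup_right (Ideal.mul_mem_mul (Ideal.mem_span_singleton_self C) hyV), ?_⟩
    rw [add_comm a c, add_assoc]
    exact hCc.mul hy
  · rw [← finrank_mulGraded (mul_ne_zero hA hC)]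
    refine Submodule.finrank_mono ?_
    rintro x ⟨hx, hx'⟩
    obtain ⟨y, ⟨-, hy⟩, rfl⟩ := mem_mulGraded.1 hx
    obtain ⟨z, -, hz⟩ := mem_mulGraded.1 hx'
    obtain ⟨w, rfl⟩ : C ∣ y := hAC.symm.dvd_of_dvd_mul_left ⟨z, hz.symm⟩
    exact mem_mulGraded.2 ⟨w, ⟨trivial, isHomogeneous_of_mul_left hC hCc hy⟩, by ring⟩

lemma gradedDim_inf_add {U V : Ideal (MvPolynomial (Fin 3) K)} {d : ℕ}
    (h : homogeneousSubmodule (Fin 3) K d ≤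
      (U.restrictScalars K ⊓ homogeneousSubmodule (Fin 3) K d) ⊔
        (V.restrictScalars K ⊓ homogeneousSubmodule (Fin 3) K d)) :
    gradedDim (⊤ : Ideal (MvPolynomial (Fin 3) K)) d + gradedDim (U ⊓ V) d = gradedDim U d + gradedDim V d := by
  have key := Submodule.finrank_sup_add_finrank_inf_eq
    (U.restrictScalars K ⊓ homogeneousSubmodule (Fin 3) K d)
    (V.restrictScalars K ⊓ homogeneousSubmodule (Fin 3) K d)
  rw [le_antisymm (sup_le inf_le_right inf_le_right) h, ← inf_inf_distrib_right] at key
  rw [gradedDim, Submodule.restrictScalars_top, top_inf_eq]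
  exact key

/-- A form `G` not vanishing at a point generates everything modulo powers of the ideal of
that point, in large degrees. -/
lemma homogeneousSubmodule_le_sup {c : Fin 3} {u : Fin 3 → K} (hu : u c = 1)
    {G : MvPolynomial (Fin 3) K} {e : ℕ} (hG : G.IsHomogeneous e) (hGu : eval u G ≠ 0) {t d : ℕ}
    (htd : t ≤ d + 1) {U : Ideal (MvPolynomial (Fin 3) K)} (hGU : G ∈ U) :
    homogeneousSubmodule (Fin 3) K (e + d) ≤
      (U.restrictScalars K ⊓ homogeneousSubmodule (Fin 3) K (e + d)) ⊔
        ((normPointIdeal c u ^ t).restrictScalars K ⊓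
          homogeneousSubmodule (Fin 3) K (e + d)) := by
  have hG0 : G ≠ 0 := by rintro rfl; simp at hGu
  set V := normPointIdeal c u ^ t
  have hle : mulGraded G ⊤ d ≤ U.restrictScalars K ⊓ homogeneousSubmodule (Fin 3) K (e + d) := by
    rintro _ ⟨y, ⟨-, hy⟩, rfl⟩
    exact ⟨Ideal.mul_mem_right _ _ hGU, hG.mul hy⟩
  refine le_trans ?_ (sup_le_sup_right hle _)
  have hle' : mulGraded G ⊤ d ⊔ (V.restrictScalars K ⊓ homogeneousSubmodule (Fin 3) K (e + d)) ≤
      (⊤ : Ideal (MvPolynomial (Fin 3) K)).restrictScalars K ⊓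
        homogeneousSubmodule (Fin 3) K (e + d) := by
    refine sup_le ?_ (inf_le_inf_right _ fun _ _ => trivial)
    rintro _ ⟨y, ⟨-, hy⟩, rfl⟩
    exact ⟨trivial, hG.mul hy⟩
  have hinf : mulGraded G ⊤ d ⊓ (V.restrictScalars K ⊓ homogeneousSubmodule (Fin 3) K (e + d)) =
      mulGraded G V d := by
    ext x
    constructor
    · rintro ⟨⟨y, ⟨-, hy⟩, rfl⟩, hV, -⟩
      exact ⟨y, ⟨mem_normPointIdeal_pow_of_mul hu hG hGu hV, hy⟩, rfl⟩
    · rintro ⟨y, ⟨hyV, hy⟩, rfl⟩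
      exact ⟨⟨y, ⟨trivial, hy⟩, rfl⟩, Ideal.mul_mem_left _ _ hyV, hG.mul hy⟩
  have hdim := Submodule.finrank_sup_add_finrank_inf_eq (mulGraded G ⊤ d)
    (V.restrictScalars K ⊓ homogeneousSubmodule (Fin 3) K (e + d))
  rw [hinf, finrank_mulGraded hG0, finrank_mulGraded hG0] at hdim
  have h1 : 2 * gradedDim V d + _ = _ := gradedDim_normPointIdeal_pow c u htd
  have h2 : 2 * gradedDim V (e + d) + _ = _ := gradedDim_normPointIdeal_pow c u (t := t) (d := e + d) (by omega)
  have h3 := gradedDim_top (K := K) d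
  have h4 := gradedDim_top (K := K) (e + d)
  have heq := Submodule.eq_of_le_of_finrank_le hle' (by
    change gradedDim _ _ ≤ _
    change _ = _ + gradedDim V (e + d) at hdim
    omega)
  rw [heq, Submodule.restrictScalars_top, top_inf_eq]

/-- Conditions of vanishing to order `t` at distinct points are independent in large degrees. -/
lemma gradedDim_iInf_normPointIdeal_pow {ι : Type*} (s : Finset ι) (c : ι → Fin 3)
    (u : ι → Fin 3 → K) (hu : ∀ i, u i (c i) = 1)
    (huu : ∀ i j, i ≠ j → ∃ k, u i k * u j (c i) ≠ u j k) (t : ℕ) :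
    ∃ D, ∀ d ≥ D, 2 * gradedDim (⨅ i ∈ s, normPointIdeal (c i) (u i) ^ t) d +
      s.card * (t * (t + 1)) = (d + 1) * (d + 2) := by
  classical
  induction s using Finset.induction_on with
  | empty => exact ⟨0, fun d _ => by simpa using gradedDim_top d⟩
  | insert j s hj ih =>
    obtain ⟨D, hD⟩ := ih
    have hl : ∀ i, ∃ l ∈ normPointIdeal (c i) (u i), l.IsHomogeneous 1 ∧
        (i ≠ j → eval (u j) l ≠ 0) := by
      intro i
      by_cases hij : i = j
      · exact ⟨0, Ideal.zero_mem _, isHomogeneous_zero _ _ _, fun h => (h hij).elim⟩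
      obtain ⟨k, hk⟩ := huu i j hij
      have hkc : k ≠ c i := by
        rintro rfl
        simp [hu] at hk
      refine ⟨X k - C (u i k) * X (c i), Ideal.subset_span ⟨k, hkc, rfl⟩,
        (isHomogeneous_X K k).sub (isHomogeneous_C_mul_X _ _), fun _ => ?_⟩
      simpa [sub_ne_zero] using hk.symm
    choose l hlI hl1 hlj using hl
    have hG : (∏ i ∈ s, l i ^ t).IsHomogeneous (∑ i ∈ s, 1 * t) :=
      IsHomogeneous.prod _ _ _ fun i _ => (hl1 i).pow t
    set G := ∏ i ∈ s, l i ^ t with hGdef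
    set e := ∑ i ∈ s, 1 * t
    have hGu : eval (u j) G ≠ 0 := by
      rw [hGdef, map_prod, Finset.prod_ne_zero_iff]
      intro i hi
      rw [map_pow]
      exact pow_ne_zero _ (hlj i fun h => hj (h ▸ hi))
    have hGU : G ∈ ⨅ i ∈ s, normPointIdeal (c i) (u i) ^ t := by
      simp only [Ideal.mem_iInf]
      exact fun i hi => Ideal.mem_of_dvd _ (Finset.dvd_prod_of_mem _ hi)
        (Ideal.pow_mem_pow (hlI i) t)
    refine ⟨D + e + t, fun d hd => ?_⟩
    obtain ⟨r, rfl⟩ := Nat.exists_eq_add_of_le (show e ≤ d by omega)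
    have h1 := gradedDim_inf_add
      (homogeneousSubmodule_le_sup (hu j) hG hGu (show t ≤ r + 1 by omega) hGU)
    have h2 := hD (e + r) (by omega)
    have h3 := gradedDim_top (K := K) (e + r)
    have h4 := gradedDim_normPointIdeal_pow (c j) (u j) (t := t) (d := e + r) (by omega)
    rw [Finset.iInf_insert, inf_comm, Finset.card_insert_of_notMem hj, add_mul, one_mul]
    omega

end HilbertFunction

section Saturation

variable {K : Type*} [Field K]

/-- An ideal `Q` is saturated if `f ∈ Q` whenever the irrelevant ideal multiplies `f` into `Q`. -/
def IsSaturatedIdeal {σ : Type*} (Q : Ideal (MvPolynomial σ K)) : Prop :=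
  ∀ f, (∀ i, X i * f ∈ Q) → f ∈ Q

lemma isSaturatedIdeal_iInf {σ ι : Type*} {Q : ι → Ideal (MvPolynomial σ K)}
    (h : ∀ i, IsSaturatedIdeal (Q i)) : IsSaturatedIdeal (⨅ i, Q i) := by
  intro f hf
  simp only [Ideal.mem_iInf] at hf ⊢
  exact fun i => h i f fun j => hf j i

lemma isSaturatedIdeal_normPointIdeal_pow {c : Fin 3} {u : Fin 3 → K} (hu : u c = 1) (t : ℕ) :
    IsSaturatedIdeal (normPointIdeal c u ^ t) := fun _ hf =>
  mem_normPointIdeal_pow_of_mul hu (isHomogeneous_X K c) (by simp [hu]) (hf c)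

/-- Saturatedness of a complete intersection of two plane curves, via the exactness of the
Koszul complex of the variables. -/
lemma exists_eq_add_of_X_mul {A C f : MvPolynomial (Fin 3) K} (hC : C ≠ 0)
    (hAC : IsRelPrime A C) (h : ∀ i, ∃ r s, X i * f = A * r + C * s) :
    ∃ r s, f = A * r + C * s := by
  choose r s hrs using h
  have hkoszul : ∀ i j, ∃ w, X j * r i - X i * r j = C * w ∧ X i * s j - X j * s i = A * w := by
    intro i j
    have h1 : A * (X j * r i - X i * r j) = C * (X i * s j - X j * s i) := by
      linear_combination X i * hrs j - X j * hrs i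
    obtain ⟨w, hw⟩ := hAC.symm.dvd_of_dvd_mul_left ⟨_, h1⟩
    refine ⟨w, hw, mul_left_cancel₀ hC ?_⟩
    rw [← h1, hw]
    ring
  obtain ⟨p, hp, hp'⟩ := hkoszul 0 1
  obtain ⟨q, hq, -⟩ := hkoszul 0 2
  obtain ⟨w, hw, -⟩ := hkoszul 1 2
  have hpqw : X 2 * p = X 1 * q - X 0 * w := by
    refine mul_left_cancel₀ hC ?_
    linear_combination X 1 * hq - X 2 * hp - X 0 * hw
  have himage : (X '' {2}ᶜ : Set (MvPolynomial (Fin 3) K)) = {X 0, X 1} := by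
    rw [show ({2}ᶜ : Set (Fin 3)) = {0, 1} by ext i; fin_cases i <;> simp, Set.image_pair]
  have hpmem : p ∈ coordIdeal K 2 := by
    rw [← pow_one (coordIdeal K 2)]
    refine mem_coordIdeal_pow_of_X_pow_mul (e := 1) ?_
    rw [pow_one, pow_one, hpqw]
    exact Ideal.sub_mem _
      (Ideal.mul_mem_right _ _ (Ideal.subset_span ⟨1, by simp, rfl⟩))
      (Ideal.mul_mem_right _ _ (Ideal.subset_span ⟨0, by simp, rfl⟩))
  rw [coordIdeal, himage, Ideal.mem_span_pair] at hpmem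
  obtain ⟨v, u, rfl⟩ := hpmem
  have hX : ∀ y : MvPolynomial (Fin 3) K, X 0 ∣ X 1 * y → X 0 ∣ y := fun y hy =>
    ((X_prime (R := K) (i := (0 : Fin 3))).dvd_or_dvd hy).resolve_left
      (by rw [X_dvd_X]; decide)
  obtain ⟨y, hy⟩ := hX (r 0 - C * u) ⟨r 1 + C * v, by linear_combination hp⟩
  obtain ⟨z, hz⟩ := hX (s 0 + A * u) ⟨s 1 - A * v, by linear_combination -hp'⟩
  refine ⟨y, z, mul_left_cancel₀ (X_ne_zero 0) ?_⟩
  linear_combination hrs 0 + A * hy + C * hz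

lemma isSaturatedIdeal_add {A C : MvPolynomial (Fin 3) K} (hC : C ≠ 0)
    (hAC : IsRelPrime A C) {U V : Ideal (MvPolynomial (Fin 3) K)} (hCU : C ∈ U) (hAV : A ∈ V)
    (hU : IsSaturatedIdeal U) (hV : IsSaturatedIdeal V) :
    IsSaturatedIdeal (Ideal.span {A} * U ⊔ Ideal.span {C} * V) := by
  intro f hf
  have hf' : ∀ i, ∃ r ∈ U, ∃ s ∈ V, X i * f = A * r + C * s := by
    intro i
    obtain ⟨x, hx, y, hy, hxy⟩ := Submodule.mem_sup.1 (hf i)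
    obtain ⟨r, hr, rfl⟩ := Ideal.mem_span_singleton_mul.1 hx
    obtain ⟨s, hs, rfl⟩ := Ideal.mem_span_singleton_mul.1 hy
    exact ⟨r, hr, s, hs, hxy.symm⟩
  choose r hr s hs hrs using hf'
  obtain ⟨y, z, rfl⟩ := exists_eq_add_of_X_mul hC hAC fun i => ⟨r i, s i, hrs i⟩
  have key : ∀ i, ∃ w, r i - X i * y = C * w ∧ X i * z - s i = A * w := by
    intro i
    have h1 : A * (r i - X i * y) = C * (X i * z - s i) := by linear_combination -hrs i
    obtain ⟨w, hw⟩ := hAC.symm.dvd_of_dvd_mul_left ⟨_, h1⟩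
    refine ⟨w, hw, mul_left_cancel₀ hC ?_⟩
    rw [← h1, hw]
    ring
  choose w hw hw' using key
  refine Submodule.add_mem_sup
    (Ideal.mul_mem_mul (Ideal.mem_span_singleton_self A) (hU y fun i => ?_))
    (Ideal.mul_mem_mul (Ideal.mem_span_singleton_self C) (hV z fun i => ?_))
  · rw [show X i * y = r i - C * w i by rw [← hw]; ring]
    exact Ideal.sub_mem _ (hr i) (Ideal.mul_mem_right _ _ hCU)
  · rw [show X i * z = s i + A * w i by rw [← hw']; ring]
    exact Ideal.add_mem _ (hs i) (Ideal.mul_mem_right _ _ hAV)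

attribute [local instance] MvPolynomial.gradedAlgebra in
/-- A homogeneous ideal containing a saturated ideal with the same Hilbert function in large
degrees is equal to it. -/
lemma le_of_gradedDim_le {Q T : Ideal (MvPolynomial (Fin 3) K)} (hQ : IsSaturatedIdeal Q)
    (hT : T.IsHomogeneous (homogeneousSubmodule (Fin 3) K)) (hQT : Q ≤ T) {D : ℕ}
    (hD : ∀ d ≥ D, gradedDim T d ≤ gradedDim Q d) : T ≤ Q := by
  have key : ∀ e d, D ≤ d + e → ∀ f ∈ T, f.IsHomogeneous d → f ∈ Q := by
    intro e
    induction e with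
    | zero =>
      intro d hd f hfT hf
      have heq := Submodule.eq_of_le_of_finrank_le
        (inf_le_inf_right (homogeneousSubmodule (Fin 3) K d)
          (show Q.restrictScalars K ≤ T.restrictScalars K from hQT)) (hD d hd)
      have hmem : f ∈ T.restrictScalars K ⊓ homogeneousSubmodule (Fin 3) K d := ⟨hfT, hf⟩
      rw [← heq] at hmem
      exact hmem.1
    | succ e ih =>
      intro d hd f hfT hf
      refine hQ f fun i => ih (1 + d) (by omega) _ (Ideal.mul_mem_left _ _ hfT) ?_
      exact (isHomogeneous_X K i).mul hf
  intro f hf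
  rw [← sum_homogeneousComponent f]
  exact Ideal.sum_mem _ fun d _ => key D d (by omega) _
    (homogeneousComponent_mem_of_mem hT hf d) (homogeneousComponent_isHomogeneous d f)

/-- The ideal `(A, B) ^ k * J`, built so as to exhibit its Hilbert function. -/
def mixedPower (A B : MvPolynomial (Fin 3) K) (J : Ideal (MvPolynomial (Fin 3) K)) :
    ℕ → Ideal (MvPolynomial (Fin 3) K)
  | 0 => J
  | k + 1 => Ideal.span {A} * mixedPower A B J k ⊔ Ideal.span {B ^ (k + 1)} * J

variable {A B : MvPolynomial (Fin 3) K} {J : Ideal (MvPolynomial (Fin 3) K)}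

lemma mixedPower_le (hA : A ∈ J) (hB : B ∈ J) (k : ℕ) : mixedPower A B J k ≤ J ^ (k + 1) := by
  induction k with
  | zero => simp [mixedPower]
  | succ k ih =>
    refine sup_le ?_ ?_
    · rw [pow_succ' J (k + 1)]
      exact Ideal.mul_mono ((Ideal.span_singleton_le_iff_mem _).2 hA) ih
    · rw [pow_succ J (k + 1)]
      exact Ideal.mul_mono_left
        ((Ideal.span_singleton_le_iff_mem _).2 (Ideal.pow_mem_pow hB (k + 1)))

lemma pow_mem_mixedPower (hB : B ∈ J) (k : ℕ) : B ^ (k + 1) ∈ mixedPower A B J k := by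
  cases k with
  | zero => simpa [mixedPower] using hB
  | succ k =>
    rw [pow_succ]
    exact Ideal.mem_sup_right (Ideal.mul_mem_mul (Ideal.mem_span_singleton_self _) hB)

lemma isSaturatedIdeal_mixedPower (hA : A ∈ J) (hB : B ∈ J) (hB0 : B ≠ 0)
    (hAB : IsRelPrime A B) (hJ : IsSaturatedIdeal J) (k : ℕ) :
    IsSaturatedIdeal (mixedPower A B J k) := by
  induction k with
  | zero => exact hJ
  | succ k ih =>
    exact isSaturatedIdeal_add (pow_ne_zero _ hB0) hAB.pow_right
      (pow_mem_mixedPower hB k) hA ih hJ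

lemma le_gradedDim_mixedPower {a b m n : ℕ} (hA0 : A ≠ 0) (hB0 : B ≠ 0)
    (hAB : IsRelPrime A B) (hAa : A.IsHomogeneous a) (hBb : B.IsHomogeneous b)
    (hab : a * b = m ^ 2 * n)
    (hJ : ∃ D, ∀ d ≥ D, (d + 1) * (d + 2) ≤ 2 * gradedDim J d + n * (m * (m + 1))) (k : ℕ) :
    ∃ D, ∀ d ≥ D, (d + 1) * (d + 2) ≤ 2 * gradedDim (mixedPower A B J k) d +
      n * (m * (k + 1) * (m * (k + 1) + 1)) := by
  obtain ⟨D₀, hD₀⟩ := hJ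
  induction k with
  | zero => exact ⟨D₀, fun d hd => by simpa [mixedPower] using hD₀ d hd⟩
  | succ k ih =>
    obtain ⟨D, hD⟩ := ih
    refine ⟨a + b * (k + 1) + D₀ + D, fun d hd => ?_⟩
    obtain ⟨e, rfl⟩ := Nat.exists_eq_add_of_le (show a + b * (k + 1) ≤ d by omega)
    have h1 := gradedDim_add_le hA0 (pow_ne_zero (k + 1) hB0) hAa (hBb.pow (k + 1))
      hAB.pow_right (mixedPower A B J k) J e
    change _ ≤ gradedDim (mixedPower A B J (k + 1)) _ + _ at h1
    have h2 := hD (b * (k + 1) + e) (by omega)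
    have h3 := hD₀ (a + e) (by omega)
    have h4 := gradedDim_top (K := K) e
    have h5 : a * (b * (k + 1)) = m ^ 2 * n * (k + 1) := by rw [← hab]; ring
    generalize b * (k + 1) = c at *
    nlinarith

attribute [local instance] MvPolynomial.gradedAlgebra in
lemma iInf_normPointIdeal_pow_le {ι : Type*} [Fintype ι] (c : ι → Fin 3)
    (u : ι → Fin 3 → K) (hu : ∀ i, u i (c i) = 1)
    (huu : ∀ i j, i ≠ j → ∃ k, u i k * u j (c i) ≠ u j k) {m a b : ℕ}
    (hA : A ∈ ⨅ i, normPointIdeal (c i) (u i) ^ m) (hB : B ∈ ⨅ i, normPointIdeal (c i) (u i) ^ m)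
    (hA0 : A ≠ 0) (hB0 : B ≠ 0) (hAB : IsRelPrime A B) (hAa : A.IsHomogeneous a)
    (hBb : B.IsHomogeneous b) (hab : a * b = m ^ 2 * Fintype.card ι) (k : ℕ) :
    ⨅ i, normPointIdeal (c i) (u i) ^ (m * (k + 1)) ≤
      (⨅ i, normPointIdeal (c i) (u i) ^ m) ^ (k + 1) := by
  have hdim := fun t => gradedDim_iInf_normPointIdeal_pow Finset.univ c u hu huu t
  simp only [Finset.mem_univ, iInf_pos, Finset.card_univ] at hdim
  obtain ⟨D₁, hD₁⟩ := hdim (m * (k + 1))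
  obtain ⟨D₂, hD₂⟩ := le_gradedDim_mixedPower hA0 hB0 hAB hAa hBb hab
    (J := ⨅ i, normPointIdeal (c i) (u i) ^ m)
    ((hdim m).imp fun D hD d hd => (hD d hd).ge) k
  have hle := mixedPower_le hA hB k
  refine (le_of_gradedDim_le (D := D₁ + D₂) (isSaturatedIdeal_mixedPower hA hB hB0 hAB
    (isSaturatedIdeal_iInf fun i => isSaturatedIdeal_normPointIdeal_pow (hu i) m) k)
    (Ideal.IsHomogeneous.iInf fun i => isHomogeneous_normPointIdeal_pow _ _ _)
    (hle.trans (le_iInf fun i => ?_)) fun d hd => ?_).trans hle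
  · rw [pow_mul]
    exact Ideal.pow_right_mono (iInf_le _ i) _
  · have h1 := hD₁ d (by omega)
    have h2 := hD₂ d (by omega)
    omega

end Saturation

section BaseChange

variable {K L σ : Type*} [Field K] [Field L] [Algebra K L]

lemma exists_coeff_eq (g : L →ₗ[K] K) (y : MvPolynomial σ L) :
    ∃ z : MvPolynomial σ K, ∀ a, coeff a z = g (coeff a y) := by
  classical
  refine ⟨∑ a ∈ y.support, monomial a (g (coeff a y)), fun a => ?_⟩
  simp only [coeff_sum, coeff_monomial, Finset.sum_ite_eq']
  split_ifs with h
  · rfl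
  · rw [notMem_support_iff.1 h, map_zero]

/-- The map between polynomial rings applying a functional to every coefficient. -/
def coeffwise (g : L →ₗ[K] K) (y : MvPolynomial σ L) : MvPolynomial σ K :=
  (exists_coeff_eq g y).choose

lemma coeff_coeffwise (g : L →ₗ[K] K) (y : MvPolynomial σ L) (a : σ →₀ ℕ) :
    coeff a (coeffwise g y) = g (coeff a y) :=
  (exists_coeff_eq g y).choose_spec a

lemma coeffwise_add (g : L →ₗ[K] K) (y z : MvPolynomial σ L) :
    coeffwise g (y + z) = coeffwise g y + coeffwise g z := by
  ext a; simp [coeff_coeffwise]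

lemma coeffwise_map_mul (g : L →ₗ[K] K) (x : MvPolynomial σ K) (y : MvPolynomial σ L) :
    coeffwise g (map (algebraMap K L) x * y) = x * coeffwise g y := by
  classical
  ext a
  simp only [coeff_coeffwise, coeff_mul, map_sum, coeff_map, ← Algebra.smul_def, map_smul,
    smul_eq_mul]

lemma coeffwise_map {g : L →ₗ[K] K} (hg : g 1 = 1) (x : MvPolynomial σ K) :
    coeffwise g (map (algebraMap K L) x) = x := by
  ext a
  rw [coeff_coeffwise, coeff_map, Algebra.algebraMap_eq_smul_one, map_smul, hg, smul_eq_mul, mul_one]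

lemma mem_map_algebraMap_iff {I : Ideal (MvPolynomial σ K)} {y : MvPolynomial σ L} :
    y ∈ I.map (map (algebraMap K L)) ↔ ∀ g : L →ₗ[K] K, coeffwise g y ∈ I := by
  classical
  constructor
  · intro hy g
    suffices h : ∀ t, coeffwise g (t * y) ∈ I by simpa using h 1
    induction hy using Submodule.span_induction with
    | mem x hx =>
      obtain ⟨z, hz, rfl⟩ := hx
      intro t
      rw [mul_comm, coeffwise_map_mul]
      exact I.mul_mem_right _ hz
    | zero =>
      intro t
      convert I.zero_mem
      ext a
      simp [coeff_coeffwise]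
    | add x z _ _ hx hz =>
      intro t
      rw [mul_add, coeffwise_add]
      exact I.add_mem (hx t) (hz t)
    | smul r x _ ih =>
      intro t
      rw [smul_eq_mul, ← mul_assoc]
      exact ih _
  · intro h
    let b := Module.Basis.ofVectorSpace K L
    let s := y.support.biUnion fun a => (b.repr (coeff a y)).support
    have : y = ∑ j ∈ s, C (b j) * map (algebraMap K L) (coeffwise (b.coord j) y) := by
      ext a
      rw [coeff_sum]
      simp only [coeff_C_mul, coeff_map, coeff_coeffwise, Module.Basis.coord_apply]
      by_cases ha : a ∈ y.support
      · conv_lhs => rw [← b.linearCombination_repr (coeff a y), Finsupp.linearCombination_apply]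
        rw [Finsupp.sum_of_support_subset _ (Finset.subset_biUnion_of_mem
          (fun a => (b.repr (coeff a y)).support) ha) _ (by simp)]
        exact Finset.sum_congr rfl fun j _ => by rw [Algebra.smul_def, mul_comm]
      · simp [notMem_support_iff.1 ha]
    rw [this]
    exact Ideal.sum_mem _ fun j _ => Ideal.mul_mem_left _ _ (Ideal.mem_map_of_mem _ (h _))

lemma map_iInf_algebraMap {ι : Type*} (I : ι → Ideal (MvPolynomial σ K)) :
    (⨅ i, I i).map (map (algebraMap K L)) = ⨅ i, (I i).map (map (algebraMap K L)) := by
  ext y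
  simp only [mem_map_algebraMap_iff, Ideal.mem_iInf]
  exact forall_comm

lemma mem_of_map_mem_map {I : Ideal (MvPolynomial σ K)} {x : MvPolynomial σ K}
    (h : map (algebraMap K L) x ∈ I.map (map (algebraMap K L))) : x ∈ I := by
  obtain ⟨g, hg⟩ := LinearMap.exists_leftInverse_of_injective (Algebra.linearMap K L)
    (LinearMap.ker_eq_bot.2 (algebraMap K L).injective)
  have := mem_map_algebraMap_iff.1 h g
  rwa [coeffwise_map (by simpa using DFunLike.congr_fun hg 1)] at this

lemma isRelPrime_of_forall_dvd {R : Type*} [CommRing R] [IsDomain R] {f g : R} (hf : f ≠ 0)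
    (h : ∀ x, f ∣ g * x → f ∣ x) : IsRelPrime f g := by
  rintro d ⟨x, rfl⟩ ⟨y, rfl⟩
  obtain ⟨z, hz⟩ := h x ⟨y, by ring⟩
  have hx : x ≠ 0 := right_ne_zero_of_mul hf
  refine IsUnit.of_mul_eq_one z (mul_left_cancel₀ hx ?_)
  linear_combination -hz

lemma isRelPrime_map {f g : MvPolynomial σ K} (hf : f ≠ 0) (h : ∀ x, f ∣ g * x → f ∣ x) :
    IsRelPrime (map (algebraMap K L) f) (map (algebraMap K L) g) := by
  have hinj := map_injective (σ := σ) _ (algebraMap K L).injective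
  refine isRelPrime_of_forall_dvd ((map_ne_zero_iff _ hinj).2 hf) fun x hx => ?_
  have hspan : (Ideal.span {f}).map (map (algebraMap K L)) =
      Ideal.span {map (algebraMap K L) f} := by
    rw [Ideal.map_span, Set.image_singleton]
  rw [← Ideal.mem_span_singleton, ← hspan, mem_map_algebraMap_iff] at hx ⊢
  intro φ
  have := hx φ
  rw [coeffwise_map_mul] at this
  rw [Ideal.mem_span_singleton] at this ⊢
  exact h _ this

lemma map_normPointIdeal {K L : Type*} [Field K] [Field L] [Algebra K L] (c : Fin 3)
    (u : Fin 3 → K) :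
    (normPointIdeal c u).map (map (algebraMap K L)) =
      normPointIdeal c fun j => algebraMap K L (u j) := by
  rw [normPointIdeal, normPointIdeal, Ideal.map_span, ← Set.image_comp]
  congr 1
  exact Set.image_congr fun j _ => by simp

/-- In a pencil without fixed component, some member has no common component with `A`. -/
lemma exists_isRelPrime_add_C_mul [Infinite L] {A f g : MvPolynomial σ L} (hA : A ≠ 0)
    (hfg : IsRelPrime f g) : ∃ r : L, IsRelPrime A (f + C r * g) := by
  classical
  by_contra! hcon
  have hq : ∀ r : L, ∃ q ∈ (UniqueFactorizationMonoid.factors A).toFinset,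
      q ∣ f + C r * g := by
    intro r
    have h := hcon r
    simp only [IsRelPrime, not_forall] at h
    obtain ⟨d, hdA, hdf, hd⟩ := h
    obtain ⟨q, hq, hqd⟩ := WfDvdMonoid.exists_irreducible_factor hd (ne_zero_of_dvd_ne_zero hA hdA)
    obtain ⟨q', hq', hqq'⟩ :=
      UniqueFactorizationMonoid.exists_mem_factors_of_dvd hA hq (hqd.trans hdA)
    exact ⟨q', Multiset.mem_toFinset.2 hq', hqq'.symm.dvd.trans (hqd.trans hdf)⟩
  choose q hq hqf using hq
  obtain ⟨r, s, hrs, h⟩ := Finite.exists_ne_map_eq_of_infinite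
    fun r => (⟨q r, hq r⟩ : {x // x ∈ (UniqueFactorizationMonoid.factors A).toFinset})
  have h : q r = q s := congrArg Subtype.val h
  have hirr := UniqueFactorizationMonoid.irreducible_of_factor _ (Multiset.mem_toFinset.1 (hq r))
  have hg : q r ∣ g := by
    have h1 := dvd_sub (hqf r) (h ▸ hqf s)
    rw [show f + C r * g - (f + C s * g) = C (r - s) * g by rw [C_sub]; ring] at h1
    have h2 := h1.mul_left (C (r - s)⁻¹)
    rwa [← mul_assoc, ← C_mul, inv_mul_cancel₀ (sub_ne_zero.2 hrs), C_1, one_mul] at h2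
  exact hirr.not_isUnit (hfg ((dvd_add_left (hg.mul_left _)).1 (hqf r)) hg)

end BaseChange

open scoped Pointwise in
lemma forall_dvd_of_isRegular {R : Type*} [CommRing R] {f g : R}
    (h : RingTheory.Sequence.IsRegular R [f, g]) (x : R) (hx : f ∣ g * x) : f ∣ x := by
  rw [RingTheory.Sequence.isRegular_cons_iff, RingTheory.Sequence.isRegular_cons_iff] at h
  have hg := h.2.1
  have hmem : ∀ y : R, Submodule.Quotient.mk (p := f • (⊤ : Submodule R R)) y = 0 ↔ f ∣ y := by
    intro y
    rw [Submodule.Quotient.mk_eq_zero, Submodule.mem_smul_pointwise_iff_exists]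
    exact ⟨fun ⟨z, _, hz⟩ => ⟨z, hz.symm⟩, fun ⟨z, hz⟩ => ⟨z, trivial, hz.symm⟩⟩
  refine (hmem x).1 (hg ?_)
  change g • Submodule.Quotient.mk (p := f • (⊤ : Submodule R R)) x = g • 0
  rw [smul_zero, ← Submodule.Quotient.mk_smul]
  exact (hmem _).2 hx

lemma ne_zero_of_isRegular {R : Type*} [CommRing R] [IsDomain R] {f g : R}
    (h : RingTheory.Sequence.IsRegular R [f, g]) : f ≠ 0 := by
  rw [RingTheory.Sequence.isRegular_cons_iff] at h
  rintro rfl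
  exact zero_ne_one (h.1 (show (0 : R) • (0 : R) = (0 : R) • 1 by simp))

/-- for the radical ideal `I` of `n` distinct points of `ℙ²`, if
`α(I^(m))·β(I^(m)) = m²n` for some `m ≥ 1`, then `(I^(m))^k = I^(mk)` for all `k ≥ 1`. -/
theorem stmt8 {K : Type*} [Field K] {n : ℕ} (hn : 0 < n)
    (p : Fin n → ℙ K (Fin (2 + 1) → K)) (hinj : Function.Injective p)
    (m : ℕ) (hm : 1 ≤ m)
    (heq : alphaDeg (⨅ i, (pointIdeal (p i)) ^ m) *
        betaDeg (⨅ i, (pointIdeal (p i)) ^ m) = m ^ 2 * n) :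
    ∀ k : ℕ, 1 ≤ k →
      (⨅ i, (pointIdeal (p i)) ^ m) ^ k = ⨅ i, (pointIdeal (p i)) ^ (m * k) := by
  classical
  have hc : ∀ i, ∃ c, (p i).rep c ≠ 0 := fun i => Function.ne_iff.1 (p i).rep_nonzero
  choose c hc using hc
  set u : Fin n → Fin 3 → K := fun i => ((p i).rep (c i))⁻¹ • (p i).rep with hu_def
  have hu : ∀ i, u i (c i) = 1 := fun i => by simp [hu_def, hc i]
  have huu : ∀ i j, i ≠ j → ∃ k, u i k * u j (c i) ≠ u j k := by
    intro i j hij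
    by_contra! hcon
    apply hij.symm
    apply hinj
    have hprop : (p j).rep = ((p j).rep (c j) * u j (c i) * ((p i).rep (c i))⁻¹) • (p i).rep := by
      ext k
      have h := hcon k
      simp only [hu_def, Pi.smul_apply, smul_eq_mul] at h ⊢
      have := hc j
      have := hc i
      field_simp at h ⊢
      linear_combination -h
    rw [← (p j).mk_rep, ← (p i).mk_rep, Projectivization.mk_eq_mk_iff']
    exact ⟨_, hprop.symm⟩
  simp only [fun i => pointIdeal_eq_normPointIdeal (p i) (hc i)] at heq ⊢
  change ∀ k : ℕ, 1 ≤ k → (⨅ i, normPointIdeal (c i) (u i) ^ m) ^ k =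
    ⨅ i, normPointIdeal (c i) (u i) ^ (m * k)
  change alphaDeg (⨅ i, normPointIdeal (c i) (u i) ^ m) *
    betaDeg (⨅ i, normPointIdeal (c i) (u i) ^ m) = _ at heq
  set J := ⨅ i, normPointIdeal (c i) (u i) ^ m with hJ
  have hpos : alphaDeg J * betaDeg J ≠ 0 := by
    rw [heq]; positivity
  obtain ⟨hα, hβ⟩ := mul_ne_zero_iff.1 hpos
  obtain ⟨A, hAJ, hA0, hAa⟩ := Nat.sInf_mem (Nat.nonempty_of_sInf_eq_succ
    (Nat.succ_pred_eq_of_ne_zero hα).symm)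
  obtain ⟨f, g, hf, hg, hfb, hgb, hreg⟩ := Nat.sInf_mem (Nat.nonempty_of_sInf_eq_succ
    (Nat.succ_pred_eq_of_ne_zero hβ).symm)
  change A.IsHomogeneous (alphaDeg J) at hAa
  change f.IsHomogeneous (betaDeg J) at hfb
  change g.IsHomogeneous (betaDeg J) at hgb
  let φ : MvPolynomial (Fin 3) K →+* MvPolynomial (Fin 3) (AlgebraicClosure K) :=
    map (algebraMap K (AlgebraicClosure K))
  have hA0' : φ A ≠ 0 := (map_ne_zero_iff _
    (map_injective _ (algebraMap K (AlgebraicClosure K)).injective)).2 hA0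
  obtain ⟨r, hr⟩ := exists_isRelPrime_add_C_mul hA0'
    (isRelPrime_map (L := AlgebraicClosure K) (ne_zero_of_isRegular hreg)
      (forall_dvd_of_isRegular hreg))
  have hB0 : φ f + C r * φ g ≠ 0 := by
    intro h
    have hunit := isRelPrime_zero_right.1 (h ▸ hr)
    have := (isUnit_iff_totalDegree_of_isReduced.1 hunit).2
    rw [(hAa.map _).totalDegree hA0'] at this
    exact hα this
  have hmap : ∀ t, (⨅ i, normPointIdeal (c i) (u i) ^ t).map φ =
      ⨅ i, normPointIdeal (c i) (fun j => algebraMap K (AlgebraicClosure K) (u i j)) ^ t := by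
    intro t
    rw [map_iInf_algebraMap]
    simp only [Ideal.map_pow, map_normPointIdeal]
  intro k hk
  obtain ⟨k, rfl⟩ := Nat.exists_eq_add_of_le' hk
  refine le_antisymm (le_iInf fun i => ?_) fun x hx => ?_
  · rw [pow_mul]
    exact Ideal.pow_right_mono (iInf_le _ i) _
  · refine mem_of_map_mem_map (L := AlgebraicClosure K) ?_
    rw [Ideal.map_pow, hJ, hmap m]
    refine iInf_normPointIdeal_pow_le c _ (fun i => by simp [hu i]) (fun i j hij => ?_)
      (A := φ A) (B := φ f + C r * φ g) ?_ ?_ hA0' hB0 hr (hAa.map _)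
      ((hfb.map _).add ((hgb.map _).C_mul r)) (by simpa using heq) k ?_
    · obtain ⟨l, hl⟩ := huu i j hij
      refine ⟨l, ?_⟩
      rw [← map_mul]
      exact (algebraMap K (AlgebraicClosure K)).injective.ne hl
    · rw [← hmap]
      exact Ideal.mem_map_of_mem φ hAJ
    · rw [← hmap]
      exact Ideal.add_mem _ (Ideal.mem_map_of_mem φ hf)
        (Ideal.mul_mem_left _ _ (Ideal.mem_map_of_mem φ hg))
    · rw [← hmap]
      exact Ideal.mem_map_of_mem φ hx

end
end

section
/- Let (R,M) be a regular local ring of dimension d and let x_1,...,x_d ∈ M^n be a regular sequence (so that R/(x_1,...,x_d) has finite length). Then the length of R/(x_1,...,x_d) is at least n^d. -/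
open MvPolynomial
open scoped LinearAlgebra.Projectivization

noncomputable section

theorem exists_ofList_cons_eq_of_notMem {R : Type*} [CommRing R] [IsLocalRing R] (rs : List R) :
    ∀ x ∈ Ideal.ofList rs, x ∉ IsLocalRing.maximalIdeal R * Ideal.ofList rs →
      ∃ ts : List R, ts.length + 1 = rs.length ∧
        Ideal.ofList (x :: ts) = Ideal.ofList rs := by
  induction rs with
  | nil =>
    intro x hx hx'
    simp_all
  | cons r rs ih =>
    intro x hx hx'
    rw [Ideal.ofList_cons, Submodule.mem_sup] at hx
    obtain ⟨y, hy, z, hz, rfl⟩ := hx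
    obtain ⟨a, rfl⟩ := Ideal.mem_span_singleton'.mp hy
    by_cases ha : IsUnit a
    · refine ⟨rs, by simp, ?_⟩
      simp only [Ideal.ofList_cons]
      apply le_antisymm
      · refine sup_le ?_ le_sup_right
        rw [Ideal.span_singleton_le_iff_mem]
        exact Submodule.mem_sup.mpr ⟨_, hy, z, hz, rfl⟩
      · refine sup_le ?_ le_sup_right
        rw [Ideal.span_singleton_le_iff_mem]
        obtain ⟨u, rfl⟩ := ha
        have h1 : ↑u⁻¹ * ((u * r + z) - z) ∈ Ideal.span {u * r + z} ⊔ Ideal.ofList rs :=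
          Ideal.mul_mem_left _ _ (Ideal.sub_mem _
            (Ideal.mem_sup_left (Ideal.mem_span_singleton_self _)) (Ideal.mem_sup_right hz))
        simpa using h1
    · have ham : a ∈ IsLocalRing.maximalIdeal R := ha
      have har : a * r ∈ IsLocalRing.maximalIdeal R * Ideal.ofList (r :: rs) :=
        Ideal.mul_mem_mul ham (Ideal.subset_span (by simp))
      obtain ⟨ts, hl, hts⟩ := ih z hz fun h ↦ hx' <| Ideal.add_mem _ har <|
        Ideal.mul_mono_right (by rw [Ideal.ofList_cons]; exact le_sup_right) h
      refine ⟨r :: ts, by simp [hl], ?_⟩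
      simp only [Ideal.ofList_cons] at hts ⊢
      rw [← hts]
      apply le_antisymm
      · refine sup_le ?_ (sup_le le_sup_left (le_sup_right.trans le_sup_right))
        rw [Ideal.span_singleton_le_iff_mem]
        exact Ideal.add_mem _ (Ideal.mem_sup_left hy)
          (Ideal.mem_sup_right (Ideal.mem_sup_left (Ideal.mem_span_singleton_self _)))
      · refine sup_le (le_sup_left.trans le_sup_right)
          (sup_le ?_ (le_sup_right.trans le_sup_right))
        rw [Ideal.span_singleton_le_iff_mem]
        have h1 : z = (a * r + z) - a * r := by simp
        rw [h1]
        refine Ideal.sub_mem _ (Ideal.mem_sup_left ?_) (Ideal.mem_sup_right (Ideal.mem_sup_left hy))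
        simp

theorem ringKrullDim_le_length_of_ofList_eq_maximalIdeal {R : Type*} [CommRing R]
    [IsNoetherianRing R] [IsLocalRing R] {rs : List R}
    (hrs : Ideal.ofList rs = IsLocalRing.maximalIdeal R) : ringKrullDim R ≤ rs.length := by
  classical
  refine (ringKrullDim_le_spanFinrank_maximalIdeal R).trans ?_
  have h : (Ideal.ofList rs).spanFinrank ≤ rs.length := by
    have h1 : ({r | r ∈ rs} : Set R) = (rs.toFinset : Set R) := by ext; simp
    unfold Ideal.ofList
    rw [h1]
    refine (Submodule.spanFinrank_span_le_ncard_of_finite (Finset.finite_toSet _)).trans ?_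
    rw [Set.ncard_coe_finset]
    exact List.toFinset_card_le rs
  rw [← hrs]
  exact_mod_cast h

section Quotient

variable {R : Type*} [CommRing R] [IsLocalRing R] {r : R} {rs : List R}

theorem mem_maximalIdeal_of_ofList_cons
    (hrs : Ideal.ofList (r :: rs) = IsLocalRing.maximalIdeal R) :
    r ∈ IsLocalRing.maximalIdeal R :=
  hrs ▸ Ideal.subset_span (by simp)

theorem isLocalRing_quotient_span_singleton (hr : r ∈ IsLocalRing.maximalIdeal R) :
    IsLocalRing (R ⧸ Ideal.span {r}) := by
  have : Nontrivial (R ⧸ Ideal.span {r}) := by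
    rw [Ideal.Quotient.nontrivial_iff, Ne, Ideal.span_singleton_eq_top]
    exact hr
  exact IsLocalRing.of_surjective' _ Ideal.Quotient.mk_surjective

theorem ofList_map_mk_eq_maximalIdeal [IsLocalRing (R ⧸ Ideal.span {r})]
    (hrs : Ideal.ofList (r :: rs) = IsLocalRing.maximalIdeal R) :
    Ideal.ofList (rs.map (Ideal.Quotient.mk (Ideal.span {r}))) =
      IsLocalRing.maximalIdeal (R ⧸ Ideal.span {r}) := by
  rw [← IsLocalRing.map_maximalIdeal_of_surjective _ Ideal.Quotient.mk_surjective, ← hrs,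
    Ideal.ofList_cons, Ideal.map_sup, Ideal.map_quotient_self, bot_sup_eq, Ideal.map_ofList]

theorem ringKrullDim_quotient_eq_length [IsNoetherianRing R] [IsLocalRing (R ⧸ Ideal.span {r})]
    (hrs : Ideal.ofList (r :: rs) = IsLocalRing.maximalIdeal R)
    (hdim : ringKrullDim R = (r :: rs).length) :
    ringKrullDim (R ⧸ Ideal.span {r}) =
      (rs.map (Ideal.Quotient.mk (Ideal.span {r}))).length := by
  apply le_antisymm
  · exact ringKrullDim_le_length_of_ofList_eq_maximalIdeal (ofList_map_mk_eq_maximalIdeal hrs)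
  · have h := IsLocalRing.maximalIdeal_height_eq_ringKrullDim (R := R) ▸
      Ideal.height_le_ringKrullDim_quotient_add_one (mem_maximalIdeal_of_ofList_cons hrs)
    rw [hdim] at h
    rw [List.length_map]
    simp only [List.length_cons, Nat.cast_add, Nat.cast_one] at h
    exact ENat.WithBot.add_le_add_one_right_iff.mp h

end Quotient

theorem isDomain_of_ringKrullDim_eq_length (d : ℕ) : ∀ {R : Type*} [CommRing R]
    [IsNoetherianRing R] [IsLocalRing R] (rs : List R), rs.length = d →
    Ideal.ofList rs = IsLocalRing.maximalIdeal R → ringKrullDim R = rs.length → IsDomain R := by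
  induction d with
  | zero =>
    intro R _ _ _ rs hl hrs hdim
    obtain rfl := List.eq_nil_of_length_eq_zero hl
    rw [Ideal.ofList_nil] at hrs
    exact (IsLocalRing.isField_iff_maximalIdeal_eq.mpr hrs.symm).isDomain
  | succ d ih =>
    intro R _ _ _ rs hl hrs hdim
    have hnot : ∀ p ∈ minimalPrimes R, ¬ IsLocalRing.maximalIdeal R ≤ p := by
      intro p hp hle
      have hpp : p.IsPrime := hp.1.1
      have h0 := Ideal.height_eq_zero_iff.mpr hp
      rw [← (IsLocalRing.maximalIdeal.isMaximal R).eq_of_le hpp.ne_top hle] at h0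
      have h1 := IsLocalRing.maximalIdeal_height_eq_ringKrullDim (R := R)
      rw [h0, hdim, hl] at h1
      norm_cast at h1
    have hsq : ¬ IsLocalRing.maximalIdeal R ≤
        IsLocalRing.maximalIdeal R * IsLocalRing.maximalIdeal R := by
      intro hle
      have hbot := Submodule.eq_bot_of_le_smul_of_le_jacobson_bot _ _
        (IsNoetherian.noetherian _) hle (IsLocalRing.jacobson_eq_maximalIdeal _ bot_ne_top).ge
      have h0 := ringKrullDim_eq_zero_of_isField (IsLocalRing.isField_iff_maximalIdeal_eq.mpr hbot)
      rw [h0, hl] at hdim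
      norm_cast at hdim
    obtain ⟨x, hxM, hx⟩ : ∃ x ∈ IsLocalRing.maximalIdeal R,
        x ∉ IsLocalRing.maximalIdeal R * IsLocalRing.maximalIdeal R ∧
          ∀ p ∈ minimalPrimes R, x ∉ p := by
      by_contra! hcon
      have := (Ideal.subset_union_prime_finite
        (s := insert (IsLocalRing.maximalIdeal R * IsLocalRing.maximalIdeal R) (minimalPrimes R))
        ((minimalPrimes.finite_of_isNoetherianRing R).insert _) (f := id)
        (I := IsLocalRing.maximalIdeal R)
        (IsLocalRing.maximalIdeal R * IsLocalRing.maximalIdeal R)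
        (IsLocalRing.maximalIdeal R * IsLocalRing.maximalIdeal R) ?_).mp ?_
      · obtain ⟨p, hp, hle⟩ := this
        rcases hp with rfl | hp
        · exact hsq hle
        · exact hnot p hp hle
      · rintro p (rfl | hp) h1 -
        · exact (h1 rfl).elim
        · exact hp.1.1
      · intro x hx
        by_cases h : x ∈ IsLocalRing.maximalIdeal R * IsLocalRing.maximalIdeal R
        · exact Set.mem_biUnion (Set.mem_insert _ _) h
        · obtain ⟨p, hp, hxp⟩ := hcon x hx h
          exact Set.mem_biUnion (Set.mem_insert_of_mem _ hp) hxp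
    obtain ⟨ts, htl, hts⟩ := exists_ofList_cons_eq_of_notMem rs x (hrs ▸ hxM) (hrs.symm ▸ hx.1)
    rw [hrs] at hts
    have := isLocalRing_quotient_span_singleton hxM
    have hdom := ih (R := R ⧸ Ideal.span {x}) _ (by simpa using by omega)
      (ofList_map_mk_eq_maximalIdeal hts)
      (ringKrullDim_quotient_eq_length hts (by rw [hdim]; simp [htl]))
    have hprime : (Ideal.span {x}).IsPrime := (Ideal.Quotient.isDomain_iff_prime _).mp hdom
    obtain ⟨p, hp, hpx⟩ := Ideal.exists_minimalPrimes_le (bot_le : ⊥ ≤ Ideal.span {x})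
    have hpp : p.IsPrime := hp.1.1
    have hpbot : p = ⊥ := by
      refine Submodule.eq_bot_of_le_smul_of_le_jacobson_bot (IsLocalRing.maximalIdeal R) p
        (IsNoetherian.noetherian _) ?_ (IsLocalRing.jacobson_eq_maximalIdeal _ bot_ne_top).ge
      intro z hz
      obtain ⟨a, rfl⟩ := Ideal.mem_span_singleton'.mp (hpx hz)
      have ha := (hpp.mem_or_mem hz).resolve_right (hx.2 p hp)
      rw [mul_comm]
      exact Ideal.mul_mem_mul hxM ha
    subst hpbot
    exact IsDomain.of_bot_isPrime R

theorem isWeaklyRegular_of_ringKrullDim_eq_length (d : ℕ) : ∀ {R : Type*} [CommRing R]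
    [IsNoetherianRing R] [IsLocalRing R] (rs : List R), rs.length = d →
    Ideal.ofList rs = IsLocalRing.maximalIdeal R → ringKrullDim R = rs.length →
    RingTheory.Sequence.IsWeaklyRegular R rs := by
  induction d with
  | zero =>
    intro R _ _ _ rs hl hrs hdim
    obtain rfl := List.eq_nil_of_length_eq_zero hl
    exact .nil _ _
  | succ d ih =>
    intro R _ _ _ rs hl hrs hdim
    obtain ⟨r, rs, rfl⟩ := List.exists_of_length_succ rs hl
    have hdom := isDomain_of_ringKrullDim_eq_length _ _ rfl hrs hdim
    have := isLocalRing_quotient_span_singleton (mem_maximalIdeal_of_ofList_cons hrs)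
    have hreg := ih (R := R ⧸ Ideal.span {r}) (rs.map (Ideal.Quotient.mk _)) (by simpa using hl)
      (ofList_map_mk_eq_maximalIdeal hrs) (ringKrullDim_quotient_eq_length hrs hdim)
    have hr : r ≠ 0 := by
      rintro rfl
      have h1 := ringKrullDim_le_length_of_ofList_eq_maximalIdeal (R := R) (rs := rs)
        (by simpa using hrs)
      rw [hdim] at h1
      norm_cast at h1
      simp at h1
    refine .cons (IsSMulRegular.of_ne_zero hr) ?_
    have h2 := (RingTheory.Sequence.isWeaklyRegular_map_algebraMap_iff (R ⧸ Ideal.span {r})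
      (R ⧸ Ideal.span {r}) rs).mp hreg
    refine (LinearEquiv.isWeaklyRegular_congr (Submodule.quotEquivOfEq _ _ ?_) rs).mp h2
    simp [← Submodule.ideal_span_singleton_smul]

open scoped Pointwise in
theorem isWeaklyRegular_and_length_of_exact {R : Type*} [CommRing R] (rs : List R) :
    ∀ {N M P : Type*} [AddCommGroup N] [Module R N] [AddCommGroup M] [Module R M]
      [AddCommGroup P] [Module R P] {f : N →ₗ[R] M} {g : M →ₗ[R] P},
      Function.Injective f → Function.Exact f g → Function.Surjective g →
      RingTheory.Sequence.IsWeaklyRegular N rs → RingTheory.Sequence.IsWeaklyRegular P rs →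
      RingTheory.Sequence.IsWeaklyRegular M rs ∧
        Module.length R (M ⧸ (Ideal.ofList rs • ⊤ : Submodule R M)) =
          Module.length R (N ⧸ (Ideal.ofList rs • ⊤ : Submodule R N)) +
            Module.length R (P ⧸ (Ideal.ofList rs • ⊤ : Submodule R P)) := by
  induction rs with
  | nil =>
    intro N M P _ _ _ _ _ _ f g hf hfg hg _ _
    have h (K : Type _) [AddCommGroup K] [Module R K] :
        (Ideal.ofList ([] : List R) • ⊤ : Submodule R K) = ⊥ := by simp
    refine ⟨.nil _ _, ?_⟩
    rw [(Submodule.quotEquivOfEqBot _ (h M)).length_eq,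
      (Submodule.quotEquivOfEqBot (Ideal.ofList ([] : List R) • ⊤ : Submodule R N)
        (by simp)).length_eq,
      (Submodule.quotEquivOfEqBot (Ideal.ofList ([] : List R) • ⊤ : Submodule R P)
        (by simp)).length_eq]
    exact Module.length_eq_add_of_exact f g hf hg hfg
  | cons r rs ih =>
    intro N M P _ _ _ _ _ _ f g hf hfg hg hN hP
    rw [RingTheory.Sequence.isWeaklyRegular_cons_iff] at hN hP ⊢
    have hinj : Function.Injective (QuotSMulTop.map r f) := by
      have h0 : Function.Exact (0 : PUnit →ₗ[R] N) f := (f.exact_zero_iff_injective PUnit).mpr hf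
      have h1 := QuotSMulTop.map_first_exact_on_four_term_exact_of_isSMulRegular_last h0 hfg hP.1
      rw [← LinearMap.ker_eq_bot, LinearMap.exact_iff.mp h1, LinearMap.range_eq_bot]
      ext
      simp
    have := ih hinj (QuotSMulTop.map_exact r hfg hg) (QuotSMulTop.map_surjective r hg) hN.2 hP.2
    refine ⟨⟨isSMulRegular_of_range_eq_ker hf (LinearMap.exact_iff.mp hfg).symm hN.1 hP.1,
      this.1⟩, ?_⟩
    simpa only [(Submodule.quotOfListConsSMulTopEquivQuotSMulTopInner _ r rs).length_eq]
      using this.2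

open scoped Pointwise in
theorem isWeaklyRegular_and_length_quotSMulTop_pow {R M : Type*} [CommRing R] [AddCommGroup M]
    [Module R M] {r : R} (hr : IsSMulRegular M r) {rs : List R}
    (hrs : RingTheory.Sequence.IsWeaklyRegular (QuotSMulTop r M) rs) (k : ℕ) :
    RingTheory.Sequence.IsWeaklyRegular (QuotSMulTop (r ^ k) M) rs ∧
      Module.length R (QuotSMulTop (r ^ k) M ⧸
        (Ideal.ofList rs • ⊤ : Submodule R (QuotSMulTop (r ^ k) M))) =
      k * Module.length R (QuotSMulTop r M ⧸
        (Ideal.ofList rs • ⊤ : Submodule R (QuotSMulTop r M))) := by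
  induction k with
  | zero =>
    have : Subsingleton (QuotSMulTop (r ^ 0) M) := by
      rw [Submodule.Quotient.subsingleton_iff]
      simp
    refine ⟨⟨fun i hi ↦ ?_⟩, by simp [Module.length_eq_zero]⟩
    exact Function.injective_of_subsingleton _
  | succ k ih =>
    let f : QuotSMulTop (r ^ k) M →ₗ[R] QuotSMulTop (r ^ (k + 1)) M :=
      Submodule.mapQ _ _ (LinearMap.lsmul R M r) (by
        intro x hx
        obtain ⟨y, -, rfl⟩ := (Submodule.mem_smul_pointwise_iff_exists _ _ _).mp hx
        exact (Submodule.mem_smul_pointwise_iff_exists _ _ _).mpr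
          ⟨y, trivial, by simp [pow_succ', mul_smul, smul_comm r]⟩)
    let g : QuotSMulTop (r ^ (k + 1)) M →ₗ[R] QuotSMulTop r M :=
      Submodule.mapQ _ _ LinearMap.id (by
        intro x hx
        obtain ⟨y, -, rfl⟩ := (Submodule.mem_smul_pointwise_iff_exists _ _ _).mp hx
        exact (Submodule.mem_smul_pointwise_iff_exists _ _ _).mpr
          ⟨r ^ k • y, trivial, by simp [pow_succ', mul_smul]⟩)
    have hf : Function.Injective f := by
      rw [injective_iff_map_eq_zero]
      intro x hx
      obtain ⟨x, rfl⟩ := Submodule.mkQ_surjective _ x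
      obtain ⟨y, -, hy⟩ := (Submodule.mem_smul_pointwise_iff_exists _ _ _).mp
        ((Submodule.Quotient.mk_eq_zero _).mp hx)
      refine (Submodule.Quotient.mk_eq_zero _).mpr
        ((Submodule.mem_smul_pointwise_iff_exists _ _ _).mpr ⟨y, trivial, hr ?_⟩)
      simpa [pow_succ', mul_smul] using hy
    have hg : Function.Surjective g := by
      intro x
      obtain ⟨x, rfl⟩ := Submodule.mkQ_surjective _ x
      exact ⟨Submodule.Quotient.mk x, rfl⟩
    have hfg : Function.Exact f g := by
      intro x
      obtain ⟨x, rfl⟩ := Submodule.mkQ_surjective _ x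
      constructor
      · intro hx
        obtain ⟨y, -, rfl⟩ := (Submodule.mem_smul_pointwise_iff_exists _ _ _).mp
          ((Submodule.Quotient.mk_eq_zero _).mp hx)
        exact ⟨Submodule.Quotient.mk y, rfl⟩
      · rintro ⟨y, hy⟩
        obtain ⟨y, rfl⟩ := Submodule.mkQ_surjective _ y
        rw [← hy]
        exact (Submodule.Quotient.mk_eq_zero _).mpr
          ((Submodule.mem_smul_pointwise_iff_exists _ _ _).mpr ⟨y, trivial, rfl⟩)
    have h := isWeaklyRegular_and_length_of_exact rs hf hfg hg ih.1 hrs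
    refine ⟨h.1, ?_⟩
    rw [h.2, ih.2]
    push_cast
    ring

open scoped Pointwise in
theorem length_quotient_ofList_pow {R : Type*} [CommRing R] (k : ℕ) (rs : List R) :
    ∀ {M : Type*} [AddCommGroup M] [Module R M], RingTheory.Sequence.IsWeaklyRegular M rs →
      Module.length R (M ⧸ (Ideal.ofList (rs.map (· ^ k)) • ⊤ : Submodule R M)) =
        (k ^ rs.length : ℕ) * Module.length R (M ⧸ (Ideal.ofList rs • ⊤ : Submodule R M)) := by
  induction rs with
  | nil =>
    intro M _ _ _
    rw [List.map_nil, List.length_nil, pow_zero, Nat.cast_one, one_mul]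
  | cons r rs ih =>
    intro M _ _ h
    rw [RingTheory.Sequence.isWeaklyRegular_cons_iff] at h
    have h1 := isWeaklyRegular_and_length_quotSMulTop_pow h.1 h.2 k
    rw [List.map_cons, (Submodule.quotOfListConsSMulTopEquivQuotSMulTopInner _ (r ^ k) _).length_eq,
      (Submodule.quotOfListConsSMulTopEquivQuotSMulTopInner _ r _).length_eq, ih h1.1, h1.2]
    push_cast
    simp only [List.length_cons, pow_succ, mul_assoc]

theorem length_quotient_le_of_le {R : Type*} [CommRing R] {I J : Ideal R} (h : I ≤ J) :
    Module.length R (R ⧸ J) ≤ Module.length R (R ⧸ I) :=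
  Module.length_le_of_surjective (Submodule.factor h) (Submodule.factor_surjective h)

theorem length_quotient_le_length_quotient_sup_add {R : Type*} [CommRing R] {I P : Ideal R} {v : R}
    (h : ∀ a ∈ I, a * v ∈ P) :
    Module.length R (R ⧸ P) ≤
      Module.length R (R ⧸ (P ⊔ Ideal.span {v})) + Module.length R (R ⧸ I) := by
  let f : (R ⧸ I) →ₗ[R] (R ⧸ P) := Submodule.mapQ I P (LinearMap.mulRight R v) h
  let g : (R ⧸ P) →ₗ[R] (R ⧸ (P ⊔ Ideal.span {v})) := Submodule.factor le_sup_left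
  have hfg : Function.Exact (LinearMap.range f).subtype g := by
    rw [LinearMap.exact_iff, Submodule.range_subtype]
    ext x
    obtain ⟨x, rfl⟩ := Submodule.mkQ_surjective _ x
    constructor
    · intro hx
      obtain ⟨y, hy, z, hz, rfl⟩ := Submodule.mem_sup.mp ((Submodule.Quotient.mk_eq_zero _).mp hx)
      obtain ⟨a, rfl⟩ := Ideal.mem_span_singleton'.mp hz
      refine ⟨Submodule.Quotient.mk a, ?_⟩
      rw [map_add, Submodule.mkQ_apply, (Submodule.Quotient.mk_eq_zero P).mpr hy, zero_add]
      rfl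
    · rintro ⟨y, hy⟩
      obtain ⟨y, rfl⟩ := Submodule.mkQ_surjective _ y
      rw [← hy]
      exact (Submodule.Quotient.mk_eq_zero _).mpr
        (Ideal.mem_sup_right (Ideal.mul_mem_left _ _ (Ideal.mem_span_singleton_self v)))
  rw [Module.length_eq_add_of_exact _ g (Submodule.subtype_injective _)
    (Submodule.factor_surjective _) hfg, add_comm]
  gcongr
  exact Module.length_le_of_surjective f.rangeRestrict f.surjective_rangeRestrict

theorem length_quotient_le_add_card_mul {R ι : Type*} [CommRing R] {I : Ideal R} (s : Finset ι)
    (v : ι → R) : ∀ {P Q : Ideal R}, (∀ i ∈ s, ∀ a ∈ I, a * v i ∈ P) →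
      Q ≤ P ⊔ Ideal.span (v '' s) →
      Module.length R (R ⧸ P) ≤ Module.length R (R ⧸ Q) + s.card * Module.length R (R ⧸ I) := by
  classical
  induction s using Finset.induction with
  | empty =>
    intro P Q _ hQ
    simpa using length_quotient_le_of_le (by simpa using hQ)
  | insert i s hi ih =>
    intro P Q h hQ
    refine (length_quotient_le_length_quotient_sup_add (h i (Finset.mem_insert_self _ _))).trans ?_
    rw [Finset.card_insert_of_notMem hi, Nat.cast_add, Nat.cast_one, add_mul, one_mul, ← add_assoc]
    gcongr
    refine ih (fun j hj a ha ↦ Ideal.mem_sup_left (h j (Finset.mem_insert_of_mem hj) a ha)) ?_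
    rwa [sup_assoc, ← Ideal.span_union, Set.singleton_union, ← Set.image_insert_eq,
      ← Finset.coe_insert]

theorem prod_pow_mem_span_pow {R : Type*} [CommRing R] {d : ℕ} (y : Fin d → R) (a : Fin d → ℕ) :
    ∏ i, y i ^ a i ∈ Ideal.span (Set.range y) ^ ∑ i, a i := by
  rw [← Finset.prod_pow_eq_pow_sum]
  exact Ideal.prod_mem_prod fun i _ ↦
    Ideal.pow_mem_pow (Ideal.subset_span (Set.mem_range_self i)) _

theorem span_range_pow_le {R : Type*} [CommRing R] {d : ℕ} (y : Fin d → R) (k : ℕ) :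
    Ideal.span (Set.range y) ^ k ≤ Ideal.span
      ((fun a : Fin d → ℕ ↦ ∏ i, y i ^ a i) ''
        ((Finset.piAntidiag Finset.univ k : Finset (Fin d → ℕ)) : Set (Fin d → ℕ))) := by
  induction k with
  | zero => simp
  | succ k ih =>
    rw [pow_succ]
    refine (Ideal.mul_mono_left ih).trans ?_
    rw [Ideal.span_mul_span', Ideal.span_le]
    rintro _ ⟨_, ⟨a, ha, rfl⟩, _, ⟨i, rfl⟩, rfl⟩
    refine Ideal.subset_span ⟨a + Pi.single i 1, ?_, ?_⟩
    · simp only [Finset.mem_coe, Finset.mem_piAntidiag] at ha ⊢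
      simp [Finset.sum_add_distrib, ha.1]
    · simp only [Pi.add_apply, pow_add, Finset.prod_mul_distrib]
      simp [Pi.single_apply]

theorem length_quotient_span_pow_le {R : Type*} [CommRing R] {d : ℕ} (x : Fin d → R) (k : ℕ) :
    Module.length R (R ⧸ Ideal.span (Set.range x) ^ k) ≤
      (∑ j ∈ Finset.range k, (Finset.piAntidiag (Finset.univ : Finset (Fin d)) j).card : ℕ) *
        Module.length R (R ⧸ Ideal.span (Set.range x)) := by
  induction k with
  | zero =>
    have : Subsingleton (R ⧸ Ideal.span (Set.range x) ^ 0) := by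
      rw [Ideal.Quotient.subsingleton_iff, pow_zero, Ideal.one_eq_top]
    simp [Module.length_eq_zero]
  | succ k ih =>
    refine (length_quotient_le_add_card_mul (I := Ideal.span (Set.range x))
      (Finset.piAntidiag Finset.univ k) (fun a : Fin d → ℕ ↦ ∏ i, x i ^ a i) (Q :=
        Ideal.span (Set.range x) ^ k) ?_ ((span_range_pow_le x k).trans le_sup_right)).trans ?_
    · intro a ha b hb
      rw [pow_succ']
      refine Ideal.mul_mem_mul hb ?_
      rw [← (Finset.mem_piAntidiag.mp ha).1]
      exact prod_pow_mem_span_pow x a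
    · rw [Finset.sum_range_succ, Nat.cast_add, add_mul]
      gcongr

theorem length_quotient_sup_pow_le {R : Type*} [CommRing R] {d : ℕ} (y : Fin d → R) (m t : ℕ) :
    Module.length R (R ⧸ (Ideal.span (Set.range fun i ↦ y i ^ m) ⊔
        Ideal.span (Set.range y) ^ (m + t))) ≤
      Module.length R (R ⧸ Ideal.span (Set.range y) ^ m) +
        (∑ j ∈ Finset.range t, ((Fintype.piFinset fun _ : Fin d ↦ Finset.range m).filter
          fun a ↦ ∑ i, a i = m + j).card : ℕ) *
        Module.length R (R ⧸ Ideal.span (Set.range y)) := by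
  induction t with
  | zero => simpa using length_quotient_le_of_le le_sup_right
  | succ t ih =>
    refine (length_quotient_le_add_card_mul (I := Ideal.span (Set.range y))
      ((Fintype.piFinset fun _ : Fin d ↦ Finset.range m).filter fun a ↦ ∑ i, a i = m + t)
      (fun a : Fin d → ℕ ↦ ∏ i, y i ^ a i) (Q := Ideal.span (Set.range fun i ↦ y i ^ m) ⊔
        Ideal.span (Set.range y) ^ (m + t)) ?_ ?_).trans ?_
    · intro a ha b hb
      refine Ideal.mem_sup_right ?_
      rw [← add_assoc, pow_succ']
      refine Ideal.mul_mem_mul hb ?_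
      rw [← (Finset.mem_filter.mp ha).2]
      exact prod_pow_mem_span_pow y a
    · refine sup_le (le_sup_left.trans le_sup_left) ((span_range_pow_le y _).trans ?_)
      rw [Ideal.span_le]
      rintro _ ⟨a, ha, rfl⟩
      have ha := (Finset.mem_piAntidiag.mp ha).1
      by_cases hlt : ∀ i, a i < m
      · refine Ideal.mem_sup_right (Ideal.subset_span ⟨a, ?_, rfl⟩)
        simp [hlt, ha]
      · push Not at hlt
        obtain ⟨i, hi⟩ := hlt
        refine Ideal.mem_sup_left (Ideal.mem_sup_left ?_)
        refine Ideal.mem_of_dvd _ ((pow_dvd_pow (y i) hi).trans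
          (Finset.dvd_prod_of_mem (fun i ↦ y i ^ a i) (Finset.mem_univ i))) ?_
        exact Ideal.subset_span (Set.mem_range_self i)
    · rw [Finset.sum_range_succ, Nat.cast_add, add_mul, ← add_assoc]
      gcongr

theorem sum_card_piAntidiag (d k : ℕ) :
    ∑ j ∈ Finset.range (k + 1), (Finset.piAntidiag (Finset.univ : Finset (Fin d)) j).card =
      (k + d).choose d := by
  rw [← Nat.sum_range_multichoose]
  refine Finset.sum_congr rfl fun j _ ↦ ?_
  have h := Finset.card_finsuppAntidiag_nat_eq_multichoose (s := (Finset.univ : Finset (Fin d))) j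
  rw [Finset.card_univ, Fintype.card_fin] at h
  rw [← h, Finset.finsuppAntidiag, Finset.card_map, Finset.card_attach]

theorem pow_le_of_forall_choose_le (d n L : ℕ) (hn : 0 < n)
    (h : ∀ k, ((n * (k + 1) - 1) + d).choose d ≤ (k + d).choose d * L) : n ^ d ≤ L := by
  have key (k : ℕ) : (n : ℝ) ^ d ≤ (1 + (d - 1 : ℝ) / (k + 1)) ^ d * L := by
    have hk : (0 : ℝ) < k + 1 := by positivity
    have h1 := Nat.pow_le_choose (α := ℝ) d ((n * (k + 1) - 1) + d)
    have h2 := Nat.choose_le_pow_div (α := ℝ) d (k + d)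
    have h3 : ((((n * (k + 1) - 1) + d).choose d : ℕ) : ℝ) ≤ ((k + d).choose d : ℕ) * L := by
      exact_mod_cast h k
    have h4 : (n * (k + 1) - 1) + d + 1 - d = n * (k + 1) := by
      have : 0 < n * (k + 1) := by positivity
      omega
    rw [h4] at h1
    have hf : (0 : ℝ) < d.factorial := by positivity
    have h5 : ((n * (k + 1) : ℕ) : ℝ) ^ d / d.factorial ≤
        (((k + d : ℕ) : ℝ) ^ d / d.factorial) * L :=
      h1.trans (h3.trans (by gcongr))
    rw [div_mul_eq_mul_div, div_le_div_iff_of_pos_right hf] at h5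
    have h6 : (1 + (d - 1 : ℝ) / (k + 1)) = (k + d : ℕ) / (k + 1 : ℝ) := by
      push_cast
      field_simp
      ring
    rw [h6, div_pow, div_mul_eq_mul_div, le_div_iff₀ (by positivity), ← mul_pow]
    exact_mod_cast h5
  have hlim : Filter.Tendsto (fun k : ℕ ↦ (1 + (d - 1 : ℝ) / (k + 1)) ^ d * L) Filter.atTop
      (nhds ((1 + 0) ^ d * L)) := by
    refine ((tendsto_const_nhds.add ?_).pow d).mul_const _
    have := (tendsto_one_div_add_atTop_nhds_zero_nat (𝕜 := ℝ)).const_mul (d - 1 : ℝ)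
    simpa [div_eq_mul_inv] using this
  have := ge_of_tendsto' hlim key
  rw [add_zero, one_pow, one_mul] at this
  exact_mod_cast this

theorem card_piFinset_range_eq_sum (d m : ℕ) :
    m ^ d = ∑ j ∈ Finset.range m, (Finset.piAntidiag (Finset.univ : Finset (Fin d)) j).card +
      ∑ j ∈ Finset.range (d * m + 1), ((Fintype.piFinset fun _ : Fin d ↦ Finset.range m).filter
        fun a ↦ ∑ i, a i = m + j).card := by
  have hmaps : ∀ a ∈ (Fintype.piFinset fun _ : Fin d ↦ Finset.range m),
      ∑ i, a i ∈ Finset.range (m + (d * m + 1)) := by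
    intro a ha
    have hle : ∑ i, a i ≤ ∑ _i : Fin d, m :=
      Finset.sum_le_sum fun i _ ↦ (Finset.mem_range.mp (Fintype.mem_piFinset.mp ha i)).le
    simp only [Finset.sum_const, Finset.card_univ, Fintype.card_fin, smul_eq_mul] at hle
    rw [Finset.mem_range]
    omega
  have hcard := Finset.card_eq_sum_card_fiberwise hmaps
  rw [Fintype.card_piFinset_const, Finset.card_range, Finset.sum_range_add] at hcard
  rw [hcard]
  congr 1
  refine Finset.sum_congr rfl fun j hj ↦ congrArg Finset.card ?_
  ext a
  simp only [Finset.mem_filter, Fintype.mem_piFinset, Finset.mem_range, Finset.mem_piAntidiag,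
    Finset.mem_univ, implies_true, and_true, and_iff_right_iff_imp]
  intro ha i
  exact ((Finset.single_le_sum (fun _ _ ↦ Nat.zero_le _) (Finset.mem_univ i)).trans ha.le).trans_lt
    (Finset.mem_range.mp hj)

theorem sum_card_piAntidiag_le_length_quotient_pow {R : Type*} [CommRing R] [IsNoetherianRing R]
    [IsLocalRing R] {d : ℕ} (hdim : ringKrullDim R = d) {y : Fin d → R}
    (hy : Ideal.span (Set.range y) = IsLocalRing.maximalIdeal R) (m : ℕ) :
    (∑ j ∈ Finset.range m, (Finset.piAntidiag (Finset.univ : Finset (Fin d)) j).card : ℕ) ≤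
      Module.length R (R ⧸ IsLocalRing.maximalIdeal R ^ m) := by
  have hof (z : Fin d → R) : Ideal.ofList (List.ofFn z) = Ideal.span (Set.range z) := by
    rw [Ideal.ofList]
    congr 1
    ext r
    simp [List.mem_ofFn]
  have hlen : (List.ofFn y).length = d := List.length_ofFn
  have hweak := isWeaklyRegular_of_ringKrullDim_eq_length d (List.ofFn y) hlen
    ((hof y).trans hy) (by rw [hdim, hlen])
  have hpow := length_quotient_ofList_pow m (List.ofFn y) hweak
  have hmax : Module.length R (R ⧸ IsLocalRing.maximalIdeal R) = 1 := by
    rw [Module.length_eq_one_iff, isSimpleModule_iff_isCoatom]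
    exact (IsLocalRing.maximalIdeal.isMaximal R).out
  rw [List.map_ofFn, hof, hof, hy, smul_eq_mul, smul_eq_mul, Ideal.mul_top, Ideal.mul_top, hmax,
    mul_one, hlen] at hpow
  have hle := length_quotient_sup_pow_le y m (d * m + 1)
  have hsup : Ideal.span (Set.range fun i ↦ y i ^ m) ⊔
      Ideal.span (Set.range y) ^ (m + (d * m + 1)) = Ideal.span (Set.range fun i ↦ y i ^ m) := by
    rw [sup_eq_left]
    refine (span_range_pow_le y _).trans ?_
    rw [Ideal.span_le]
    rintro _ ⟨a, ha, rfl⟩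
    have ha : ∑ i, a i = m + (d * m + 1) := (Finset.mem_piAntidiag.mp ha).1
    obtain ⟨i, hi⟩ : ∃ i, m ≤ a i := by
      by_contra! hlt
      have hle : ∑ i, a i ≤ ∑ _i : Fin d, m := Finset.sum_le_sum fun i _ ↦ (hlt i).le
      simp only [Finset.sum_const, Finset.card_univ, Fintype.card_fin, smul_eq_mul] at hle
      omega
    refine Ideal.mem_of_dvd _ ((pow_dvd_pow (y i) hi).trans
      (Finset.dvd_prod_of_mem (fun i ↦ y i ^ a i) (Finset.mem_univ i))) ?_
    exact Ideal.subset_span (Set.mem_range_self i)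
  rw [hsup, hy, hmax, mul_one] at hle
  refine (ENat.add_le_add_iff_right (ENat.natCast_ne_top _)).mp (le_trans (le_of_eq ?_) hle)
  rw [← Nat.cast_add, ← card_piFinset_range_eq_sum]
  exact hpow.symm

/-- in a regular local ring `(R,M)` of dimension `d` (a Noetherian local
ring whose maximal ideal is generated by `d = dim R` elements), a regular sequence
`x_1,…,x_d ∈ Mⁿ` satisfies `length(R/(x_1,…,x_d)) ≥ n^d`, where length is the Krull
dimension of the lattice of submodules. -/
theorem stmt9 {R : Type*} [CommRing R] [IsNoetherianRing R] [IsLocalRing R]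
    (d : ℕ) (hdim : ringKrullDim R = d)
    (hregular : ∃ y : Fin d → R, Ideal.span (Set.range y) = IsLocalRing.maximalIdeal R)
    (n : ℕ) (hn : 0 < n) (x : Fin d → R)
    (hx : ∀ i, x i ∈ (IsLocalRing.maximalIdeal R) ^ n)
    (hreg : RingTheory.Sequence.IsRegular R (List.ofFn x)) :
    ((n ^ d : ℕ) : WithBot ℕ∞) ≤
      Order.krullDim (Submodule R (R ⧸ Ideal.span (Set.range x))) := by
  rw [← Module.coe_length R (R ⧸ Ideal.span (Set.range x))]
  suffices ((n ^ d : ℕ) : ℕ∞) ≤ Module.length R (R ⧸ Ideal.span (Set.range x)) by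
    exact_mod_cast this
  obtain htop | htop := eq_or_ne (Module.length R (R ⧸ Ideal.span (Set.range x))) ⊤
  · simp [htop]
  obtain ⟨L, hL⟩ := ENat.ne_top_iff_exists.mp htop
  rw [← hL, Nat.cast_le]
  obtain ⟨y, hy⟩ := hregular
  refine pow_le_of_forall_choose_le d n L hn fun k ↦ ?_
  have hpos : n * (k + 1) - 1 + 1 = n * (k + 1) := Nat.sub_add_cancel (Nat.mul_pos hn k.succ_pos)
  have hle : Ideal.span (Set.range x) ^ (k + 1) ≤
      IsLocalRing.maximalIdeal R ^ (n * (k + 1)) := by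
    rw [pow_mul]
    refine Ideal.pow_right_mono ?_ _
    rw [Ideal.span_le]
    rintro _ ⟨i, rfl⟩
    exact hx i
  have h := (sum_card_piAntidiag_le_length_quotient_pow hdim hy _).trans
    ((length_quotient_le_of_le hle).trans (length_quotient_span_pow_le x (k + 1)))
  rw [← hpos, sum_card_piAntidiag, sum_card_piAntidiag, ← hL] at h
  exact_mod_cast h

end
end

section
/- Let I = ∩_i I(p_i) where the n = C(s,2) points p_i ∈ P^2 form a star configuration coming from s ≥ 2 lines in P^2. Then β(I^(k)) = k·α(I) = k(s-1) for all k ≥ 1; moreover, for every even integer m > 0, α(I^(m))·β(I^(m)) = m^2·n and (I^(m))^k = I^(mk) for all k ≥ 1. -/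
open MvPolynomial
open scoped LinearAlgebra.Projectivization

noncomputable section

/-- A family of `n = C(s,N)` distinct points of `ℙ^N` is a star configuration for `s ≥ N`
hyperplanes (in general position: no `N+1` of them meet in a single point) if the points
are exactly the points obtained by intersecting `N` of the `s` hyperplanes. The
hyperplanes are recorded by linear functionals `φ` in general position (any
`min(s, N+1)` of them are linearly independent). -/
def IsStarConfiguration {K : Type*} [Field K] {N n : ℕ} (s : ℕ)
    (p : Fin n → ℙ K (Fin (N + 1) → K)) : Prop :=
  N ≤ s ∧ n = Nat.choose s N ∧ Function.Injective p ∧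
  ∃ φ : Fin s → ((Fin (N + 1) → K) →ₗ[K] K),
    (∀ T : Finset (Fin s), T.card ≤ N + 1 →
      LinearIndependent K (fun i : T => φ (i : Fin s))) ∧
    (∀ i : Fin n, ∃ T : Finset (Fin s), T.card = N ∧ ∀ j ∈ T, φ j (p i).rep = 0) ∧
    (∀ T : Finset (Fin s), T.card = N → ∃ i : Fin n, ∀ j ∈ T, φ j (p i).rep = 0)

theorem totalDegree_aeval_le {K σ τ : Type*} [Field K] [Fintype σ] {g : σ → MvPolynomial τ K}
    (hg : ∀ i, (g i).totalDegree ≤ 1) (f : MvPolynomial σ K) :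
    (aeval g f).totalDegree ≤ f.totalDegree := by
  rw [aeval_def, eval₂_eq']
  refine totalDegree_finsetSum_le fun d hd => ?_
  calc _ ≤ (algebraMap K (MvPolynomial τ K) (coeff d f)).totalDegree
          + (∏ i, g i ^ d i).totalDegree := totalDegree_mul _ _
    _ ≤ 0 + ∑ i, d i := by
        refine add_le_add (totalDegree_C _).le ?_
        refine (totalDegree_finsetProd _ _).trans (Finset.sum_le_sum fun i _ => ?_)
        refine (totalDegree_pow _ _).trans ?_
        simpa using Nat.mul_le_mul_left (d i) (hg i)
    _ ≤ f.totalDegree := by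
        rw [zero_add]
        refine le_trans (le_of_eq ?_) (le_totalDegree hd)
        rw [Finsupp.sum_fintype _ _ fun _ => rfl]

theorem exists_dual_apply_eq_one {K V : Type*} [Field K] [AddCommGroup V] [Module K V]
    {l : Module.Dual K V} (hl : l ≠ 0) : ∃ v, l v = 1 := by
  obtain ⟨w, hw⟩ := DFunLike.ne_iff.1 hl
  exact ⟨(l w)⁻¹ • w, by simpa using inv_mul_cancel₀ hw⟩

section LinearForms

variable {K σ : Type*} [Field K] [Fintype σ] [DecidableEq σ]

/-- The linear form attached to a linear functional on `σ → K`. -/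
def linearForm : Module.Dual K (σ → K) →ₗ[K] MvPolynomial σ K :=
  ∑ i, (LinearMap.toSpanSingleton K (MvPolynomial σ K) (X i)).comp
    (LinearMap.applyₗ (Pi.single i (1 : K)))

theorem linearForm_apply (l : Module.Dual K (σ → K)) :
    linearForm l = ∑ i, l (Pi.single i 1) • (X i : MvPolynomial σ K) := by
  simp [linearForm]

theorem sum_smul_single (l : Module.Dual K (σ → K)) (x : σ → K) :
    ∑ i, l (Pi.single i 1) * x i = l x := by
  conv_rhs => rw [pi_eq_sum_univ' x]
  simp [map_sum, mul_comm]

theorem aeval_linearForm {A : Type*} [CommRing A] [Algebra K A] (g : σ → A)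
    (l : Module.Dual K (σ → K)) :
    aeval g (linearForm l) = ∑ i, l (Pi.single i 1) • g i := by
  simp [linearForm_apply]

@[simp]
theorem eval_linearForm (l : Module.Dual K (σ → K)) (x : σ → K) :
    eval x (linearForm l) = l x := by
  simp [linearForm_apply, smul_eval, sum_smul_single]

theorem linearForm_proj (i : σ) :
    linearForm (LinearMap.proj i : Module.Dual K (σ → K)) = X i := by
  simp [linearForm_apply, Pi.single_apply]

theorem linearForm_injective :
    Function.Injective (linearForm : Module.Dual K (σ → K) → MvPolynomial σ K) := by
  intro l l' h
  ext x
  simpa using congrArg (eval (Pi.single x 1)) h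

theorem linearForm_ne_zero {l : Module.Dual K (σ → K)} (hl : l ≠ 0) : linearForm l ≠ 0 := by
  rw [← map_zero linearForm]
  exact linearForm_injective.ne hl

theorem isHomogeneous_linearForm (l : Module.Dual K (σ → K)) : (linearForm l).IsHomogeneous 1 := by
  rw [linearForm_apply]
  refine IsHomogeneous.sum _ _ _ fun i _ => ?_
  rw [smul_eq_C_mul]
  exact isHomogeneous_C_mul_X _ _

theorem isHomogeneous_prod_linearForm {ι : Type*} (T : Finset ι)
    (φ : ι → Module.Dual K (σ → K)) : (∏ i ∈ T, linearForm (φ i)).IsHomogeneous T.card := by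
  simpa using IsHomogeneous.prod T (fun i => linearForm (φ i)) (fun _ => 1)
    fun i _ => isHomogeneous_linearForm _

/-- The substitution `x ↦ x - l(x) v`; when `l v = 1` it is the projection along `v` onto the
hyperplane `l = 0`. -/
def hyperplaneProj (l : Module.Dual K (σ → K)) (v : σ → K) :
    MvPolynomial σ K →ₐ[K] MvPolynomial σ K :=
  aeval fun i => X i - v i • linearForm l

theorem hyperplaneProj_linearForm (l l' : Module.Dual K (σ → K)) (v : σ → K) :
    hyperplaneProj l v (linearForm l') = linearForm (l' - l' v • l) := by
  rw [hyperplaneProj, aeval_linearForm, map_sub, map_smul, ← sum_smul_single l' v,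
    linearForm_apply l', Finset.sum_smul, ← Finset.sum_sub_distrib]
  simp [smul_sub, smul_smul]

theorem dvd_sub_hyperplaneProj (l : Module.Dual K (σ → K)) (v : σ → K) (f : MvPolynomial σ K) :
    linearForm l ∣ f - hyperplaneProj l v f := by
  rw [← Ideal.mem_span_singleton, ← Ideal.Quotient.mk_eq_mk_iff_sub_mem]
  have : (Ideal.Quotient.mkₐ K (Ideal.span {linearForm l})) =
      (Ideal.Quotient.mkₐ K (Ideal.span {linearForm l})).comp (hyperplaneProj l v) := by
    ext i
    simp only [hyperplaneProj, AlgHom.comp_apply, aeval_X, Ideal.Quotient.mkₐ_eq_mk]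
    rw [Ideal.Quotient.mk_eq_mk_iff_sub_mem, sub_sub_cancel]
    exact Submodule.smul_of_tower_mem _ _ (Ideal.mem_span_singleton_self _)
  exact DFunLike.congr_fun this f

theorem hyperplaneProj_eq_zero_iff {l : Module.Dual K (σ → K)} {v : σ → K} (hv : l v = 1)
    (f : MvPolynomial σ K) : hyperplaneProj l v f = 0 ↔ linearForm l ∣ f := by
  constructor
  · intro h
    simpa [h] using dvd_sub_hyperplaneProj l v f
  · rintro ⟨g, rfl⟩
    simp [hyperplaneProj_linearForm, hv]

theorem hyperplaneProj_idem {l : Module.Dual K (σ → K)} {v : σ → K} (hv : l v = 1)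
    (f : MvPolynomial σ K) :
    hyperplaneProj l v (hyperplaneProj l v f) = hyperplaneProj l v f := by
  have := (hyperplaneProj_eq_zero_iff hv _).2 (dvd_sub_hyperplaneProj l v f)
  rw [map_sub, sub_eq_zero] at this
  exact this.symm

theorem prime_linearForm {l : Module.Dual K (σ → K)} (hl : l ≠ 0) : Prime (linearForm l) := by
  obtain ⟨v, hv⟩ := exists_dual_apply_eq_one hl
  refine ⟨linearForm_ne_zero hl, fun h => ?_, fun a b hab => ?_⟩
  · simpa using (hyperplaneProj_eq_zero_iff hv 1).2 h.dvd
  · simpa [← hyperplaneProj_eq_zero_iff hv] using hab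

theorem totalDegree_hyperplaneProj_le (l : Module.Dual K (σ → K)) (v : σ → K)
    (f : MvPolynomial σ K) : (hyperplaneProj l v f).totalDegree ≤ f.totalDegree := by
  refine totalDegree_aeval_le (fun i => IsHomogeneous.totalDegree_le ?_) f
  refine (isHomogeneous_X _ _).sub ?_
  rw [smul_eq_C_mul]
  exact (isHomogeneous_linearForm l).C_mul _

theorem not_linearForm_dvd {l l' : Module.Dual K (σ → K)}
    (h : LinearIndependent K ![l, l']) : ¬ linearForm l ∣ linearForm l' := by
  have hl : l ≠ 0 := h.ne_zero 0
  obtain ⟨v, hv⟩ := exists_dual_apply_eq_one hl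
  rw [← hyperplaneProj_eq_zero_iff hv, hyperplaneProj_linearForm]
  refine linearForm_ne_zero fun h0 => ?_
  have := (LinearIndependent.pair_iff.1 h (-l' v) 1 (by rw [← h0]; module)).2
  exact one_ne_zero this

end LinearForms

theorem Finset.prod_pow_dvd_of_prime {M ι : Type*} [CommMonoidWithZero M] [IsCancelMulZero M]
    (T : Finset ι) (q : ι → M) (m : ℕ) (hq : ∀ i ∈ T, Prime (q i))
    (hqq : ∀ i ∈ T, ∀ j ∈ T, i ≠ j → ¬ q i ∣ q j) {f : M} (hf : ∀ i ∈ T, q i ^ m ∣ f) :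
    ∏ i ∈ T, q i ^ m ∣ f := by
  classical
  induction T using Finset.induction_on with
  | empty => simp
  | insert a T ha ih =>
    simp only [Finset.mem_insert, forall_eq_or_imp] at hq hqq hf
    obtain ⟨c, rfl⟩ := ih hq.2 (fun i hi j hj => (hqq.2 i hi).2 j hj) hf.2
    rw [Finset.prod_insert ha, mul_comm]
    refine mul_dvd_mul_left _ (hq.1.pow_dvd_of_dvd_mul_left m ?_ hf.1)
    rw [hq.1.dvd_finsetProd_iff]
    rintro ⟨j, hj, hdvd⟩
    exact hqq.1.2 j hj (by rintro rfl; exact ha hj) (hq.1.dvd_of_dvd_pow hdvd)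

section PointIdeal

variable {K : Type*} [Field K] {N : ℕ} (q : ℙ K (Fin (N + 1) → K))

theorem linearForm_mem_pointIdeal {l : Module.Dual K (Fin (N + 1) → K)} (hl : l q.rep = 0) :
    linearForm l ∈ pointIdeal q :=
  Ideal.subset_span ⟨⟨1, isHomogeneous_linearForm l⟩, by rw [eval_linearForm, hl]⟩

/-- The substitution `x ↦ l(x) q + t (x - l(x) q)`; when `l q = 1`, the `t`-adic order of the
image of `f` is the order of vanishing of `f` at `q`. -/
def pointScaling (l : Module.Dual K (Fin (N + 1) → K)) :
    MvPolynomial (Fin (N + 1)) K →ₐ[K] Polynomial (MvPolynomial (Fin (N + 1)) K) :=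
  aeval fun i => Polynomial.C (q.rep i • linearForm l) +
    Polynomial.X * Polynomial.C (X i - q.rep i • linearForm l)

theorem pointScaling_linearForm (l l' : Module.Dual K (Fin (N + 1) → K)) :
    pointScaling q l (linearForm l') = Polynomial.C (l' q.rep • linearForm l) +
      Polynomial.X * Polynomial.C (linearForm l' - l' q.rep • linearForm l) := by
  have h : ∑ i, (l' (Pi.single i 1) * q.rep i) • linearForm l = l' q.rep • linearForm l := by
    rw [← Finset.sum_smul, sum_smul_single]
  rw [pointScaling, aeval_linearForm, ← h, linearForm_apply l', ← Finset.sum_sub_distrib,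
    map_sum, map_sum, Finset.mul_sum, ← Finset.sum_add_distrib]
  refine Finset.sum_congr rfl fun i _ => ?_
  rw [smul_add, mul_smul, ← smul_sub]
  simp only [← Polynomial.smul_C, mul_smul_comm]

theorem eval_zero_pointScaling (l : Module.Dual K (Fin (N + 1) → K))
    {f : MvPolynomial (Fin (N + 1)) K} {d : ℕ} (hf : f.IsHomogeneous d) :
    (pointScaling q l f).eval 0 = eval q.rep f • linearForm l ^ d := by
  have h : (Polynomial.evalRingHom 0).comp (pointScaling q l).toRingHom =
      (aeval fun i => q.rep i • linearForm l :
        MvPolynomial (Fin (N + 1)) K →ₐ[K] MvPolynomial (Fin (N + 1)) K).toRingHom := by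
    apply MvPolynomial.ringHom_ext
    · intro r
      simp [algebraMap_eq, Polynomial.algebraMap_apply]
    · intro i
      simp [pointScaling]
  refine (DFunLike.congr_fun h f).trans ?_
  change aeval _ f = _
  rw [aeval_def, eval₂_eq', eval_eq', Finset.sum_smul]
  refine Finset.sum_congr rfl fun e he => ?_
  have hd : ∑ i, e i = d := by
    rw [hf.degree_eq_sum_deg_support he]
    exact (Finset.sum_subset (Finset.subset_univ _) (by simp)).symm
  simp_rw [smul_pow, ← hd, ← Finset.prod_pow_eq_pow_sum, Finset.prod_smul, mul_smul,
    algebraMap_eq, ← smul_eq_C_mul]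

theorem eval_one_pointScaling (l : Module.Dual K (Fin (N + 1) → K))
    (f : MvPolynomial (Fin (N + 1)) K) : (pointScaling q l f).eval 1 = f := by
  have h : (Polynomial.evalRingHom 1).comp (pointScaling q l).toRingHom = RingHom.id _ := by
    apply MvPolynomial.ringHom_ext
    · intro r
      simp [algebraMap_eq, Polynomial.algebraMap_apply]
    · intro i
      simp [pointScaling]
  exact DFunLike.congr_fun h f

variable {q} {l : Module.Dual K (Fin (N + 1) → K)} (hl : l q.rep = 1)

include hl

theorem pointScaling_mem_reesAlgebra {J : Ideal (MvPolynomial (Fin (N + 1)) K)}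
    (hJ : ∀ l' : Module.Dual K (Fin (N + 1) → K), l' q.rep = 0 → linearForm l' ∈ J)
    (f : MvPolynomial (Fin (N + 1)) K) : pointScaling q l f ∈ reesAlgebra J := by
  induction f using MvPolynomial.induction_on with
  | C a =>
    rw [← algebraMap_eq, AlgHom.commutes, Polynomial.algebraMap_apply]
    exact (reesAlgebra J).algebraMap_mem _
  | add f g hf hg => rw [map_add]; exact add_mem hf hg
  | mul_X f i hf =>
    rw [map_mul]
    refine mul_mem hf ?_
    rw [pointScaling, aeval_X]
    refine add_mem ((reesAlgebra J).algebraMap_mem _) ?_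
    rw [Polynomial.X_mul_C, Polynomial.C_mul_X_eq_monomial]
    refine reesAlgebra.monomial_mem.2 ?_
    rw [pow_one, ← linearForm_proj i, ← map_smul, ← map_sub]
    exact hJ _ (by simp [hl])

theorem mem_pow_of_X_pow_dvd_pointScaling {J : Ideal (MvPolynomial (Fin (N + 1)) K)}
    (hJ : ∀ l' : Module.Dual K (Fin (N + 1) → K), l' q.rep = 0 → linearForm l' ∈ J) {m : ℕ}
    {f : MvPolynomial (Fin (N + 1)) K} (h : Polynomial.X ^ m ∣ pointScaling q l f) :
    f ∈ J ^ m := by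
  rw [← eval_one_pointScaling q l f, Polynomial.eval_eq_sum_range]
  refine sum_mem fun k _ => ?_
  rw [one_pow, mul_one]
  rcases lt_or_ge k m with hk | hk
  · rw [Polynomial.X_pow_dvd_iff.1 h k hk]
    exact zero_mem _
  · exact Ideal.pow_le_pow_right hk
      ((mem_reesAlgebra_iff _ _).1 (pointScaling_mem_reesAlgebra hl hJ f) k)

theorem mem_pointIdeal_pow_iff (m : ℕ) (f : MvPolynomial (Fin (N + 1)) K) :
    f ∈ pointIdeal q ^ m ↔ Polynomial.X ^ m ∣ pointScaling q l f := by
  constructor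
  · have h : pointIdeal q ≤ (Ideal.span {Polynomial.X}).comap (pointScaling q l) := by
      refine Ideal.span_le.2 ?_
      rintro g ⟨⟨d, hg⟩, h0⟩
      rw [SetLike.mem_coe, Ideal.mem_comap, Ideal.mem_span_singleton, Polynomial.X_dvd_iff,
        Polynomial.coeff_zero_eq_eval_zero, eval_zero_pointScaling q l hg, h0, zero_smul]
    intro hf
    have := (Ideal.pow_right_mono h m).trans (Ideal.le_comap_pow _ m) hf
    rwa [Ideal.mem_comap, Ideal.span_singleton_pow, Ideal.mem_span_singleton] at this
  · exact mem_pow_of_X_pow_dvd_pointScaling hl fun _ => linearForm_mem_pointIdeal q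

omit hl

theorem exists_dual_rep_eq_one (q : ℙ K (Fin (N + 1) → K)) :
    ∃ l : Module.Dual K (Fin (N + 1) → K), l q.rep = 1 := by
  obtain ⟨i, hi⟩ := Function.ne_iff.1 q.rep_nonzero
  exact ⟨(q.rep i)⁻¹ • LinearMap.proj i, by simpa using inv_mul_cancel₀ hi⟩

theorem pointIdeal_le {J : Ideal (MvPolynomial (Fin (N + 1)) K)}
    (hJ : ∀ l' : Module.Dual K (Fin (N + 1) → K), l' q.rep = 0 → linearForm l' ∈ J) :
    pointIdeal q ≤ J := by
  obtain ⟨l, hl⟩ := exists_dual_rep_eq_one q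
  intro f hf
  rw [← pow_one (pointIdeal q), mem_pointIdeal_pow_iff hl] at hf
  simpa using mem_pow_of_X_pow_dvd_pointScaling hl hJ hf

theorem linearForm_mul_mem_pointIdeal_pow {l' : Module.Dual K (Fin (N + 1) → K)}
    (hl' : l' q.rep = 0) (h0 : l' ≠ 0) {m : ℕ} {f : MvPolynomial (Fin (N + 1)) K}
    (hf : linearForm l' * f ∈ pointIdeal q ^ m) : f ∈ pointIdeal q ^ (m - 1) := by
  obtain ⟨l, hl⟩ := exists_dual_rep_eq_one q
  rcases m with _ | m
  · simp
  rw [mem_pointIdeal_pow_iff hl, map_mul, pointScaling_linearForm, hl', zero_smul, map_zero,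
    zero_add, sub_zero, pow_succ', mul_assoc, mul_dvd_mul_iff_left Polynomial.X_ne_zero] at hf
  rw [mem_pointIdeal_pow_iff hl]
  refine Polynomial.prime_X.pow_dvd_of_dvd_mul_left _ ?_ hf
  rw [Polynomial.X_dvd_iff, Polynomial.coeff_C_zero]
  exact linearForm_ne_zero h0

theorem mul_mem_pointIdeal_pow_of_eval_ne_zero {g : MvPolynomial (Fin (N + 1)) K} {d : ℕ}
    (hg : g.IsHomogeneous d) (h0 : eval q.rep g ≠ 0) {m : ℕ} {f : MvPolynomial (Fin (N + 1)) K}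
    (hf : g * f ∈ pointIdeal q ^ m) : f ∈ pointIdeal q ^ m := by
  obtain ⟨l, hl⟩ := exists_dual_rep_eq_one q
  rw [mem_pointIdeal_pow_iff hl, map_mul] at hf
  rw [mem_pointIdeal_pow_iff hl]
  refine Polynomial.prime_X.pow_dvd_of_dvd_mul_left _ ?_ hf
  rw [Polynomial.X_dvd_iff, Polynomial.coeff_zero_eq_eval_zero, eval_zero_pointScaling q l hg]
  refine smul_ne_zero h0 (pow_ne_zero _ (linearForm_ne_zero ?_))
  rintro rfl
  simp at hl

end PointIdeal

theorem RingTheory.Sequence.isRegular_pair_iff {R : Type*} [CommRing R] [IsDomain R] {f g : R} :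
    RingTheory.Sequence.IsRegular R [f, g] ↔
      f ≠ 0 ∧ (∀ x, f ∣ g * x → f ∣ x) ∧ Ideal.span {f, g} ≠ ⊤ := by
  have h1 : IsSMulRegular (R ⧸ (Ideal.ofList ([] : List R) • ⊤ : Submodule R R)) f ↔ f ≠ 0 := by
    rw [isSMulRegular_quotient_iff_mem_of_smul_mem]
    simp only [Ideal.ofList_nil, smul_eq_mul, Ideal.bot_mul, Ideal.mem_bot,
      mul_eq_zero]
    exact ⟨fun h h0 => one_ne_zero (h 1 (Or.inl h0)), fun h x hx => hx.resolve_left h⟩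
  have h2 : IsSMulRegular (R ⧸ (Ideal.ofList [f] • ⊤ : Submodule R R)) g ↔
      ∀ x, f ∣ g * x → f ∣ x := by
    rw [isSMulRegular_quotient_iff_mem_of_smul_mem]
    simp [Ideal.mem_span_singleton]
  rw [RingTheory.Sequence.isRegular_iff, RingTheory.Sequence.isWeaklyRegular_iff_Fin,
    ← and_assoc]
  refine and_congr ?_ ?_
  · rw [← h1, ← h2]
    exact Fin.forall_fin_two
  · simp [Ideal.span_insert, eq_comm]

section DualIndependence

variable {K : Type*} [Field K]

theorem eq_zero_of_linearIndependent_triple {a b c : Module.Dual K (Fin (2 + 1) → K)}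
    (h : LinearIndependent K ![a, b, c]) {x : Fin (2 + 1) → K} (ha : a x = 0) (hb : b x = 0)
    (hc : c x = 0) : x = 0 := by
  have htop : Submodule.span K (Set.range ![a, b, c]) = ⊤ :=
    h.span_eq_top_of_card_eq_finrank (by simp [Subspace.dual_finrank_eq])
  have hle : Submodule.span K (Set.range ![a, b, c]) ≤ LinearMap.ker (Module.Dual.eval K _ x) := by
    rw [Submodule.span_le]
    rintro _ ⟨i, rfl⟩
    fin_cases i
    · exact ha
    · exact hb
    · exact hc
  funext i
  exact hle (htop ▸ Submodule.mem_top : LinearMap.proj i ∈ _)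

theorem exists_smul_add_smul_eq {a b l : Module.Dual K (Fin (2 + 1) → K)}
    (h : LinearIndependent K ![a, b]) {x : Fin (2 + 1) → K} (hx : x ≠ 0) (ha : a x = 0)
    (hb : b x = 0) (hl : l x = 0) : ∃ r t : K, r • a + t • b = l := by
  by_contra hcon
  refine hx (eq_zero_of_linearIndependent_triple (a := l) (b := a) (c := b) ?_ hl ha hb)
  refine linearIndependent_finCons.2 ⟨h, ?_⟩
  rwa [Matrix.range_cons, Matrix.range_cons, Matrix.range_empty, Set.union_empty,
    Set.singleton_union, Submodule.mem_span_pair]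

end DualIndependence

section StarConfiguration

variable {K ι κ : Type*} [Field K]

/-- The lines `φ i = 0`, no three of them concurrent, have the `p a` as their pairwise
intersection points. -/
structure IsLineStar (p : κ → ℙ K (Fin (2 + 1) → K))
    (φ : ι → Module.Dual K (Fin (2 + 1) → K)) : Prop where
  pair_indep : ∀ i j, i ≠ j → LinearIndependent K ![φ i, φ j]
  triple_indep : ∀ i j k, i ≠ j → i ≠ k → j ≠ k → LinearIndependent K ![φ i, φ j, φ k]
  exists_lines : ∀ a, ∃ i j, i ≠ j ∧ φ i (p a).rep = 0 ∧ φ j (p a).rep = 0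
  exists_point : ∀ i j, i ≠ j → ∃ a, φ i (p a).rep = 0 ∧ φ j (p a).rep = 0

theorem IsStarConfiguration.exists_isLineStar {n s : ℕ} {p : Fin n → ℙ K (Fin (2 + 1) → K)}
    (h : IsStarConfiguration (N := 2) s p) :
    ∃ φ : Fin s → Module.Dual K (Fin (2 + 1) → K), IsLineStar p φ := by
  obtain ⟨-, -, -, φ, hind, hlines, hpoint⟩ := h
  refine ⟨φ, fun i j hij => ?_, fun i j k hij hik hjk => ?_, fun a => ?_, fun i j hij => ?_⟩
  · have := (hind {i, j} (Finset.card_le_two.trans (by norm_num))).comp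
      ![⟨i, by simp⟩, ⟨j, by simp⟩] (by
        intro x y hxy
        fin_cases x <;> fin_cases y <;> simp_all)
    convert! this using 1
    funext x
    fin_cases x <;> rfl
  · have := (hind {i, j, k} Finset.card_le_three).comp
      ![⟨i, by simp⟩, ⟨j, by simp⟩, ⟨k, by simp⟩] (by
        intro x y hxy
        fin_cases x <;> fin_cases y <;> simp_all)
    convert! this using 1
    funext x
    fin_cases x <;> rfl
  · obtain ⟨T, hT, h0⟩ := hlines a
    obtain ⟨i, j, hij, rfl⟩ := Finset.card_eq_two.1 hT
    exact ⟨i, j, hij, h0 i (by simp), h0 j (by simp)⟩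
  · obtain ⟨a, ha⟩ := hpoint {i, j} (Finset.card_pair hij)
    exact ⟨a, ha i (by simp), ha j (by simp)⟩

/-- The product of all the lines but the `i`-th. -/
def prodOthers [Fintype ι] [DecidableEq ι] (φ : ι → Module.Dual K (Fin (2 + 1) → K)) (i : ι) :
    MvPolynomial (Fin (2 + 1)) K :=
  ∏ j ∈ Finset.univ.erase i, linearForm (φ j)

section

variable [Fintype ι] [DecidableEq ι] (φ : ι → Module.Dual K (Fin (2 + 1) → K))

theorem isHomogeneous_prodOthers (i : ι) :
    (prodOthers φ i).IsHomogeneous (Fintype.card ι - 1) := by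
  have := isHomogeneous_prod_linearForm (Finset.univ.erase i) φ
  rwa [Finset.card_erase_of_mem (Finset.mem_univ i), Finset.card_univ] at this

theorem linearForm_dvd_prodOthers {i j : ι} (hij : i ≠ j) :
    linearForm (φ i) ∣ prodOthers φ j :=
  Finset.dvd_prod_of_mem (fun i => linearForm (φ i)) (by simpa using hij)

theorem prod_linearForm_eq_mul_mul {j k : ι} (hjk : j ≠ k) : ∏ i, linearForm (φ i) =
    linearForm (φ j) * (linearForm (φ k) *
      ∏ i ∈ (Finset.univ.erase j).erase k, linearForm (φ i)) := by
  rw [Finset.mul_prod_erase _ (fun i => linearForm (φ i)) (by simpa using hjk.symm),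
    Finset.mul_prod_erase _ (fun i => linearForm (φ i)) (Finset.mem_univ j)]

end

namespace IsLineStar

variable {p : κ → ℙ K (Fin (2 + 1) → K)} {φ : ι → Module.Dual K (Fin (2 + 1) → K)}
  (h : IsLineStar p φ)

include h

theorem ne_zero [Nontrivial ι] (i : ι) : φ i ≠ 0 := by
  obtain ⟨j, hj⟩ := exists_ne i
  exact (h.pair_indep i j hj.symm).ne_zero 0

theorem apply_ne_zero {i j k : ι} (hij : i ≠ j) (hik : i ≠ k) (hjk : j ≠ k) {a : κ}
    (hi : φ i (p a).rep = 0) (hj : φ j (p a).rep = 0) : φ k (p a).rep ≠ 0 := fun hk =>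
  (p a).rep_nonzero
    (eq_zero_of_linearIndependent_triple (h.triple_indep i j k hij hik hjk) hi hj hk)

theorem hyperplaneProj_pow_dvd {i j : ι} (hij : i ≠ j) {v : Fin (2 + 1) → K} (hv : φ i v = 1)
    {m : ℕ} {f : MvPolynomial (Fin (2 + 1)) K} (hf : f ∈ ⨅ a, pointIdeal (p a) ^ m) :
    hyperplaneProj (φ i) v (linearForm (φ j)) ^ m ∣ hyperplaneProj (φ i) v f := by
  obtain ⟨a, hi, hj⟩ := h.exists_point i j hij
  have hle : pointIdeal (p a) ≤
      (Ideal.span {hyperplaneProj (φ i) v (linearForm (φ j))}).comap (hyperplaneProj (φ i) v) := by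
    refine pointIdeal_le fun l hl => ?_
    obtain ⟨r, t, rfl⟩ :=
      exists_smul_add_smul_eq (h.pair_indep i j hij) (p a).rep_nonzero hi hj hl
    rw [Ideal.mem_comap, map_add, map_smul, map_smul, map_add, map_smul, map_smul,
      (hyperplaneProj_eq_zero_iff hv _).2 dvd_rfl, smul_zero, zero_add]
    exact Submodule.smul_of_tower_mem _ _ (Ideal.mem_span_singleton_self _)
  have := (Ideal.pow_right_mono hle m).trans (Ideal.le_comap_pow _ m) ((Ideal.mem_iInf.1 hf) a)
  rwa [Ideal.mem_comap, Ideal.span_singleton_pow, Ideal.mem_span_singleton] at this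

theorem prime_hyperplaneProj {i j : ι} (hij : i ≠ j) {v : Fin (2 + 1) → K} (hv : φ i v = 1) :
    Prime (hyperplaneProj (φ i) v (linearForm (φ j))) := by
  rw [hyperplaneProj_linearForm]
  refine prime_linearForm fun h0 => not_linearForm_dvd (h.pair_indep i j hij) ?_
  rw [← hyperplaneProj_eq_zero_iff hv, hyperplaneProj_linearForm, h0, map_zero]

theorem not_hyperplaneProj_dvd {i j k : ι} (hij : i ≠ j) (hik : i ≠ k) (hjk : j ≠ k)
    (v : Fin (2 + 1) → K) : ¬ hyperplaneProj (φ i) v (linearForm (φ j)) ∣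
      hyperplaneProj (φ i) v (linearForm (φ k)) := by
  obtain ⟨a, hi, hj⟩ := h.exists_point i j hij
  rintro ⟨c, hc⟩
  have := congrArg (eval (p a).rep) hc
  rw [hyperplaneProj_linearForm, hyperplaneProj_linearForm, map_mul, eval_linearForm,
    eval_linearForm] at this
  exact h.apply_ne_zero hij hik hjk hi hj (by simpa [hi, hj] using this)

theorem prod_dvd [Nontrivial ι] [Fintype ι] {f : MvPolynomial (Fin (2 + 1)) K}
    (hf : ∀ i, linearForm (φ i) ∣ f) : ∏ i, linearForm (φ i) ∣ f := by
  have := Finset.prod_pow_dvd_of_prime Finset.univ (fun i => linearForm (φ i)) 1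
    (fun i _ => prime_linearForm (h.ne_zero i))
    (fun i _ j _ hij => not_linearForm_dvd (h.pair_indep i j hij)) (f := f)
    (fun i _ => by rw [pow_one]; exact hf i)
  simpa using this

theorem totalDegree_prod_mul [Nontrivial ι] [Fintype ι] {f : MvPolynomial (Fin (2 + 1)) K}
    (hf : f ≠ 0) :
    ((∏ i, linearForm (φ i)) * f).totalDegree = Fintype.card ι + f.totalDegree := by
  have h0 : ∏ i, linearForm (φ i) ≠ 0 :=
    Finset.prod_ne_zero_iff.2 fun i _ => linearForm_ne_zero (h.ne_zero i)
  rw [totalDegree_mul_of_isDomain h0 hf,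
    (isHomogeneous_prod_linearForm _ φ).totalDegree h0, Finset.card_univ]

variable [Fintype ι] [DecidableEq ι]

theorem hyperplaneProj_prodOthers_pow_dvd {i : ι} {v : Fin (2 + 1) → K} (hv : φ i v = 1)
    {m : ℕ} {f : MvPolynomial (Fin (2 + 1)) K} (hf : f ∈ ⨅ a, pointIdeal (p a) ^ m) :
    hyperplaneProj (φ i) v (prodOthers φ i) ^ m ∣ hyperplaneProj (φ i) v f := by
  rw [prodOthers, map_prod, ← Finset.prod_pow]
  refine Finset.prod_pow_dvd_of_prime _ _ m (fun j hj => ?_) (fun j hj k hk hjk => ?_)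
    fun j hj => ?_
  · exact h.prime_hyperplaneProj (Finset.ne_of_mem_erase hj).symm hv
  · exact h.not_hyperplaneProj_dvd (Finset.ne_of_mem_erase hj).symm
      (Finset.ne_of_mem_erase hk).symm hjk v
  · exact h.hyperplaneProj_pow_dvd (Finset.ne_of_mem_erase hj).symm hv hf

theorem mul_card_sub_one_le_totalDegree [Nontrivial ι] {i : ι} {m : ℕ}
    {f : MvPolynomial (Fin (2 + 1)) K} (hf : f ∈ ⨅ a, pointIdeal (p a) ^ m)
    (hi : ¬ linearForm (φ i) ∣ f) : m * (Fintype.card ι - 1) ≤ f.totalDegree := by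
  obtain ⟨v, hv⟩ := exists_dual_apply_eq_one (h.ne_zero i)
  have h0 := mt (hyperplaneProj_eq_zero_iff hv f).1 hi
  refine le_trans ?_ (totalDegree_hyperplaneProj_le (φ i) v f)
  obtain ⟨c, hc⟩ := h.hyperplaneProj_prodOthers_pow_dvd hv hf
  rw [hc] at h0 ⊢
  rw [totalDegree_mul_of_isDomain (left_ne_zero_of_mul h0) (right_ne_zero_of_mul h0)]
  refine le_trans (le_of_eq ?_) (Nat.le_add_right _ _)
  refine (IsHomogeneous.totalDegree ?_ (left_ne_zero_of_mul h0)).symm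
  rw [prodOthers, map_prod, mul_comm]
  refine IsHomogeneous.pow ?_ m
  simp_rw [hyperplaneProj_linearForm]
  have := isHomogeneous_prod_linearForm (Finset.univ.erase i) fun j => φ j - φ j v • φ i
  rwa [Finset.card_erase_of_mem (Finset.mem_univ i), Finset.card_univ] at this

theorem exists_dvd_sub_mul_prodOthers_pow [Nontrivial ι] (i : ι) {m : ℕ}
    {f : MvPolynomial (Fin (2 + 1)) K} (hf : f ∈ ⨅ a, pointIdeal (p a) ^ m) :
    ∃ c, linearForm (φ i) ∣ f - c * prodOthers φ i ^ m := by
  obtain ⟨v, hv⟩ := exists_dual_apply_eq_one (h.ne_zero i)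
  obtain ⟨c, hc⟩ := h.hyperplaneProj_prodOthers_pow_dvd hv hf
  refine ⟨c, (hyperplaneProj_eq_zero_iff hv _).1 ?_⟩
  rw [map_sub, map_mul, map_pow, sub_eq_zero, ← hyperplaneProj_idem hv f, hc, map_mul, map_pow,
    hyperplaneProj_idem hv, mul_comm]

theorem prodOthers_mem (i : ι) : prodOthers φ i ∈ ⨅ a, pointIdeal (p a) := by
  refine Ideal.mem_iInf.2 fun a => ?_
  obtain ⟨j, k, hjk, hj, hk⟩ := h.exists_lines a
  rcases ne_or_eq j i with hji | rfl
  · exact Ideal.mem_of_dvd _ (linearForm_dvd_prodOthers φ hji) (linearForm_mem_pointIdeal _ hj)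
  · exact Ideal.mem_of_dvd _ (linearForm_dvd_prodOthers φ hjk.symm)
      (linearForm_mem_pointIdeal _ hk)

theorem prod_mem : ∏ i, linearForm (φ i) ∈ ⨅ a, pointIdeal (p a) ^ 2 := by
  refine Ideal.mem_iInf.2 fun a => ?_
  obtain ⟨j, k, hjk, hj, hk⟩ := h.exists_lines a
  rw [prod_linearForm_eq_mul_mul φ hjk, ← mul_assoc, sq]
  exact Ideal.mul_mem_right _ _ (Ideal.mul_mem_mul (linearForm_mem_pointIdeal _ hj)
    (linearForm_mem_pointIdeal _ hk))

theorem mem_of_prod_mul_mem [Nontrivial ι] {m : ℕ} {f : MvPolynomial (Fin (2 + 1)) K}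
    (hf : (∏ i, linearForm (φ i)) * f ∈ ⨅ a, pointIdeal (p a) ^ (m + 2)) :
    f ∈ ⨅ a, pointIdeal (p a) ^ m := by
  refine Ideal.mem_iInf.2 fun a => ?_
  obtain ⟨j, k, hjk, hj, hk⟩ := h.exists_lines a
  have hfa := Ideal.mem_iInf.1 hf a
  rw [prod_linearForm_eq_mul_mul φ hjk, mul_assoc, mul_assoc] at hfa
  refine mul_mem_pointIdeal_pow_of_eval_ne_zero (isHomogeneous_prod_linearForm _ φ) ?_
    (linearForm_mul_mem_pointIdeal_pow hk (h.ne_zero k)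
      (linearForm_mul_mem_pointIdeal_pow hj (h.ne_zero j) hfa))
  rw [map_prod]
  refine Finset.prod_ne_zero_iff.2 fun i hi => ?_
  rw [eval_linearForm]
  simp only [Finset.mem_erase, Finset.mem_univ, and_true] at hi
  exact h.apply_ne_zero hjk hi.2.symm hi.1.symm hj hk

theorem not_linearForm_dvd_prodOthers [Nontrivial ι] (i : ι) :
    ¬ linearForm (φ i) ∣ prodOthers φ i := by
  rw [prodOthers, (prime_linearForm (h.ne_zero i)).dvd_finsetProd_iff]
  rintro ⟨j, hj, hdvd⟩
  exact not_linearForm_dvd (h.pair_indep i j (Finset.ne_of_mem_erase hj).symm) hdvd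

theorem iInf_pointIdeal_pow_two_mul [Nontrivial ι] (r : ℕ) :
    ⨅ a, pointIdeal (p a) ^ (2 * r) = (⨅ a, pointIdeal (p a) ^ 2) ^ r := by
  refine le_antisymm ?_ (le_iInf fun a => ?_)
  · induction r with
    | zero => simp
    | succ r ih =>
      intro f hf
      choose c hc using fun i => h.exists_dvd_sub_mul_prodOthers_pow i hf
      have hsq : ∀ i, prodOthers φ i ^ 2 ∈ ⨅ a, pointIdeal (p a) ^ 2 := fun i =>
        Ideal.mem_iInf.2 fun a => Ideal.pow_mem_pow (Ideal.mem_iInf.1 (h.prodOthers_mem i) a) 2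
      have hsum : ∑ i, c i * prodOthers φ i ^ (2 * (r + 1)) ∈
          (⨅ a, pointIdeal (p a) ^ 2) ^ (r + 1) := by
        refine sum_mem fun i _ => Ideal.mul_mem_left _ _ ?_
        rw [pow_mul]
        exact Ideal.pow_mem_pow (hsq i) _
      have hle : (⨅ a, pointIdeal (p a) ^ 2) ^ (r + 1) ≤ ⨅ a, pointIdeal (p a) ^ (2 * (r + 1)) :=
        le_iInf fun a => by rw [pow_mul]; exact Ideal.pow_right_mono (iInf_le _ a) _
      have hdvd : ∏ i, linearForm (φ i) ∣ f - ∑ i, c i * prodOthers φ i ^ (2 * (r + 1)) := by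
        refine h.prod_dvd fun i => ?_
        rw [← Finset.add_sum_erase _ _ (Finset.mem_univ i), ← sub_sub]
        refine dvd_sub (hc i) (Finset.dvd_sum fun j hj => dvd_mul_of_dvd_right ?_ _)
        exact dvd_pow (linearForm_dvd_prodOthers φ (Finset.ne_of_mem_erase hj).symm) (by simp)
      obtain ⟨g, hg⟩ := hdvd
      have hmem := sub_mem hf (hle hsum)
      rw [hg, mul_add, mul_one] at hmem
      rw [← sub_add_cancel f (∑ i, c i * prodOthers φ i ^ (2 * (r + 1))), hg]
      refine add_mem ?_ hsum
      rw [pow_succ']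
      exact Ideal.mul_mem_mul h.prod_mem (ih (h.mem_of_prod_mul_mem hmem))
  · rw [pow_mul]
    exact Ideal.pow_right_mono (iInf_le _ a) _

theorem card_sub_one_le_totalDegree [Nontrivial ι] {f : MvPolynomial (Fin (2 + 1)) K}
    (hf : f ∈ ⨅ a, pointIdeal (p a)) (h0 : f ≠ 0) : Fintype.card ι - 1 ≤ f.totalDegree := by
  by_cases hdvd : ∀ i, linearForm (φ i) ∣ f
  · obtain ⟨g, rfl⟩ := h.prod_dvd hdvd
    rw [h.totalDegree_prod_mul (right_ne_zero_of_mul h0)]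
    omega
  · push Not at hdvd
    obtain ⟨i, hi⟩ := hdvd
    simpa using h.mul_card_sub_one_le_totalDegree (m := 1) (by simpa using hf) hi

theorem card_mul_le_totalDegree [Nontrivial ι] (r : ℕ) {f : MvPolynomial (Fin (2 + 1)) K}
    (hf : f ∈ ⨅ a, pointIdeal (p a) ^ (2 * r)) (h0 : f ≠ 0) :
    Fintype.card ι * r ≤ f.totalDegree := by
  induction r generalizing f with
  | zero => simp
  | succ r ih =>
    by_cases hdvd : ∀ i, linearForm (φ i) ∣ f
    · obtain ⟨g, rfl⟩ := h.prod_dvd hdvd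
      rw [h.totalDegree_prod_mul (right_ne_zero_of_mul h0), mul_add, mul_one, add_comm]
      rw [mul_add, mul_one] at hf
      exact Nat.add_le_add_left (ih (h.mem_of_prod_mul_mem hf) (right_ne_zero_of_mul h0)) _
    · push Not at hdvd
      obtain ⟨i, hi⟩ := hdvd
      refine le_trans ?_ (h.mul_card_sub_one_le_totalDegree hf hi)
      rw [mul_comm 2, mul_assoc, mul_comm]
      refine Nat.mul_le_mul_left _ ?_
      have := Fintype.one_lt_card (α := ι)
      omega

theorem alphaDeg_iInf [Nontrivial ι] :
    alphaDeg (⨅ a, pointIdeal (p a)) = Fintype.card ι - 1 := by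
  obtain ⟨i⟩ := (inferInstance : Nonempty ι)
  have hmem : Fintype.card ι - 1 ∈ {d : ℕ | ∃ f ∈ ⨅ a, pointIdeal (p a),
      f ≠ 0 ∧ IsHomogeneous f d} :=
    ⟨prodOthers φ i, h.prodOthers_mem i,
      fun h0 => h.not_linearForm_dvd_prodOthers i (h0 ▸ dvd_zero _), isHomogeneous_prodOthers φ i⟩
  refine le_antisymm (Nat.sInf_le hmem) (le_csInf ⟨_, hmem⟩ ?_)
  rintro d ⟨f, hf, h0, hd⟩
  exact (h.card_sub_one_le_totalDegree hf h0).trans hd.totalDegree_le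

theorem alphaDeg_iInf_pow_two_mul [Nontrivial ι] (r : ℕ) :
    alphaDeg (⨅ a, pointIdeal (p a) ^ (2 * r)) = Fintype.card ι * r := by
  have hmem : Fintype.card ι * r ∈ {d : ℕ | ∃ f ∈ ⨅ a, pointIdeal (p a) ^ (2 * r),
      f ≠ 0 ∧ IsHomogeneous f d} := by
    refine ⟨(∏ i, linearForm (φ i)) ^ r, ?_, ?_, ?_⟩
    · rw [h.iInf_pointIdeal_pow_two_mul]
      exact Ideal.pow_mem_pow h.prod_mem r
    · exact pow_ne_zero _ (Finset.prod_ne_zero_iff.2 fun i _ => linearForm_ne_zero (h.ne_zero i))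
    · exact (isHomogeneous_prod_linearForm _ φ).pow r
  refine le_antisymm (Nat.sInf_le hmem) (le_csInf ⟨_, hmem⟩ ?_)
  rintro d ⟨f, hf, h0, hd⟩
  exact (h.card_mul_le_totalDegree r hf h0).trans hd.totalDegree_le

theorem not_linearForm_dvd_sum_prodOthers [Nontrivial ι] (i : ι) :
    ¬ linearForm (φ i) ∣ ∑ j, prodOthers φ j := by
  rw [← Finset.add_sum_erase _ _ (Finset.mem_univ i), dvd_add_left
    (Finset.dvd_sum fun j hj => linearForm_dvd_prodOthers φ (Finset.ne_of_mem_erase hj).symm)]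
  exact h.not_linearForm_dvd_prodOthers i

theorem isRelPrime_sum_prodOthers [Nontrivial ι] (i : ι) :
    IsRelPrime (∑ j, prodOthers φ j) (prodOthers φ i) :=
  IsRelPrime.prod_right fun j _ =>
    ((prime_linearForm (h.ne_zero j)).irreducible.isRelPrime_iff_not_dvd.2
      (h.not_linearForm_dvd_sum_prodOthers j)).symm

theorem betaDeg_iInf_pow [Nontrivial ι] {k : ℕ} (hk : 1 ≤ k) :
    betaDeg (⨅ a, pointIdeal (p a) ^ k) = k * (Fintype.card ι - 1) := by
  obtain ⟨i⟩ := (inferInstance : Nonempty ι)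
  have hcard := Fintype.one_lt_card (α := ι)
  have hmem : k * (Fintype.card ι - 1) ∈ {d : ℕ | ∃ f g : MvPolynomial (Fin (2 + 1)) K,
      f ∈ ⨅ a, pointIdeal (p a) ^ k ∧ g ∈ ⨅ a, pointIdeal (p a) ^ k ∧
      f.IsHomogeneous d ∧ g.IsHomogeneous d ∧
      RingTheory.Sequence.IsRegular (MvPolynomial (Fin (2 + 1)) K) [f, g]} := by
    have hpow : ∀ f ∈ ⨅ a, pointIdeal (p a), f ^ k ∈ ⨅ a, pointIdeal (p a) ^ k := fun f hf =>
      Ideal.mem_iInf.2 fun a => Ideal.pow_mem_pow (Ideal.mem_iInf.1 hf a) k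
    have hF : (∑ j, prodOthers φ j).IsHomogeneous (Fintype.card ι - 1) :=
      IsHomogeneous.sum _ _ _ fun j _ => isHomogeneous_prodOthers φ j
    have hG := isHomogeneous_prodOthers φ i
    refine ⟨(∑ j, prodOthers φ j) ^ k, prodOthers φ i ^ k,
      hpow _ (sum_mem fun j _ => h.prodOthers_mem j), hpow _ (h.prodOthers_mem i),
      mul_comm k _ ▸ hF.pow k, mul_comm k _ ▸ hG.pow k,
      RingTheory.Sequence.isRegular_pair_iff.2 ⟨?_, fun x hx => ?_, ?_⟩⟩
    · exact pow_ne_zero _ fun h0 => h.not_linearForm_dvd_sum_prodOthers i (h0 ▸ dvd_zero _)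
    · exact (h.isRelPrime_sum_prodOthers i).pow.dvd_of_dvd_mul_left hx
    · have hzero : ∀ f : MvPolynomial (Fin (2 + 1)) K, f.IsHomogeneous (Fintype.card ι - 1) →
          f ^ k ∈ RingHom.ker (eval (0 : Fin (2 + 1) → K)) := fun f hf => by
        rw [RingHom.mem_ker, map_pow, eval_zero, constantCoeff_eq, hf.coeff_eq_zero (by simp; omega),
          zero_pow (by omega)]
      refine ne_top_of_le_ne_top (RingHom.ker_ne_top (eval (0 : Fin (2 + 1) → K))) ?_
      rw [Ideal.span_le, Set.pair_subset_iff]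
      exact ⟨hzero _ hF, hzero _ hG⟩
  refine le_antisymm (Nat.sInf_le hmem) (le_csInf ⟨_, hmem⟩ ?_)
  rintro d ⟨f, g, hf, hg, hfd, hgd, hreg⟩
  obtain ⟨h0, hfg, -⟩ := RingTheory.Sequence.isRegular_pair_iff.1 hreg
  by_cases hif : linearForm (φ i) ∣ f
  · refine (h.mul_card_sub_one_le_totalDegree (i := i) hg fun hig => ?_).trans hgd.totalDegree_le
    obtain ⟨f', rfl⟩ := hif
    obtain ⟨g', rfl⟩ := hig
    obtain ⟨c, hc⟩ := hfg f' ⟨g', by ring⟩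
    refine (prime_linearForm (h.ne_zero i)).not_isUnit (IsUnit.of_mul_eq_one c ?_)
    exact mul_right_cancel₀ (right_ne_zero_of_mul h0) (by linear_combination -hc)
  · exact (h.mul_card_sub_one_le_totalDegree hf hif).trans hfd.totalDegree_le

end IsLineStar

end StarConfiguration

/-- for the ideal `I` of a star configuration of `n = C(s,2)` points from
`s ≥ 2` lines in `ℙ²`: `β(I^(k)) = k·α(I) = k(s-1)` for all `k ≥ 1`, and for every even
`m > 0`, `α(I^(m))·β(I^(m)) = m²n` and `(I^(m))^k = I^(mk)` for all `k ≥ 1`. -/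
theorem stmt11 {K : Type*} [Field K] {n : ℕ} (s : ℕ)
    (p : Fin n → ℙ K (Fin (2 + 1) → K))
    (hstar : IsStarConfiguration (N := 2) s p) :
    (∀ k : ℕ, 1 ≤ k →
      betaDeg (⨅ i, (pointIdeal (p i)) ^ k) = k * alphaDeg (⨅ i, pointIdeal (p i)) ∧
      betaDeg (⨅ i, (pointIdeal (p i)) ^ k) = k * (s - 1)) ∧
    (∀ m : ℕ, 0 < m → Even m →
      alphaDeg (⨅ i, (pointIdeal (p i)) ^ m) *
          betaDeg (⨅ i, (pointIdeal (p i)) ^ m) = m ^ 2 * n ∧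
      ∀ k : ℕ, 1 ≤ k →
        (⨅ i, (pointIdeal (p i)) ^ m) ^ k = ⨅ i, (pointIdeal (p i)) ^ (m * k)) := by
  obtain ⟨φ, h⟩ := hstar.exists_isLineStar
  obtain ⟨hs, hn, -⟩ := hstar
  have : Nontrivial (Fin s) := Fin.nontrivial_iff_two_le.2 hs
  have hbeta : ∀ k, 1 ≤ k → betaDeg (⨅ i, pointIdeal (p i) ^ k) = k * (s - 1) := fun k hk => by
    rw [h.betaDeg_iInf_pow hk, Fintype.card_fin]
  refine ⟨fun k hk => ⟨?_, hbeta k hk⟩, fun m hm heven => ?_⟩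
  · rw [hbeta k hk, h.alphaDeg_iInf, Fintype.card_fin]
  · obtain ⟨r, rfl⟩ := even_iff_exists_two_mul.1 heven
    refine ⟨?_, fun k _ => ?_⟩
    · rw [hbeta _ hm, h.alphaDeg_iInf_pow_two_mul, Fintype.card_fin, hn]
      have hchoose : s.choose 2 * 2 = s * (s - 1) := by
        rw [Nat.choose_two_right]
        exact Nat.div_mul_cancel (Nat.even_mul_pred_self s).two_dvd
      calc s * r * (2 * r * (s - 1)) = 2 * r ^ 2 * (s * (s - 1)) := by ring
        _ = 2 * r ^ 2 * (s.choose 2 * 2) := by rw [hchoose]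
        _ = (2 * r) ^ 2 * s.choose 2 := by ring
    · rw [mul_assoc, h.iInf_pointIdeal_pow_two_mul, h.iInf_pointIdeal_pow_two_mul, pow_mul]

end
end
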